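/- Let V be a finite-dimensional complex symplectic vector space, Γ ⊂ Sp(V) a finite subgroup, and H_c the symplectic reflection algebra at parameter c. Then for every c ∈ 𝔭, the regular H_c-bimodule H_c has finite length in the category of H_c-bimodules. -/

import Mathlib

/-!
# Statement 4

Let `V` be a finite-dimensional complex symplectic vector space, `Γ ⊂ Sp(V)` a finite
subgroup, and `H_c` the symplectic reflection algebra of Etingof–Ginzburg at a parameter
`c ∈ 𝔭`.  Then for every `c ∈ 𝔭` the regular `H_c`-bimodule `H_c` has finite length in the
category of `H_c`-bimodules.

Sub-bimodules of the regular bimodule `H_c` are exactly the two-sided ideals of `H_c`, so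
finite length of the regular bimodule is expressed as: the lattice `TwoSidedIdeal H_c` of
two-sided ideals is both well-founded (Artinian, DCC) and co-well-founded (Noetherian, ACC),
which for a module is equivalent to having a finite composition series.
-/

open scoped BigOperators

/-- A finite-dimensional complex symplectic vector space `V` together with a
finite subgroup `Γ` of its symplectic group `Sp(V)`. -/
structure SympGamma where
  /-- the underlying vector space -/
  V : Type
  [acg : AddCommGroup V]
  [mod : Module ℂ V]
  /-- `V` is finite-dimensional -/
  fd : FiniteDimensional ℂ V
  /-- the symplectic form `ω` -/
  ω : V →ₗ[ℂ] V →ₗ[ℂ] ℂ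
  /-- `ω` is alternating -/
  alt : ∀ v, ω v v = 0
  /-- `ω` is nondegenerate -/
  nondeg : ∀ v, (∀ w, ω v w = 0) → v = 0
  /-- the finite subgroup `Γ ⊂ GL(V)` -/
  Γ : Subgroup (V ≃ₗ[ℂ] V)
  /-- `Γ` is finite -/
  fin : Finite Γ
  /-- `Γ` consists of symplectic transformations, i.e. `Γ ⊂ Sp(V)` -/
  symp : ∀ g ∈ Γ, ∀ u v, ω (g u) (g v) = ω u v

attribute [instance] SympGamma.acg SympGamma.mod SympGamma.fd SympGamma.fin

namespace SympGamma

/-- `g ∈ Γ` is a symplectic reflection if `rk(g - 1) = 2`. -/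
def IsSympRefl (S : SympGamma) (g : S.Γ) : Prop :=
  Module.finrank ℂ (LinearMap.range ((g : S.V ≃ₗ[ℂ] S.V).toLinearMap - LinearMap.id)) = 2

/-- The parameter space `𝔭` of the symplectic reflection algebras: `Γ`-invariant
(under conjugation) complex-valued functions on the set of symplectic reflections,
recorded as functions on `Γ` vanishing off the symplectic reflections. -/
def Param (S : SympGamma) : Type :=
  {c : S.Γ → ℂ // (∀ g, ¬ S.IsSympRefl g → c g = 0) ∧ ∀ g h : S.Γ, c (h * g * h⁻¹) = c g}

/-- The property that the family `ωs` consists of the forms `ω_s` (`s` a symplectic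
reflection): `ω_s` has kernel `ker(s-1)` and agrees with `ω` on `im(s-1)`. -/
def IsReflForms (S : SympGamma) (ωs : S.Γ → S.V →ₗ[ℂ] S.V →ₗ[ℂ] ℂ) : Prop :=
  ∀ g : S.Γ, S.IsSympRefl g →
    (∀ u : S.V, (∀ w, ωs g u w = 0) ↔ (g : S.V ≃ₗ[ℂ] S.V) u = u) ∧
    (∀ u v : S.V,
      u ∈ LinearMap.range ((g : S.V ≃ₗ[ℂ] S.V).toLinearMap - LinearMap.id) →
      v ∈ LinearMap.range ((g : S.V ≃ₗ[ℂ] S.V).toLinearMap - LinearMap.id) →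
      ωs g u v = S.ω u v)

/-- The defining relations of the symplectic reflection algebra
`H_c = T(V)#Γ / (u ⊗ v - v ⊗ u - ω(u,v) - Σ_s c_s ω_s(u,v) s)`,
imposed on the free algebra on `V ⊔ Γ` (the first four families of relations carve out
the smash product `T(V)#Γ`, the last one is the symplectic reflection algebra relation). -/
inductive SRARel (S : SympGamma) (ωs : S.Γ → S.V →ₗ[ℂ] S.V →ₗ[ℂ] ℂ) (c : Param S) :
    FreeAlgebra ℂ (S.V ⊕ S.Γ) → FreeAlgebra ℂ (S.V ⊕ S.Γ) → Prop
  | vadd (u v : S.V) : SRARel S ωs c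
      (FreeAlgebra.ι ℂ (Sum.inl (u + v)))
      (FreeAlgebra.ι ℂ (Sum.inl u) + FreeAlgebra.ι ℂ (Sum.inl v))
  | vsmul (a : ℂ) (u : S.V) : SRARel S ωs c
      (FreeAlgebra.ι ℂ (Sum.inl (a • u)))
      (a • FreeAlgebra.ι ℂ (Sum.inl u))
  | gmul (g h : S.Γ) : SRARel S ωs c
      (FreeAlgebra.ι ℂ (Sum.inr (g * h)))
      (FreeAlgebra.ι ℂ (Sum.inr g) * FreeAlgebra.ι ℂ (Sum.inr h))
  | gone : SRARel S ωs c (FreeAlgebra.ι ℂ (Sum.inr (1 : S.Γ))) 1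
  | conj (g : S.Γ) (u : S.V) : SRARel S ωs c
      (FreeAlgebra.ι ℂ (Sum.inr g) * FreeAlgebra.ι ℂ (Sum.inl u))
      (FreeAlgebra.ι ℂ (Sum.inl ((g : S.V ≃ₗ[ℂ] S.V) u)) * FreeAlgebra.ι ℂ (Sum.inr g))
  | main (u v : S.V) : SRARel S ωs c
      (FreeAlgebra.ι ℂ (Sum.inl u) * FreeAlgebra.ι ℂ (Sum.inl v)
        - FreeAlgebra.ι ℂ (Sum.inl v) * FreeAlgebra.ι ℂ (Sum.inl u))
      (algebraMap ℂ _ (S.ω u v)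
        + ∑ᶠ s : S.Γ, (c.1 s * ωs s u v) • FreeAlgebra.ι ℂ (Sum.inr s))

/-- The symplectic reflection algebra `H_c` of Etingof–Ginzburg. -/
abbrev SRA (S : SympGamma) (ωs : S.Γ → S.V →ₗ[ℂ] S.V →ₗ[ℂ] ℂ) (c : Param S) : Type :=
  RingQuot (SRARel S ωs c)

end SympGamma

namespace SRAFin

section Codim
variable {K N : Type*} [Field K] [AddCommGroup N] [Module K N] [FiniteDimensional K N]

/-- The codimension of a subspace. -/
noncomputable def codim (A : Submodule K N) : ℕ := Module.finrank K (N ⧸ A)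

lemma codim_add_finrank (A : Submodule K N) :
    codim A + Module.finrank K A = Module.finrank K N :=
  Submodule.finrank_quotient_add_finrank A

lemma codim_anti {A B : Submodule K N} (h : A ≤ B) : codim B ≤ codim A := by
  have h1 := codim_add_finrank A
  have h2 := codim_add_finrank B
  have h3 := Submodule.finrank_mono h
  omega

lemma codim_inf_add_codim_sup (A B : Submodule K N) :
    codim (A ⊓ B) + codim (A ⊔ B) = codim A + codim B := by
  have h1 := codim_add_finrank A
  have h2 := codim_add_finrank B
  have h3 := codim_add_finrank (A ⊓ B)
  have h4 := codim_add_finrank (A ⊔ B)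
  have h5 := Submodule.finrank_sup_add_finrank_inf_eq A B
  omega

lemma codim_top : codim (⊤ : Submodule K N) = 0 := by
  have h1 := codim_add_finrank (⊤ : Submodule K N)
  rw [finrank_top] at h1
  omega

lemma codim_range_mul_sup_le (f g : Module.End K N) (A : Submodule K N)
    (hf : A ≤ A.comap f) :
    codim (LinearMap.range (f * g) ⊔ A) ≤
      codim (LinearMap.range f ⊔ A) + codim (LinearMap.range g ⊔ A) := by
  obtain ⟨D, hD⟩ := Submodule.exists_isCompl (LinearMap.range g ⊔ A)
  have h1 : LinearMap.range f ⊔ A ≤ (LinearMap.range (f * g) ⊔ A) ⊔ D.map f := by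
    refine sup_le ?_ (le_sup_of_le_left le_sup_right)
    rintro _ ⟨x, rfl⟩
    have hx : x ∈ (LinearMap.range g ⊔ A) ⊔ D := by rw [hD.sup_eq_top]; trivial
    obtain ⟨y, hy, d, hd, rfl⟩ := Submodule.mem_sup.1 hx
    obtain ⟨_, ⟨w, rfl⟩, a, ha, rfl⟩ := Submodule.mem_sup.1 hy
    rw [map_add, map_add]
    exact Submodule.add_mem_sup (Submodule.add_mem_sup ⟨w, rfl⟩ (hf ha))
      (Submodule.mem_map_of_mem hd)
  have h2 := Submodule.finrank_mono h1
  have h3 := Submodule.finrank_add_le_finrank_add_finrank (LinearMap.range (f * g) ⊔ A)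
    (D.map f)
  have h4 := Submodule.finrank_map_le f D
  have h5 := Submodule.finrank_add_eq_of_isCompl hD
  have h6 := codim_add_finrank (LinearMap.range (f * g) ⊔ A)
  have h7 := codim_add_finrank (LinearMap.range f ⊔ A)
  have h8 := codim_add_finrank (LinearMap.range g ⊔ A)
  omega

omit [FiniteDimensional K N] in
lemma le_comap_sub_smul {A : Submodule K N} {y z : Module.End K N} (hy : A ≤ A.comap y)
    (hz : A ≤ A.comap z) (c : K) : A ≤ A.comap (y - c • z) := fun _ ha =>
  A.sub_mem (hy ha) (A.smul_mem c (hz ha))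

lemma exists_codim_range_sub_smul_sup_le [CharZero K] (y z : Module.End K N)
    (hyz : Commute y z) (A : Submodule K N) (hy : A ≤ A.comap y) (hz : A ≤ A.comap z)
    (k : ℕ) (hk : 0 < k) :
    ∃ c : K, k * codim (LinearMap.range (y - c • z) ⊔ A) ≤
      codim A + k ^ 2 * codim (LinearMap.range y ⊔ LinearMap.range z ⊔ A) := by
  set δ := codim (LinearMap.range y ⊔ LinearMap.range z ⊔ A) with hδ
  let F : ℕ → Module.End K N := fun i => y - (i : K) • z
  let B : ℕ → Submodule K N := fun i => LinearMap.range (F i) ⊔ A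
  have hcomm : ∀ i j, Commute (F i) (F j) := fun i j =>
    (((Commute.refl y).sub_right (hyz.smul_right _)).sub_left
      ((hyz.symm.smul_left _).sub_right (((Commute.refl z).smul_left _).smul_right _)))
  have hstab : ∀ i j, B i ≤ (B i).comap (F j) := by
    intro i j
    refine sup_le ?_ ?_
    · rintro _ ⟨x, rfl⟩
      refine Submodule.mem_sup_left ⟨F j x, ?_⟩
      exact LinearMap.congr_fun (hcomm i j).eq x
    · exact fun a ha => Submodule.mem_sup_right (le_comap_sub_smul hy hz _ ha)
  have hsup : ∀ i j, i ≠ j → codim (LinearMap.range (F j) ⊔ B i) ≤ δ := by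
    intro i j hij
    apply codim_anti
    have hne : (j : K) - i ≠ 0 := sub_ne_zero.2 (by exact_mod_cast hij.symm)
    have hz' : LinearMap.range z ≤ LinearMap.range (F j) ⊔ B i := by
      rintro _ ⟨w, rfl⟩
      have : z w = ((j : K) - i)⁻¹ • (F i w - F j w) := by
        rw [eq_inv_smul_iff₀ hne]
        simp only [F, LinearMap.sub_apply, LinearMap.smul_apply, sub_smul]
        abel
      rw [this]
      exact Submodule.smul_mem _ _ (Submodule.sub_mem _
        (Submodule.mem_sup_right (Submodule.mem_sup_left ⟨w, rfl⟩))
        (Submodule.mem_sup_left ⟨w, rfl⟩))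
    refine sup_le (sup_le ?_ hz') (le_sup_of_le_right le_sup_right)
    rintro _ ⟨w, rfl⟩
    have : y w = F j w + (j : K) • z w := by simp [F]
    rw [this]
    exact Submodule.add_mem _ (Submodule.mem_sup_left ⟨w, rfl⟩)
      (Submodule.smul_mem _ _ (hz' ⟨w, rfl⟩))
  let P : ℕ → Module.End K N := fun n => Nat.rec 1 (fun i p => F i * p) n
  have hPc : ∀ n i, Commute (F i) (P n) := by
    intro n i
    induction n with
    | zero => exact Commute.one_right _
    | succ n ih => exact (hcomm i n).mul_right ih
  let I : ℕ → Submodule K N := fun n => Nat.rec ⊤ (fun i p => p ⊓ B i) n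
  have hPI : ∀ n, LinearMap.range (P n) ⊔ A ≤ I n := by
    intro n
    induction n with
    | zero => exact le_top
    | succ n ih =>
      refine le_inf (le_trans (sup_le_sup_right ?_ _) ih) (sup_le_sup_right ?_ _)
      · rintro _ ⟨x, rfl⟩
        exact ⟨F n x, (LinearMap.congr_fun (hPc n n).eq x).symm⟩
      · rintro _ ⟨x, rfl⟩
        exact ⟨P n x, rfl⟩
  have hPk : ∀ j n, n ≤ j → codim (LinearMap.range (P n) ⊔ B j) ≤ n * δ := by
    intro j n
    induction n with
    | zero =>
      intro _
      have : LinearMap.range (P 0) = ⊤ := LinearMap.range_id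
      rw [this, top_sup_eq, codim_top]
      simp
    | succ n ih =>
      intro hn
      have h1 := codim_range_mul_sup_le (F n) (P n) (B j) (hstab j n)
      have h2 := hsup j n (by omega)
      have h3 := ih (by omega)
      calc _ ≤ _ := h1
        _ ≤ δ + n * δ := add_le_add h2 h3
        _ = _ := by ring
  have hIsup : ∀ n, codim (I n ⊔ B n) ≤ n * δ := fun n =>
    (codim_anti (sup_le_sup_right (le_sup_left.trans (hPI n)) _)).trans (hPk n n le_rfl)
  have hsum : ∀ n, n ≤ k → ∑ i ∈ Finset.range n, codim (B i) ≤ codim (I n) + n * k * δ := by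
    intro n
    induction n with
    | zero => simp
    | succ n ih =>
      intro hn
      rw [Finset.sum_range_succ]
      have h1 := ih (by omega)
      have h2 := codim_inf_add_codim_sup (I n) (B n)
      have h3 := hIsup n
      have h4 : n * δ ≤ k * δ := Nat.mul_le_mul_right _ (by omega)
      change _ ≤ codim (I n ⊓ B n) + _
      have h5 : (n + 1) * k * δ = n * k * δ + k * δ := by ring
      omega
  have htot := hsum k le_rfl
  have hIA : codim (I k) ≤ codim A := codim_anti (le_sup_right.trans (hPI k))
  by_contra! hcon
  have : ∑ i ∈ Finset.range k, (k * codim (B i)) > k * (codim A + k ^ 2 * δ) := by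
    calc k * (codim A + k ^ 2 * δ) = ∑ i ∈ Finset.range k, (codim A + k ^ 2 * δ) := by simp
      _ < _ := Finset.sum_lt_sum_of_nonempty (Finset.nonempty_range_iff.2 hk.ne')
          (fun i _ => hcon i)
  rw [← Finset.mul_sum] at this
  have h6 := Nat.lt_of_mul_lt_mul_left this
  have h7 : k ^ 2 * δ = k * k * δ := by ring
  omega

end Codim

/-- The constants in `exists_codim_range_sum_le`. -/
def koszulConst : ℕ → ℕ → ℕ
  | 0, k => k
  | m + 1, k => koszulConst m (4 * k ^ 2)

lemma exists_codim_range_sum_le {K N : Type*} [Field K] [CharZero K] [AddCommGroup N]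
    [Module K N] [FiniteDimensional K N] (m : ℕ) : ∀ (k : ℕ) (_ : 0 < k)
    (x : Fin m → Module.End K N) (_ : ∀ i j, Commute (x i) (x j)) (A : Submodule K N)
    (_ : ∀ i, A ≤ A.comap (x i)), ∃ a : Fin m → K,
      k * codim (LinearMap.range (∑ i, a i • x i) ⊔ A) ≤
        codim A + koszulConst m k * codim ((⨆ i, LinearMap.range (x i)) ⊔ A) := by
  induction m with
  | zero =>
    intro k hk x _ A _
    refine ⟨0, ?_⟩
    simp [koszulConst]
  | succ m ih =>
    intro k hk x hx A hA
    set z := x (Fin.last m)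
    have hA' : ∀ i : Fin m, LinearMap.range z ⊔ A ≤
        (LinearMap.range z ⊔ A).comap (x i.castSucc) := by
      intro i
      refine sup_le ?_ fun a ha => Submodule.mem_sup_right (hA _ ha)
      rintro _ ⟨w, rfl⟩
      exact Submodule.mem_sup_left ⟨x i.castSucc w,
        LinearMap.congr_fun (hx (Fin.last m) i.castSucc).eq w⟩
    obtain ⟨a, ha⟩ := ih (4 * k ^ 2) (by positivity) (fun i => x i.castSucc)
      (fun i j => hx _ _) (LinearMap.range z ⊔ A) hA'
    set y := ∑ i : Fin m, a i • x i.castSucc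
    have hyz : Commute y z := Commute.sum_left _ _ _ fun i _ => (hx _ _).smul_left _
    have hyA : A ≤ A.comap y := by
      intro w hw
      simp only [y, Submodule.mem_comap, LinearMap.sum_apply, LinearMap.smul_apply]
      exact A.sum_mem fun i _ => A.smul_mem _ (hA _ hw)
    obtain ⟨c, hc⟩ := exists_codim_range_sub_smul_sup_le y z hyz A hyA (hA _) (2 * k)
      (by omega)
    refine ⟨Fin.snoc a (-c), ?_⟩
    have e1 : ∑ i, (Fin.snoc a (-c) : Fin (m + 1) → K) i • x i = y - c • z := by
      rw [Fin.sum_univ_castSucc]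
      simp [y, z, sub_eq_add_neg]
    have e2 : (⨆ i : Fin m, LinearMap.range (x i.castSucc)) ⊔ (LinearMap.range z ⊔ A) =
        (⨆ i, LinearMap.range (x i)) ⊔ A := by
      rw [← sup_assoc]
      congr 1
      apply le_antisymm
      · exact sup_le (iSup_le fun i => le_iSup (fun i => LinearMap.range (x i)) _)
          (le_iSup (fun i => LinearMap.range (x i)) _)
      · refine iSup_le fun i => ?_
        induction i using Fin.lastCases with
        | last => exact le_sup_right
        | cast i =>
          exact le_sup_of_le_left (le_iSup (fun i : Fin m => LinearMap.range (x i.castSucc)) i)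
    rw [e1]
    rw [e2] at ha
    change _ ≤ codim A + koszulConst m (4 * k ^ 2) * _
    have h3 : codim (LinearMap.range z ⊔ A) ≤ codim A := codim_anti le_sup_right
    rw [← sup_assoc] at ha
    have h4 : (2 * k) ^ 2 = 4 * k ^ 2 := by ring
    rw [h4] at hc
    have h5 : 2 * k * codim (LinearMap.range (y - c • z) ⊔ A) =
      2 * (k * codim (LinearMap.range (y - c • z) ⊔ A)) := by ring
    omega
section Trace
variable {K N : Type*} [Field K] [AddCommGroup N] [Module K N] [FiniteDimensional K N]

open Module.Basis in
lemma trace_eq_trace_restrict_add_trace_mapQ (W : Submodule K N) (e : N →ₗ[K] N)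
    (he : W ≤ W.comap e) :
    LinearMap.trace K N e =
      LinearMap.trace K W (e.restrict he) + LinearMap.trace K (N ⧸ W) (W.mapQ W e he) := by
  let bW := Module.Free.chooseBasis K W
  let bQ := Module.Free.chooseBasis K (N ⧸ W)
  let b := sumQuot bW bQ
  rw [LinearMap.trace_eq_matrix_trace K b, LinearMap.trace_eq_matrix_trace K bW,
    LinearMap.trace_eq_matrix_trace K bQ]
  simp only [Matrix.trace, Matrix.diag, Fintype.sum_sum_type]
  congr 1
  · refine Finset.sum_congr rfl fun i _ => ?_
    simp only [b, LinearMap.toMatrix_apply, sumQuot_inl]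
    apply sumQuot_repr_inl_of_mem
  · refine Finset.sum_congr rfl fun i _ => ?_
    simp only [LinearMap.toMatrix_apply, sumQuot_repr_inr, b]
    rw [← sumQuot_inr bW bQ i, W.mapQ_apply]
    simp

/-- `t` is a complex number of absolute value at most `r`. -/
def TrBound {K : Type*} [Field K] [Algebra ℂ K] (t : K) (r : ℝ) : Prop :=
  ∃ τ : ℂ, algebraMap ℂ K τ = t ∧ ‖τ‖ ≤ r

variable [Algebra ℂ K]

omit [AddCommGroup N] [Module K N] [FiniteDimensional K N] in
lemma TrBound.mono {t : K} {r s : ℝ} (h : TrBound t r) (hrs : r ≤ s) : TrBound t s :=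
  let ⟨τ, h1, h2⟩ := h
  ⟨τ, h1, h2.trans hrs⟩

omit [AddCommGroup N] [Module K N] [FiniteDimensional K N] in
lemma TrBound.mul {t : K} {r : ℝ} (h : TrBound t r) (c : ℂ) :
    TrBound (algebraMap ℂ K c * t) (‖c‖ * r) := by
  obtain ⟨τ, rfl, h2⟩ := h
  exact ⟨c * τ, map_mul _ _ _, by rw [norm_mul]; gcongr⟩

omit [AddCommGroup N] [Module K N] [FiniteDimensional K N] in
lemma TrBound.sum {ι : Type*} (s : Finset ι) {t : ι → K} {r : ι → ℝ}
    (h : ∀ i ∈ s, TrBound (t i) (r i)) : TrBound (∑ i ∈ s, t i) (∑ i ∈ s, r i) := by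
  induction s using Finset.cons_induction with
  | empty => exact ⟨0, by simp⟩
  | cons a s ha ih =>
    obtain ⟨τ, h1, h2⟩ := h a (by simp)
    obtain ⟨τ', h1', h2'⟩ := ih fun i hi => h i (by simp [hi])
    rw [Finset.sum_cons, Finset.sum_cons]
    exact ⟨τ + τ', by rw [map_add, h1, h1'], (norm_add_le _ _).trans (by gcongr)⟩

lemma trBound_trace_of_pow_eq_one (G : Module.End K N) (e : ℕ) (he : 0 < e) (hG : G ^ e = 1) :
    TrBound (LinearMap.trace K N G) (Module.finrank K N) := by
  classical
  let b := Module.finBasis K N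
  let M := LinearMap.toMatrix b b G
  let L := AlgebraicClosure K
  let M' : Matrix _ _ L := M.map (algebraMap K L)
  have hM' : M' ^ e = 1 := by
    have h1 : M ^ e = 1 := by
      have h2 : (LinearMap.toMatrixAlgEquiv b G) ^ e = 1 := by
        rw [← map_pow, hG, map_one]
      exact h2
    have h3 : ((algebraMap K L).mapMatrix M) ^ e = 1 := by rw [← map_pow, h1, map_one]
    exact h3
  have hroot : ∀ μ ∈ M'.charpoly.roots, ∃ τ : ℂ, algebraMap ℂ L τ = μ ∧ ‖τ‖ = 1 := by
    intro μ hμ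
    have h1 : M'.charpoly.IsRoot μ := Polynomial.isRoot_of_mem_roots hμ
    have h2 : Module.End.HasEigenvalue (Matrix.toLin' M') μ := by
      rw [Module.End.hasEigenvalue_iff_isRoot_charpoly]
      rwa [Matrix.charpoly_toLin']
    have h3 : μ ^ e = 1 := by
      obtain ⟨v, hv⟩ := h2.exists_hasEigenvector
      have h4 := hv.pow_apply e
      rw [← Matrix.toLin'_pow, hM', Matrix.toLin'_one, LinearMap.id_apply] at h4
      have h5 : (μ ^ e - 1) • v = 0 := by rw [sub_smul, ← h4, one_smul, sub_self]
      rcases smul_eq_zero.1 h5 with h6 | h6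
      · exact sub_eq_zero.1 h6
      · exact absurd h6 hv.2
    have hp := Complex.isPrimitiveRoot_exp e he.ne'
    have hp' := hp.map_of_injective (f := algebraMap ℂ L) (algebraMap ℂ L).injective
    have : NeZero e := ⟨he.ne'⟩
    obtain ⟨i, _, hi⟩ := hp'.eq_pow_of_pow_eq_one h3
    refine ⟨Complex.exp (2 * Real.pi * Complex.I / e) ^ i, by rw [map_pow, hi], ?_⟩
    rw [norm_pow, hp.norm'_eq_one he.ne', one_pow]
  have hsum : ∀ s : Multiset L, (∀ μ ∈ s, ∃ τ : ℂ, algebraMap ℂ L τ = μ ∧ ‖τ‖ = 1) →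
      ∃ τ : ℂ, algebraMap ℂ L τ = s.sum ∧ ‖τ‖ ≤ s.card := by
    intro s
    induction s using Multiset.induction with
    | empty => intro _; exact ⟨0, by simp⟩
    | cons a s ih =>
      intro hs
      obtain ⟨τ, h1, h2⟩ := hs a (by simp)
      obtain ⟨τ', h1', h2'⟩ := ih fun μ hμ => hs μ (by simp [hμ])
      refine ⟨τ + τ', by simp [h1, h1'], (norm_add_le _ _).trans ?_⟩
      rw [h2, Multiset.card_cons]
      push_cast
      linarith
  obtain ⟨τ, h1, h2⟩ := hsum _ hroot
  rw [← Matrix.trace_eq_sum_roots_charpoly] at h1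
  refine ⟨τ, ?_, h2.trans ?_⟩
  · apply (algebraMap K L).injective
    rw [← IsScalarTower.algebraMap_apply, h1, LinearMap.trace_eq_matrix_trace K b]
    exact (AddMonoidHom.map_trace (algebraMap K L).toAddMonoidHom M).symm
  · have := Polynomial.card_roots' M'.charpoly
    rw [Matrix.charpoly_natDegree_eq_dim, Fintype.card_fin] at this
    exact_mod_cast this

lemma trBound_trace_of_homotopy (d ι τ H f : Module.End K N) (hd : d * d = 0)
    (hι : d * ι + ι * d = f) (hτ : τ * τ = 1) (hdτ : d * τ + τ * d = 0)
    (hHd : H * d = d * H) (hHτ : H * τ = τ * H) (e : ℕ) (he : 0 < e) (hH : H ^ e = 1) :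
    TrBound (LinearMap.trace K N (τ * H)) (codim (LinearMap.range f)) := by
  set Z := LinearMap.ker d with hZ
  set Φ := τ * H with hΦ
  have hΦd : ∀ x, d (Φ x) = - Φ (d x) := by
    intro x
    have h1 := LinearMap.congr_fun hdτ (H x)
    have h2 := LinearMap.congr_fun hHd x
    simp only [LinearMap.add_apply, Module.End.mul_apply, LinearMap.zero_apply] at h1 h2
    rw [eq_neg_iff_add_eq_zero]
    simpa [hΦ, h2] using h1
  have hΦZ : Z ≤ Z.comap Φ := by
    intro x hx
    have hx' : d x = 0 := hx
    change d (Φ x) = 0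
    rw [hΦd, hx', map_zero, neg_zero]
  have hdd : ∀ x, d (d x) = 0 := fun x => LinearMap.congr_fun hd x
  set d' : N →ₗ[K] Z := d.codRestrict Z hdd with hd'
  set W : Submodule K Z := LinearMap.range d'
  set ΦZ : Module.End K Z := Φ.restrict hΦZ
  have hΦW : W ≤ W.comap ΦZ := by
    rintro _ ⟨x, rfl⟩
    refine ⟨-(Φ x), ?_⟩
    apply Subtype.ext
    change d (-(Φ x)) = Φ (d x)
    rw [map_neg, hΦd, neg_neg]
  have h1 := trace_eq_trace_restrict_add_trace_mapQ Z Φ hΦZ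
  have h2 := trace_eq_trace_restrict_add_trace_mapQ W ΦZ hΦW
  have hker : LinearMap.ker d' = Z := by
    ext x
    exact Subtype.ext_iff
  let E : (N ⧸ Z) ≃ₗ[K] W := (Submodule.quotEquivOfEq _ _ hker.symm).trans
    d'.quotKerEquivRange
  have h3 : LinearMap.trace K (N ⧸ Z) (Z.mapQ Z Φ hΦZ) =
      - LinearMap.trace K W (ΦZ.restrict hΦW) := by
    rw [← LinearMap.trace_conj' _ E, ← map_neg]
    congr 1
    ext w
    obtain ⟨x, rfl⟩ := E.surjective w
    obtain ⟨x, rfl⟩ := Z.mkQ_surjective x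
    have hE : ∀ x : N, ((E (Z.mkQ x) : Z) : N) = d x := fun x => rfl
    rw [LinearEquiv.conj_apply]
    simp only [LinearMap.comp_apply, LinearEquiv.coe_coe, LinearEquiv.symm_apply_apply,
      LinearMap.neg_apply]
    have : (Z.mapQ Z Φ hΦZ) (Z.mkQ x) = Z.mkQ (Φ x) := rfl
    rw [this, hE, hΦd]
    simp only [Submodule.coe_neg, LinearMap.restrict_apply, ΦZ, hE]
  have h4 : LinearMap.trace K N Φ =
      LinearMap.trace K (Z ⧸ W) (W.mapQ W ΦZ hΦW) := by
    rw [h1, h2, h3]; ring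
  have hΦpow : Φ ^ (2 * e) = 1 := by
    have hc : Commute τ H := hHτ.symm
    rw [hΦ, hc.mul_pow, pow_mul, pow_two, hτ, one_pow, mul_comm 2 e, pow_mul, hH, one_pow,
      one_mul]
  have hQ : (W.mapQ W ΦZ hΦW) ^ (2 * e) = 1 := by
    have hn : ∀ n (z : Z), ((W.mapQ W ΦZ hΦW) ^ n) (W.mkQ z) = W.mkQ ((ΦZ ^ n) z) ∧
        (((ΦZ ^ n) z : Z) : N) = (Φ ^ n) z := by
      intro n z
      induction n with
      | zero => exact ⟨rfl, rfl⟩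
      | succ n ih =>
        rw [pow_succ', pow_succ', pow_succ', Module.End.mul_apply, Module.End.mul_apply,
          Module.End.mul_apply, ih.1, ← ih.2]
        exact ⟨rfl, rfl⟩
    apply LinearMap.ext
    intro q
    obtain ⟨z, rfl⟩ := W.mkQ_surjective q
    have h5 : (ΦZ ^ (2 * e)) z = z := Subtype.ext (by rw [(hn _ z).2, hΦpow]; rfl)
    rw [(hn _ z).1, h5]
    rfl
  rw [h4]
  refine (trBound_trace_of_pow_eq_one _ (2 * e) (by omega) hQ).mono ?_
  have hfZ : ∀ x : Z, f x = d (ι x) := by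
    intro x
    have h5 := LinearMap.congr_fun hι x
    have h6 : d (x : N) = 0 := x.2
    simp only [LinearMap.add_apply, Module.End.mul_apply, h6, map_zero, add_zero] at h5
    exact h5.symm
  let fZ : Z →ₗ[K] Z := (f.comp Z.subtype).codRestrict Z fun x => by
    change d (f x) = 0
    rw [hfZ, hdd]
  have h5 : LinearMap.range fZ ≤ W := by
    rintro _ ⟨x, rfl⟩
    exact ⟨ι x, Subtype.ext (hfZ x).symm⟩
  have h6 := LinearMap.finrank_range_add_finrank_ker fZ
  have h7 := LinearMap.finrank_range_add_finrank_ker f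
  have h8 : Module.finrank K (LinearMap.ker fZ) ≤ Module.finrank K (LinearMap.ker f) := by
    rw [← Submodule.finrank_map_subtype_eq Z (LinearMap.ker fZ)]
    apply Submodule.finrank_mono
    rintro _ ⟨x, hx, rfl⟩
    exact congrArg Subtype.val (show fZ x = 0 from hx)
  have h9 := codim_add_finrank (LinearMap.range f)
  have h10 := codim_add_finrank W
  have h11 := Submodule.finrank_mono h5
  have : Module.finrank K (Z ⧸ W) ≤ codim (LinearMap.range f) := by
    change codim W ≤ _
    omega
  exact_mod_cast this

omit [Algebra ℂ K] in
lemma codim_range_prodMap (f : Module.End K N) :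
    codim (LinearMap.range (LinearMap.prodMap f f)) = 2 * codim (LinearMap.range f) := by
  have h1 := codim_add_finrank (LinearMap.range (LinearMap.prodMap f f))
  have h2 := codim_add_finrank (LinearMap.range f)
  have h4 : LinearMap.range (LinearMap.prodMap f f) =
      LinearMap.range (LinearMap.prodMap (LinearMap.range f).subtype
        (LinearMap.range f).subtype) := by
    rw [LinearMap.range_prodMap, LinearMap.range_prodMap, Submodule.range_subtype]
  have h5 : Module.finrank K (LinearMap.range (LinearMap.prodMap f f)) =
      2 * Module.finrank K (LinearMap.range f) := by
    rw [h4, LinearMap.finrank_range_of_inj, Module.finrank_prod, two_mul]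
    exact Function.Injective.prodMap Subtype.val_injective Subtype.val_injective
  rw [Module.finrank_prod] at h1
  omega
end Trace

section Koszul
universe u v
variable {K : Type u} [Field K] [Algebra ℂ K]

lemma trBound_koszul (e : ℕ) (he : 0 < e) (r : ℕ) : ∀ {E : Type v} [AddCommGroup E] [Module K E]
    [FiniteDimensional K E] (d ι τ H f : Module.End K E) (_ : d * d = 0)
    (_ : d * ι + ι * d = f) (_ : τ * τ = 1) (_ : d * τ + τ * d = 0)
    (_ : H * d = d * H) (_ : H * τ = τ * H) (_ : H ^ e = 1)
    (y : Fin r → Module.End K E) (_ : ∀ i j, Commute (y i) (y j))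
    (_ : ∀ i, Commute (y i) d) (_ : ∀ i, Commute (y i) ι) (_ : ∀ i, Commute (y i) τ)
    (μ : Fin r → ℂ) (_ : ∀ i, μ i ^ e = 1)
    (_ : ∀ i, H * y i = algebraMap ℂ K (μ i) • (y i * H)) (a : Fin r → K),
    TrBound (algebraMap ℂ K (∏ i, (1 - (μ i)⁻¹)) * LinearMap.trace K E (τ * H))
      (2 ^ r * codim (LinearMap.range (f + ∑ i, a i • y i))) := by
  induction r with
  | zero =>
    intro E _ _ _ d ι τ H f hd hι hτ hdτ hHd hHτ hH y _ _ _ _ μ _ _ a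
    simpa using trBound_trace_of_homotopy d ι τ H f hd hι hτ hdτ hHd hHτ e he hH
  | succ r ih =>
    intro E _ _ _ d ι τ H f hd hι hτ hdτ hHd hHτ hH y hyy hyd hyι hyτ μ hμ hHy a
    have ap : ∀ {f g : Module.End K E}, f = g → ∀ x, f x = g x :=
      fun h x => LinearMap.congr_fun h x
    have hd' : ∀ x, d (d x) = 0 := ap hd
    have hι' : ∀ x, d (ι x) + ι (d x) = f x := ap hι
    have hτ' : ∀ x, τ (τ x) = x := ap hτ
    have hdτ' : ∀ x, d (τ x) + τ (d x) = 0 := ap hdτ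
    have hHd' : ∀ x, H (d x) = d (H x) := ap hHd
    have hHτ' : ∀ x, H (τ x) = τ (H x) := ap hHτ
    have hyy' : ∀ i j x, y i (y j x) = y j (y i x) := fun i j => ap (hyy i j).eq
    have hyd' : ∀ i x, y i (d x) = d (y i x) := fun i => ap (hyd i).eq
    have hyι' : ∀ i x, y i (ι x) = ι (y i x) := fun i => ap (hyι i).eq
    have hyτ' : ∀ i x, y i (τ x) = τ (y i x) := fun i => ap (hyτ i).eq
    have hHy' : ∀ i x, H (y i x) = algebraMap ℂ K (μ i) • y i (H x) := fun i => ap (hHy i)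
    have hμ0 : ∀ i, μ i ≠ 0 := fun i h => by
      have := hμ i
      rw [h, zero_pow he.ne'] at this
      exact zero_ne_one this
    set ν : K := algebraMap ℂ K (μ 0)⁻¹ with hν
    have hνμ : ν * algebraMap ℂ K (μ 0) = 1 := by
      rw [hν, ← map_mul, inv_mul_cancel₀ (hμ0 0), map_one]
    let d₁ : Module.End K (E × E) :=
      LinearMap.prod (d.comp (LinearMap.fst K E E))
        ((y 0).comp (LinearMap.fst K E E) - d.comp (LinearMap.snd K E E))
    let ι₁ : Module.End K (E × E) :=
      LinearMap.prod (ι.comp (LinearMap.fst K E E) + a 0 • LinearMap.snd K E E)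
        (-(ι.comp (LinearMap.snd K E E)))
    let τ₁ : Module.End K (E × E) := LinearMap.prodMap τ (-τ)
    let H₁ : Module.End K (E × E) := LinearMap.prodMap H (ν • H)
    let g := f + a 0 • y 0
    have hd₁ : ∀ p q, d₁ (p, q) = (d p, y 0 p - d q) := fun _ _ => rfl
    have hι₁ : ∀ p q, ι₁ (p, q) = (ι p + a 0 • q, -ι q) := fun _ _ => rfl
    have hτ₁ : ∀ p q, τ₁ (p, q) = (τ p, -τ q) := fun _ _ => rfl
    have key := ih d₁ ι₁ τ₁ H₁ (LinearMap.prodMap g g) ?_ ?_ ?_ ?_ ?_ ?_ ?_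
      (fun i => LinearMap.prodMap (y i.succ) (y i.succ)) ?_ ?_ ?_ ?_ (fun i => μ i.succ)
      (fun i => hμ _) ?_ (fun i => a i.succ)
    · have e1 : LinearMap.prodMap g g + ∑ i : Fin r, a i.succ •
          LinearMap.prodMap (y i.succ) (y i.succ) =
          LinearMap.prodMap (f + ∑ i, a i • y i) (f + ∑ i, a i • y i) := by
        rw [Fin.sum_univ_succ, ← add_assoc]
        apply LinearMap.ext
        rintro ⟨p, q⟩
        ext <;> simp [g, Prod.fst_sum, Prod.snd_sum]
      rw [e1, codim_range_prodMap] at key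
      have e2 : LinearMap.trace K (E × E) (τ₁ * H₁) =
          (1 - ν) * LinearMap.trace K E (τ * H) := by
        have : τ₁ * H₁ = LinearMap.prodMap (τ * H) (-(ν • (τ * H))) := by
          apply LinearMap.ext
          rintro ⟨p, q⟩
          simp [τ₁, H₁]
        rw [this, LinearMap.trace_prodMap']
        simp only [map_neg, map_smul, smul_eq_mul]
        ring
      rw [e2, ← mul_assoc] at key
      rw [Fin.prod_univ_succ, mul_comm (1 - (μ 0)⁻¹), map_mul, map_sub, map_one, ← hν]
      refine key.mono (le_of_eq ?_)
      push_cast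
      ring
    · apply LinearMap.ext; rintro ⟨p, q⟩
      simp [d₁, hd', hyd']
    · apply LinearMap.ext; rintro ⟨p, q⟩
      have hg : ∀ p q, LinearMap.prodMap g g (p, q) = (f p + a 0 • y 0 p, f q + a 0 • y 0 q) :=
        fun _ _ => rfl
      rw [hg, LinearMap.add_apply, Module.End.mul_apply, Module.End.mul_apply, hι₁, hd₁, hd₁, hι₁,
        Prod.mk_add_mk, ← hι', ← hι']
      simp only [map_add, map_neg, map_sub, map_smul, smul_sub, hyι']
      congr 1 <;> abel
    · apply LinearMap.ext; rintro ⟨p, q⟩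
      simp [τ₁, hτ']
    · apply LinearMap.ext; rintro ⟨p, q⟩
      have h1 := hdτ' p
      have h2 := hdτ' q
      rw [LinearMap.add_apply, Module.End.mul_apply, Module.End.mul_apply, hτ₁, hd₁, hd₁, hτ₁,
        Prod.mk_add_mk, h1, LinearMap.zero_apply, Prod.mk_eq_zero]
      refine ⟨rfl, ?_⟩
      rw [map_neg, map_sub, hyτ']
      rw [← h2]; abel
    · apply LinearMap.ext; rintro ⟨p, q⟩
      simp [d₁, H₁, hHd', hHy', smul_sub, smul_smul, hνμ]
    · apply LinearMap.ext; rintro ⟨p, q⟩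
      simp [τ₁, H₁, hHτ']
    · have h1 : ∀ n, H₁ ^ n = LinearMap.prodMap (H ^ n) (ν ^ n • H ^ n) := by
        intro n
        induction n with
        | zero => rw [pow_zero, pow_zero, pow_zero, one_smul]; rfl
        | succ n ihn =>
          rw [pow_succ, ihn]
          apply LinearMap.ext; rintro ⟨p, q⟩
          simp [H₁, pow_succ, smul_smul, mul_comm]
      rw [h1, hH, hν, ← map_pow, inv_pow, hμ, inv_one, map_one, one_smul]
      rfl
    · intro i j
      apply LinearMap.ext; rintro ⟨p, q⟩
      simp [hyy' i.succ j.succ]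
    · intro i
      apply LinearMap.ext; rintro ⟨p, q⟩
      simp [d₁, hyd', hyy' i.succ 0]
    · intro i
      apply LinearMap.ext; rintro ⟨p, q⟩
      simp [ι₁, hyι']
    · intro i
      apply LinearMap.ext; rintro ⟨p, q⟩
      simp [τ₁, hyτ']
    · intro i
      apply LinearMap.ext; rintro ⟨p, q⟩
      simp only [H₁, Module.End.mul_apply, LinearMap.prodMap_apply, LinearMap.smul_apply, hHy',
        map_smul, Prod.smul_mk]
      rw [smul_comm]

/-- A finite order operator `h` which scales commuting operators `x i` by scalars different
from `1` has small trace unless the `x i` are far from being jointly surjective. -/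
lemma exists_trBound_trace (e : ℕ) (he : 0 < e) (m : ℕ) (μ : Fin m → ℂ) (hμ : ∀ i, μ i ^ e = 1)
    (hμ1 : ∀ i, μ i ≠ 1) (ε : ℝ) (hε : 0 < ε) : ∃ C : ℝ, 0 ≤ C ∧
    ∀ {N : Type v} [AddCommGroup N] [Module K N] [FiniteDimensional K N]
    (h : Module.End K N) (_ : h ^ e = 1) (x : Fin m → Module.End K N)
    (_ : ∀ i j, Commute (x i) (x j)) (_ : ∀ i, h * x i = algebraMap ℂ K (μ i) • (x i * h)),
    TrBound (LinearMap.trace K N h)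
      (ε * Module.finrank K N + C * codim (⨆ i, LinearMap.range (x i))) := by
  set P : ℂ := ∏ i, (1 - (μ i)⁻¹) with hP
  have hP0 : P ≠ 0 := by
    refine Finset.prod_ne_zero_iff.2 fun i _ h => hμ1 i ?_
    rw [sub_eq_zero, eq_comm, inv_eq_one] at h
    exact h
  have hPn : 0 < ‖P‖ := norm_pos_iff.2 hP0
  obtain ⟨k, hk⟩ := exists_nat_gt (2 ^ m / (‖P‖ * ε))
  have hkpos : (0 : ℝ) < k := lt_trans (by positivity) hk
  have hk0 : 0 < k := by exact_mod_cast hkpos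
  refine ⟨ε * koszulConst m k, by positivity, ?_⟩
  intro N _ _ _ h hh x hx hhx
  have : CharZero K := charZero_of_injective_algebraMap (algebraMap ℂ K).injective
  obtain ⟨a, ha⟩ := exists_codim_range_sum_le m k hk0 x hx ⊥ (fun i => bot_le)
  have h1 := trBound_koszul e he m (E := N) 0 0 1 h 0 (by simp) (by simp) (by simp) (by simp)
    (by simp) (by simp) hh x hx (fun i => Commute.zero_right _) (fun i => Commute.zero_right _)
    (fun i => Commute.one_right _) μ hμ hhx a
  rw [one_mul, zero_add, ← hP] at h1
  have h2 := h1.mul P⁻¹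
  rw [← mul_assoc, ← map_mul, inv_mul_cancel₀ hP0, map_one, one_mul, norm_inv] at h2
  refine h2.mono ?_
  rw [sup_bot_eq, sup_bot_eq] at ha
  have h3 : codim (⊥ : Submodule K N) ≤ Module.finrank K N := by
    have := codim_add_finrank (⊥ : Submodule K N); omega
  set X : ℝ := ((codim (LinearMap.range (∑ i, a i • x i)) : ℕ) : ℝ)
  have ha' : (k : ℝ) * X ≤ Module.finrank K N +
      koszulConst m k * codim (⨆ i, LinearMap.range (x i)) := by
    have h5 := ha.trans (Nat.add_le_add_right h3 _)
    simp only [X]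
    exact_mod_cast h5
  have h4 : 2 ^ m * ‖P‖⁻¹ ≤ ε * k := by
    rw [div_lt_iff₀ (by positivity)] at hk
    rw [← div_eq_mul_inv, div_le_iff₀ hPn]
    linarith
  have hX : 0 ≤ X := Nat.cast_nonneg _
  calc ‖P‖⁻¹ * (2 ^ m * X) = (2 ^ m * ‖P‖⁻¹) * X := by ring
    _ ≤ ε * k * X := by gcongr
    _ = ε * (k * X) := by ring
    _ ≤ ε * (Module.finrank K N + koszulConst m k * codim (⨆ i, LinearMap.range (x i))) := by
        gcongr
    _ = _ := by ring
end Koszul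

section TraceVanishing
variable {K N : Type*} [Field K] [AddCommGroup N] [Module K N]

lemma exists_adapted_linearIndepOn (G : Set N) (Fil : ℕ → Submodule K N)
    (hanti : Antitone Fil) (hG : ∀ i, Fil i ≤ Submodule.span K (G ∩ Fil i)) (k : ℕ)
    (hk : Fil k = ⊥) : ∀ n i, i + n = k → ∃ (s : Set N) (deg : N → ℕ),
      LinearIndepOn K id s ∧ s ⊆ G ∧ (∀ e ∈ s, i ≤ deg e ∧ e ∈ Fil (deg e)) ∧
      ∀ i', i ≤ i' → Fil i' ≤ Submodule.span K {e ∈ s | i' ≤ deg e} := by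
  intro n
  induction n with
  | zero =>
    rintro i rfl
    refine ⟨∅, 0, linearIndepOn_empty _ _, by simp, by simp, fun i' hi' => ?_⟩
    exact ((hanti hi').trans hk.le).trans bot_le
  | succ n ih =>
    intro i hi
    obtain ⟨s, deg, hs, hsG, hsdeg, hsFil⟩ := ih (i + 1) (by omega)
    have hst : s ⊆ G ∩ Fil i := fun e he =>
      ⟨hsG he, hanti (by have := (hsdeg e he).1; omega) (hsdeg e he).2⟩
    obtain ⟨b, hb, hsb, hspan, hbi⟩ := exists_linearIndepOn_extension hs hst
    simp only [Set.image_id] at hspan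
    classical
    refine ⟨b, fun e => if e ∈ s then deg e else i, hbi, fun e he => (hb he).1, ?_, ?_⟩
    · intro e he
      by_cases h : e ∈ s
      · simp only [h, if_true]
        exact ⟨by have := (hsdeg e h).1; omega, (hsdeg e h).2⟩
      · simp only [h, if_false]
        exact ⟨le_rfl, (hb he).2⟩
    · intro i' hi'
      rcases hi'.eq_or_lt with rfl | hlt
      · refine (hG i).trans (Submodule.span_le.2 (hspan.trans (Submodule.span_mono ?_)))
        intro e he
        refine ⟨he, ?_⟩
        by_cases h : e ∈ s
        · simp only [h, if_true]
          have := (hsdeg e h).1; omega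
        · simp only [h, if_false]; exact le_rfl
      · refine (hsFil i' hlt).trans (Submodule.span_mono ?_)
        rintro e ⟨he, hd⟩
        refine ⟨hsb he, ?_⟩
        simpa only [he, if_true] using hd

lemma exists_adapted_basis (G : Set N) (Fil : ℕ → Submodule K N)
    (hanti : Antitone Fil) (hG : ∀ i, Fil i ≤ Submodule.span K (G ∩ Fil i)) (k : ℕ)
    (h0 : Fil 0 = ⊤) (hk : Fil k = ⊥) : ∃ (s : Set N) (b : Module.Basis s K N) (deg : s → ℕ),
      (∀ j, b j ∈ G) ∧ (∀ j, b j ∈ Fil (deg j)) ∧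
      ∀ i, ∀ x ∈ Fil i, ∀ j, b.repr x j ≠ 0 → i ≤ deg j := by
  obtain ⟨s, deg, hs, hsG, hsdeg, hsFil⟩ :=
    exists_adapted_linearIndepOn G Fil hanti hG k hk k 0 (zero_add k)
  have hspan : ⊤ ≤ Submodule.span K (Set.range (fun x : s => (x : N))) := by
    rw [← h0]
    refine (hsFil 0 le_rfl).trans (Submodule.span_mono ?_)
    rintro e ⟨he, _⟩
    exact ⟨⟨e, he⟩, rfl⟩
  let b := Module.Basis.mk (v := fun x : s => (x : N)) hs hspan
  have hb : ∀ j, b j = j := fun j => Module.Basis.mk_apply hs hspan j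
  refine ⟨s, b, fun j => deg j, fun j => by rw [hb]; exact hsG j.2,
    fun j => by rw [hb]; exact (hsdeg j j.2).2, fun i x hx j hj => ?_⟩
  have h1 : x ∈ Submodule.span K (b '' {j | i ≤ deg j}) := by
    refine Submodule.span_mono ?_ (hsFil i (Nat.zero_le i) hx)
    rintro e ⟨he, hd⟩
    exact ⟨⟨e, he⟩, hd, hb _⟩
  rw [Module.Basis.mem_span_image] at h1
  exact h1 (Finsupp.mem_support_iff.2 hj)

lemma commutator_lift_identity {Q ι : Type*} [Ring Q] [Fintype ι] (ħ : Q)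
    (hħ : ∀ a, ħ * a = a * ħ) (hreg : ∀ a, ħ * a = 0 → a = 0) {u v x q : Q}
    (huv : u * v - v * u = ħ * x) {e m m' : ι → Q} {P P' c c' : ι → ι → Q} {b : ι → ι → Q}
    (hu : ∀ j, u * e j * q = ∑ l, e l * P l j + ħ * m j)
    (hv : ∀ j, v * e j * q = ∑ l, e l * P' l j + ħ * m' j)
    (hc : ∀ l j, P l j * q - q * P l j = ħ * c l j)
    (hc' : ∀ l j, P' l j * q - q * P' l j = ħ * c' l j)
    (hb : ∀ a j, ∑ l, (P a l * P' l j - P' a l * P l j) = ħ * b a j) (j : ι) :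
    x * e j * q * q = ∑ a, e a * b a j + (∑ l, m l * P' l j - ∑ l, m' l * P l j)
      + (∑ l, u * e l * c' l j - ∑ l, v * e l * c l j) + (u * m' j * q - v * m j * q) := by
  have key : ∀ {u v : Q} {m m' : ι → Q} {P P' c' : ι → ι → Q}
      (_ : ∀ j, u * e j * q = ∑ l, e l * P l j + ħ * m j)
      (_ : ∀ j, v * e j * q = ∑ l, e l * P' l j + ħ * m' j)
      (_ : ∀ l j, P' l j * q - q * P' l j = ħ * c' l j),
      u * v * e j * q * q = ∑ a, e a * ∑ l, P a l * P' l j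
        + ħ * (∑ l, m l * P' l j + ∑ l, u * e l * c' l j + u * m' j * q) := by
    intro u v m m' P P' c' hu hv hc'
    have h1 : ∀ l, u * (e l * P' l j) * q
        = ∑ a, e a * (P a l * P' l j) + ħ * (m l * P' l j + u * e l * c' l j) := by
      intro l
      have h2 : P' l j * q = q * P' l j + ħ * c' l j := by rw [← hc']; abel
      calc u * (e l * P' l j) * q = u * e l * (P' l j * q) := by noncomm_ring
        _ = (u * e l * q) * P' l j + ħ * (u * e l * c' l j) := by
          rw [h2, mul_add, ← mul_assoc _ q, ← mul_assoc _ ħ, ← hħ, mul_assoc ħ]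
        _ = _ := by
          rw [hu, add_mul, Finset.sum_mul, mul_add, mul_assoc ħ, add_assoc]
          simp only [mul_assoc]
    calc u * v * e j * q * q = u * (v * e j * q) * q := by noncomm_ring
      _ = ∑ l, u * (e l * P' l j) * q + ħ * (u * m' j * q) := by
        rw [hv, mul_add, add_mul, Finset.mul_sum, Finset.sum_mul, ← mul_assoc u ħ, ← hħ]
        simp only [mul_assoc]
      _ = _ := by
        simp only [h1, Finset.sum_add_distrib, ← Finset.mul_sum, mul_add]
        rw [Finset.sum_comm]
        simp only [← Finset.mul_sum]
        abel
  refine sub_eq_zero.1 (hreg _ ?_)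
  have h3 := key hu hv hc'
  have h4 := key hv hu hc
  have h5 : ħ * (x * e j * q * q) = u * v * e j * q * q - v * u * e j * q * q := by
    simp only [← mul_assoc, ← huv, sub_mul]
  have h6 : ∑ a, e a * ∑ l, P a l * P' l j - ∑ a, e a * ∑ l, P' a l * P l j
      = ħ * ∑ a, e a * b a j := by
    rw [← Finset.sum_sub_distrib, Finset.mul_sum]
    refine Finset.sum_congr rfl fun a _ => ?_
    rw [← mul_sub, ← Finset.sum_sub_distrib, hb, ← mul_assoc, ← hħ, mul_assoc]
  rw [mul_sub, h5, h3, h4]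
  simp only [mul_add, mul_sub, ← h6]
  abel

/-- Vanishing of the trace of an operator which is, up to the central element `ħ`, a commutator
of operators raising a finite filtration. -/
lemma trace_eq_zero_of_commutator [FiniteDimensional K N] {O F B : Type*} [CommRing O]
    [IsDomain O] [Algebra O K] [IsFractionRing O K] [Ring F] [Ring B]
    (ħ : F) (hħ : ∀ a, ħ * a = a * ħ) (I₀ I₁ : TwoSidedIdeal F)
    (hsat : ∀ a, ħ * a ∈ I₁ → a ∈ I₁)
    (cls : F →+* B) (hcls : ∀ a, cls a = 0 → ∃ b, a = ħ * b)
    (ψ : O →+* B) (hψ : ∀ o b, ψ o * b = b * ψ o) (lft : O → F) (hlft : ∀ o, cls (lft o) = ψ o)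
    (hlft0 : lft 0 = 0)
    (p : F → N) (hpadd : ∀ a ∈ I₀, ∀ b ∈ I₀, p (a + b) = p a + p b)
    (hpħ : ∀ a ∈ I₀, p (ħ * a) = 0) (hp₁ : ∀ a ∈ I₁, p a = 0)
    (R : F → Module.End K N) (hpR : ∀ a ∈ I₀, ∀ b, p (a * b) = R b (p a))
    (hRl : ∀ o n, R (lft o) n = algebraMap O K o • n)
    (D : AddSubgroup F) (hD : ∀ a ∈ D, a ∈ I₀) (hDR : ∀ a ∈ D, ∀ b, a * b ∈ D)
    (hDker : ∀ a ∈ D, p a = 0 → ∃ o : O, o ≠ 0 ∧ ∃ m ∈ I₀, a * lft o - ħ * m ∈ I₁)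
    (hDsurj : ∀ n : N, ∃ o : O, o ≠ 0 ∧ ∃ a ∈ D, p a = algebraMap O K o • n)
    (u v x : F) (huv : u * v - v * u = ħ * x) (U V X : Module.End K N)
    (hU : ∀ a ∈ I₀, p (u * a) = U (p a)) (hV : ∀ a ∈ I₀, p (v * a) = V (p a))
    (hX : ∀ a ∈ D, p (x * a) = X (p a))
    (hDu : ∀ a ∈ D, u * a ∈ D) (hDv : ∀ a ∈ D, v * a ∈ D)
    (Fil : ℕ → Submodule K N) (hanti : Antitone Fil) (k : ℕ) (h0 : Fil 0 = ⊤) (hk : Fil k = ⊥)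
    (hUF : ∀ i, ∀ n ∈ Fil i, U n ∈ Fil (i + 1)) (hVF : ∀ i, ∀ n ∈ Fil i, V n ∈ Fil (i + 1))
    (hRF : ∀ i b, ∀ n ∈ Fil i, R b n ∈ Fil i) :
    LinearMap.trace K N X = 0 := by
  classical
  have hinj : Function.Injective (algebraMap O K) := IsFractionRing.injective O K
  have hne : ∀ o : O, o ≠ 0 → algebraMap O K o ≠ 0 := fun o ho h =>
    ho (hinj (by rw [h, map_zero]))
  obtain ⟨s, e, deg, heG, heF, hrepr⟩ := exists_adapted_basis {n : N | ∃ a ∈ D, p a = n} Fil hanti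
    (fun i n hn => by
      obtain ⟨o, ho, a, ha, hpa⟩ := hDsurj n
      have : n = (algebraMap O K o)⁻¹ • p a := by
        rw [hpa, smul_smul, inv_mul_cancel₀ (hne o ho), one_smul]
      rw [this]
      refine Submodule.smul_mem _ _ (Submodule.subset_span ⟨⟨a, ha, rfl⟩, ?_⟩)
      rw [hpa]
      exact Submodule.smul_mem _ _ hn) k h0 hk
  have : Finite s := Module.Finite.finite_basis e
  have := Fintype.ofFinite s
  choose ê hêD hê using heG
  have hlift : ∀ a b, cls a = cls b → ∃ c, a = b + ħ * c := fun a b h => by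
    obtain ⟨c, hc⟩ := hcls (a - b) (by rw [map_sub, h, sub_self])
    exact ⟨c, by rw [← hc]; abel⟩
  have hmul : ∀ o o', ∃ c, lft (o * o') = lft o * lft o' + ħ * c := fun o o' =>
    hlift _ _ (by simp only [map_mul, hlft])
  choose mc hmc using hmul
  have hbr : ∀ o o', ∃ c, (o = 0 → c = 0) ∧ lft o * lft o' - lft o' * lft o = ħ * c := by
    intro o o'
    by_cases ho : o = 0
    · exact ⟨0, fun _ => rfl, by rw [ho, hlft0]; simp⟩
    · obtain ⟨c, hc⟩ := hlift (lft o * lft o') (lft o' * lft o) (by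
        rw [map_mul, map_mul, hlft, hψ, hlft])
      exact ⟨c, fun h => absurd h ho, by rw [hc]; abel⟩
  choose br hbr0 hbr using hbr
  have hp0 : p 0 = 0 := by
    have := hpadd 0 I₀.zero_mem 0 I₀.zero_mem
    simpa using this
  have hpneg : ∀ a ∈ I₀, p (-a) = -p a := fun a ha => by
    have := hpadd a ha (-a) (I₀.neg_mem ha)
    rw [add_neg_cancel, hp0] at this
    exact (neg_eq_of_add_eq_zero_right this.symm).symm
  have hpsub : ∀ a ∈ I₀, ∀ b ∈ I₀, p (a - b) = p a - p b := fun a ha b hb => by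
    rw [sub_eq_add_neg, hpadd a ha _ (I₀.neg_mem hb), hpneg b hb, sub_eq_add_neg]
  have hpsum : ∀ (t : Finset s) (f : s → F), (∀ j, f j ∈ I₀) →
      p (∑ j ∈ t, f j) = ∑ j ∈ t, p (f j) := by
    intro t f hf
    induction t using Finset.induction_on with
    | empty => simpa using hp0
    | insert a t ha ih =>
      rw [Finset.sum_insert ha, Finset.sum_insert ha, hpadd _ (hf a) _ (sum_mem fun j _ => hf j), ih]
  have hêI : ∀ j, ê j ∈ I₀ := fun j => hD _ (hêD j)
  let π := I₁.ringCon.mk'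
  have hπ : ∀ a b, π a = π b ↔ a - b ∈ I₁ := fun a b => by
    change (a : I₁.ringCon.Quotient) = b ↔ _
    rw [RingCon.eq, I₁.rel_iff]
  have hπs : Function.Surjective π := I₁.ringCon.mk'_surjective
  have hcommon : ∀ (u : F) (U : Module.End K N) (_ : ∀ a ∈ I₀, p (u * a) = U (p a))
      (_ : ∀ a ∈ D, u * a ∈ D), ∃ q : O, q ≠ 0 ∧ ∀ r, ∃ (P : s → s → O) (m : s → F),
        (∀ l j, algebraMap O K (P l j) = algebraMap O K (q * r) * e.repr (U (e j)) l) ∧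
        (∀ j, m j ∈ I₀) ∧
        ∀ j, π (u * ê j * lft (q * r)) = π (∑ l, ê l * lft (P l j) + ħ * m j) := by
    intro u U hU hDu
    obtain ⟨⟨q, hq⟩, hqP⟩ := IsLocalization.exist_integer_multiples_of_finite (nonZeroDivisors O)
      (fun i : s × s => e.repr (U (e i.2)) i.1)
    choose P hP using hqP
    have hP' : ∀ l j, algebraMap O K (P (l, j)) = algebraMap O K q * e.repr (U (e j)) l := by
      intro l j
      rw [hP (l, j)]
      exact Algebra.smul_def _ _
    have haD : ∀ j, u * ê j * lft q - ∑ l, ê l * lft (P (l, j)) ∈ D := fun j =>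
      D.sub_mem (hDR _ (hDu _ (hêD j)) _) (sum_mem fun l _ => hDR _ (hêD l) _)
    have hpa : ∀ j, p (u * ê j * lft q - ∑ l, ê l * lft (P (l, j))) = 0 := by
      intro j
      rw [hpsub _ (hD _ (hDR _ (hDu _ (hêD j)) _)) _ (sum_mem fun l _ => hD _ (hDR _ (hêD l) _)),
        hpsum _ _ fun l => hD _ (hDR _ (hêD l) _), hpR _ (hD _ (hDu _ (hêD j))), hU _ (hêI j),
        hRl, hê]
      simp_rw [hpR _ (hêI _), hRl, hê, hP', mul_smul]
      rw [← Finset.smul_sum, e.sum_repr, sub_self]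
    choose o ho m hm hom using fun j => hDker _ (haD j) (hpa j)
    have hmulo : ∀ j r, ∃ m' ∈ I₀,
        (u * ê j * lft q - ∑ l, ê l * lft (P (l, j))) * lft (o j * r) - ħ * m' ∈ I₁ := by
      intro j r
      refine ⟨m j * lft r + (u * ê j * lft q - ∑ l, ê l * lft (P (l, j))) * mc (o j) r,
        I₀.add_mem (I₀.mul_mem_right _ _ (hm j)) (I₀.mul_mem_right _ _ (hD _ (haD j))), ?_⟩
      convert I₁.mul_mem_right _ (lft r) (hom j) using 1
      rw [hmc]
      generalize (u * ê j * lft q - ∑ l, ê l * lft (P (l, j))) = a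
      rw [mul_add, ← mul_assoc a ħ, ← hħ a]
      noncomm_ring
    refine ⟨q * ∏ j, o j, mul_ne_zero (nonZeroDivisors.ne_zero hq)
      (Finset.prod_ne_zero_iff.2 fun j _ => ho j), fun r => ?_⟩
    have hro : ∀ j, ∃ r', o j * r' = (∏ j, o j) * r := fun j =>
      ⟨(∏ i ∈ Finset.univ.erase j, o i) * r, by
        rw [← mul_assoc, Finset.mul_prod_erase _ _ (Finset.mem_univ j)]⟩
    choose r' hr' using hro
    set w := (∏ j, o j) * r with hw
    choose m' hm' hom' using fun j => hmulo j (r' j)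
    simp only [hr'] at hom'
    refine ⟨fun l j => P (l, j) * w, fun j => m' j + u * ê j * mc q w - ∑ l, ê l * mc (P (l, j)) w,
      fun l j => ?_, fun j => I₀.sub_mem (I₀.add_mem (hm' j) (I₀.mul_mem_right _ _
        (I₀.mul_mem_left _ _ (hêI j)))) (sum_mem fun l _ => I₀.mul_mem_right _ _ (hêI l)),
      fun j => ?_⟩
    · rw [mul_assoc, ← hw]
      simp only [map_mul, hP']
      ring
    · rw [mul_assoc q, ← hw, hπ]
      convert hom' j using 1
      have h1 : ∀ c d : F, c * (ħ * d) = ħ * (c * d) := fun c d => by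
        rw [← mul_assoc, ← hħ, mul_assoc]
      simp only [hmc, mul_add, h1, mul_sub, Finset.sum_add_distrib, Finset.mul_sum, sub_mul,
        Finset.sum_mul, mul_assoc]
      abel
  obtain ⟨q₁, hq₁, hqU⟩ := hcommon u U hU hDu
  obtain ⟨q₂, hq₂, hqV⟩ := hcommon v V hV hDv
  obtain ⟨P, m, hP, hm, hPm⟩ := hqU q₂
  obtain ⟨P', m', hP', hm', hPm'⟩ := hqV q₁
  rw [mul_comm q₂ q₁] at hP' hPm'
  set q := q₁ * q₂ with hqdef
  have hq : q ≠ 0 := mul_ne_zero hq₁ hq₂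
  have hUV : ∀ n, U (V n) = V (U n) := by
    intro n
    obtain ⟨o, ho, a, ha, hpa⟩ := hDsurj n
    have hI := hD a ha
    have h1 : p (u * v * a) - p (v * u * a) = 0 := by
      rw [← hpsub _ (I₀.mul_mem_left _ _ hI) _ (I₀.mul_mem_left _ _ hI), ← sub_mul, huv, mul_assoc,
        hpħ _ (I₀.mul_mem_left _ _ hI)]
    rw [mul_assoc, mul_assoc, hU _ (hD _ (hDv a ha)), hV _ hI, hV _ (hD _ (hDu a ha)), hU _ hI, hpa,
      map_smul, map_smul, map_smul, map_smul, ← smul_sub] at h1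
    exact sub_eq_zero.1 ((smul_eq_zero_iff_right (hne o ho)).1 h1)
  have hPcomp : ∀ (U V : Module.End K N) (P P' : s → s → O)
      (_ : ∀ l j, algebraMap O K (P l j) = algebraMap O K q * e.repr (U (e j)) l)
      (_ : ∀ l j, algebraMap O K (P' l j) = algebraMap O K q * e.repr (V (e j)) l) (a j : s),
      algebraMap O K (∑ l, P a l * P' l j) =
        algebraMap O K q * algebraMap O K q * e.repr (U (V (e j))) a := by
    intro U V P P' hP hP' a j
    conv_rhs => rw [← e.sum_repr (V (e j))]
    simp only [map_sum, map_mul, hP, hP', map_smul, Finsupp.coe_finsetSum, Finsupp.coe_smul,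
      Finset.sum_apply, Pi.smul_apply, smul_eq_mul, Finset.mul_sum]
    exact Finset.sum_congr rfl fun l _ => by ring
  have hPc : ∀ a j, ∑ l, (P a l * P' l j - P' a l * P l j) = 0 := by
    intro a j
    apply hinj
    rw [Finset.sum_sub_distrib, map_sub, hPcomp U V P P' hP hP', hPcomp V U P' P hP' hP, hUV,
      sub_self, map_zero]
  have hbex : ∀ a j, ∃ b : F, ((∀ l, P a l * P' l j = 0 ∧ P' a l * P l j = 0) → b = 0) ∧
      ∑ l, (lft (P a l) * lft (P' l j) - lft (P' a l) * lft (P l j)) = ħ * b := by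
    intro a j
    by_cases h : ∀ l, P a l * P' l j = 0 ∧ P' a l * P l j = 0
    · refine ⟨0, fun _ => rfl, ?_⟩
      rw [mul_zero]
      refine Finset.sum_eq_zero fun l _ => ?_
      rcases h l with ⟨h1, h2⟩
      have h3 : ∀ o o' : O, o * o' = 0 → lft o * lft o' = 0 := fun o o' hoo => by
        rcases mul_eq_zero.1 hoo with h | h <;> simp [h, hlft0]
      rw [h3 _ _ h1, h3 _ _ h2, sub_zero]
    · obtain ⟨b, hb⟩ := hcls (∑ l, (lft (P a l) * lft (P' l j) - lft (P' a l) * lft (P l j))) (by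
        simp only [map_sum, map_sub, map_mul, hlft]
        simp only [← map_mul, ← map_sub, ← map_sum, hPc, map_zero])
      exact ⟨b, fun h' => absurd h' h, hb⟩
  choose b hb0 hb using hbex
  have hid := commutator_lift_identity (π ħ)
    (fun a => by obtain ⟨a, rfl⟩ := hπs a; rw [← map_mul, ← map_mul, hħ])
    (fun a ha => by
      obtain ⟨a, rfl⟩ := hπs a
      rw [← map_mul, ← map_zero π, hπ, sub_zero] at ha
      rw [← map_zero π, hπ, sub_zero]
      exact hsat a ha) (u := π u) (v := π v) (x := π x) (q := π (lft q))
    (by simp only [← map_mul, ← map_sub, huv])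
    (e := fun j => π (ê j)) (m := fun j => π (m j)) (m' := fun j => π (m' j))
    (P := fun l j => π (lft (P l j))) (P' := fun l j => π (lft (P' l j)))
    (c := fun l j => π (br (P l j) q)) (c' := fun l j => π (br (P' l j) q))
    (b := fun a j => π (b a j))
    (fun j => by simpa only [map_mul, map_sum, map_add] using hPm j)
    (fun j => by simpa only [map_mul, map_sum, map_add] using hPm' j)
    (fun l j => by simp only [← map_mul, ← map_sub, hbr])
    (fun l j => by simp only [← map_mul, ← map_sub, hbr])
    (fun a j => by simp only [← map_mul, ← map_sub, ← map_sum, hb])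
  have hpπ : ∀ a ∈ I₀, ∀ b ∈ I₀, π a = π b → p a = p b := fun a ha b hb h => by
    rw [← sub_eq_zero, ← hpsub a ha b hb]
    exact hp₁ _ ((hπ a b).1 h)
  let κ := algebraMap O K q
  have hκ : κ ≠ 0 := hne q hq
  let M := e.constr K fun j => p (m j)
  let M' := e.constr K fun j => p (m' j)
  let T := e.constr K fun j => ∑ a, R (b a j) (e a) +
    (∑ l, U (R (br (P' l j) q) (e l)) - ∑ l, V (R (br (P l j) q) (e l)))
  have hmI : ∀ j r, m j * r ∈ I₀ := fun j r => I₀.mul_mem_right _ _ (hm j)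
  have hmI' : ∀ j r, m' j * r ∈ I₀ := fun j r => I₀.mul_mem_right _ _ (hm' j)
  have hêIr : ∀ j r, ê j * r ∈ I₀ := fun j r => I₀.mul_mem_right _ _ (hêI j)
  have hMV : ∀ (M V : Module.End K N) (P' : s → s → O)
      (_ : ∀ l j, algebraMap O K (P' l j) = κ * e.repr (V (e j)) l) (j : s),
      ∑ l, algebraMap O K (P' l j) • M (e l) = κ • M (V (e j)) := by
    intro M V P' hP' j
    conv_rhs => rw [← e.sum_repr (V (e j))]
    simp only [map_sum, map_smul, hP', mul_smul, Finset.smul_sum]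
  have hfin : (κ * κ) • X = T + κ • (M * V - M' * U + (U * M' - V * M)) := by
    refine e.ext fun j => ?_
    have h1 := hpπ (x * ê j * lft q * lft q) (I₀.mul_mem_right _ _ (I₀.mul_mem_right _ _
      (I₀.mul_mem_left _ _ (hêI j)))) (∑ a, ê a * b a j + (∑ l, m l * lft (P' l j)
      - ∑ l, m' l * lft (P l j)) + (∑ l, u * (ê l * br (P' l j) q) - ∑ l, v * (ê l * br (P l j) q))
      + (u * (m' j * lft q) - v * (m j * lft q)))
      (I₀.add_mem (I₀.add_mem (I₀.add_mem (sum_mem fun a _ => hêIr _ _)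
        (I₀.sub_mem (sum_mem fun a _ => hmI _ _) (sum_mem fun a _ => hmI' _ _)))
        (I₀.sub_mem (sum_mem fun a _ => I₀.mul_mem_left _ _ (hêIr _ _))
          (sum_mem fun a _ => I₀.mul_mem_left _ _ (hêIr _ _))))
        (I₀.sub_mem (I₀.mul_mem_left _ _ (hmI' _ _)) (I₀.mul_mem_left _ _ (hmI _ _))))
      (by simpa only [map_mul, map_sum, map_add, map_sub, mul_assoc] using hid j)
    rw [hpadd _ (I₀.add_mem (I₀.add_mem (sum_mem fun a _ => hêIr _ _)
        (I₀.sub_mem (sum_mem fun a _ => hmI _ _) (sum_mem fun a _ => hmI' _ _)))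
        (I₀.sub_mem (sum_mem fun a _ => I₀.mul_mem_left _ _ (hêIr _ _))
          (sum_mem fun a _ => I₀.mul_mem_left _ _ (hêIr _ _)))) _
        (I₀.sub_mem (I₀.mul_mem_left _ _ (hmI' _ _)) (I₀.mul_mem_left _ _ (hmI _ _))),
      hpadd _ (I₀.add_mem (sum_mem fun a _ => hêIr _ _)
        (I₀.sub_mem (sum_mem fun a _ => hmI _ _) (sum_mem fun a _ => hmI' _ _))) _
        (I₀.sub_mem (sum_mem fun a _ => I₀.mul_mem_left _ _ (hêIr _ _))
          (sum_mem fun a _ => I₀.mul_mem_left _ _ (hêIr _ _))),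
      hpadd _ (sum_mem fun a _ => hêIr _ _) _
        (I₀.sub_mem (sum_mem fun a _ => hmI _ _) (sum_mem fun a _ => hmI' _ _)),
      hpsub _ (sum_mem fun a _ => hmI _ _) _ (sum_mem fun a _ => hmI' _ _),
      hpsub _ (sum_mem fun a _ => I₀.mul_mem_left _ _ (hêIr _ _)) _
          (sum_mem fun a _ => I₀.mul_mem_left _ _ (hêIr _ _)),
      hpsub _ (I₀.mul_mem_left _ _ (hmI' _ _)) _ (I₀.mul_mem_left _ _ (hmI _ _)),
      hpsum _ _ fun _ => hêIr _ _, hpsum _ _ fun _ => hmI _ _, hpsum _ _ fun _ => hmI' _ _,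
      hpsum _ _ fun _ => I₀.mul_mem_left _ _ (hêIr _ _),
      hpsum _ _ fun _ => I₀.mul_mem_left _ _ (hêIr _ _),
      hpR _ (I₀.mul_mem_right _ _ (I₀.mul_mem_left _ _ (hêI j))),
      hpR _ (I₀.mul_mem_left _ _ (hêI j)), hX _ (hêD j), hRl, hRl, hê, smul_smul] at h1
    simp only [hU _ (hêIr _ _), hV _ (hêIr _ _), hU _ (hmI' _ _), hV _ (hmI _ _), hpR _ (hêI _),
      hpR _ (hm _), hpR _ (hm' _), hRl, hê] at h1
    have hMe : ∀ j, M (e j) = p (m j) := e.constr_basis K _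
    have hMe' : ∀ j, M' (e j) = p (m' j) := e.constr_basis K _
    simp only [← hMe, ← hMe', hMV M V P' hP', hMV M' U P hP] at h1
    change (κ * κ) • X (e j) = T (e j) +
      κ • (M (V (e j)) - M' (U (e j)) + (U (M' (e j)) - V (M (e j))))
    have hTe : T (e j) = ∑ a, R (b a j) (e a) +
      (∑ l, U (R (br (P' l j) q) (e l)) - ∑ l, V (R (br (P l j) q) (e l))) := e.constr_basis K _ j
    rw [h1, hTe, map_smul, map_smul]
    simp only [smul_add, smul_sub]
    abel
  have hdeg : ∀ (U : Module.End K N) (_ : ∀ i, ∀ n ∈ Fil i, U n ∈ Fil (i + 1)) (P : s → s → O)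
      (_ : ∀ l j, algebraMap O K (P l j) = κ * e.repr (U (e j)) l) (l j : s), P l j ≠ 0 →
      deg j + 1 ≤ deg l := by
    intro U hUF P hP l j h
    refine hrepr _ _ (hUF _ _ (heF j)) l fun h0 => hne _ h ?_
    rw [hP, h0, mul_zero]
  have hTF : ∀ i, ∀ n ∈ Fil i, T n ∈ Fil (i + 1) := by
    have hTe : ∀ j, T (e j) ∈ Fil (deg j + 1) := by
      intro j
      have hTe : T (e j) = ∑ a, R (b a j) (e a) +
        (∑ l, U (R (br (P' l j) q) (e l)) - ∑ l, V (R (br (P l j) q) (e l))) := e.constr_basis K _ j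
      have hR0 : ∀ n : N, R 0 n = 0 := fun n => by rw [← hlft0, hRl, map_zero, zero_smul]
      have hUR : ∀ (U V : Module.End K N) (_ : ∀ i, ∀ n ∈ Fil i, U n ∈ Fil (i + 1))
          (_ : ∀ i, ∀ n ∈ Fil i, V n ∈ Fil (i + 1)) (P : s → s → O)
          (_ : ∀ l j, algebraMap O K (P l j) = κ * e.repr (U (e j)) l) (l j : s),
          V (R (br (P l j) q) (e l)) ∈ Fil (deg j + 1) := by
        intro U V hUF hVF P hP l j
        by_cases h : P l j = 0
        · rw [hbr0 _ _ h, hR0, map_zero]; exact zero_mem _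
        · exact hanti (by have := hdeg U hUF P hP l j h; omega) (hVF _ _ (hRF _ _ _ (heF l)))
      rw [hTe]
      refine add_mem (sum_mem fun a _ => ?_) (sub_mem (sum_mem fun l _ => hUR V U hVF hUF P' hP' l j)
        (sum_mem fun l _ => hUR U V hUF hVF P hP l j))
      by_cases h : ∀ l, P a l * P' l j = 0 ∧ P' a l * P l j = 0
      · rw [hb0 _ _ h, hR0]; exact zero_mem _
      · push Not at h
        obtain ⟨l, hl⟩ := h
        have : deg j + 1 ≤ deg a := by
          by_cases h1 : P a l * P' l j = 0
          · have := hdeg V hVF P' hP' a l (left_ne_zero_of_mul (hl h1))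
            have := hdeg U hUF P hP l j (right_ne_zero_of_mul (hl h1))
            omega
          · have := hdeg V hVF P' hP' l j (right_ne_zero_of_mul h1)
            have := hdeg U hUF P hP a l (left_ne_zero_of_mul h1)
            omega
        exact hanti this (hRF _ _ _ (heF a))
    intro i n hn
    rw [← e.sum_repr n, map_sum]
    refine sum_mem fun j _ => ?_
    rw [map_smul]
    by_cases h : e.repr n j = 0
    · rw [h, zero_smul]; exact zero_mem _
    · exact Submodule.smul_mem _ _ (hanti (by have := hrepr i n hn j h; omega) (hTe j))
  have hTnil : IsNilpotent T := by
    have hTpow : ∀ i n, (T ^ i) n ∈ Fil i := by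
      intro i
      induction i with
      | zero => intro n; rw [h0]; trivial
      | succ i ih => intro n; rw [pow_succ']; exact hTF _ _ (ih n)
    refine ⟨k, LinearMap.ext fun n => ?_⟩
    have := hTpow k n
    rwa [hk, Submodule.mem_bot] at this
  have htr := congrArg (LinearMap.trace K N) hfin
  have hT0 : LinearMap.trace K N T = 0 := (LinearMap.isNilpotent_trace_of_isNilpotent hTnil).eq_zero
  simp only [map_smul, map_add, map_sub, hT0, LinearMap.trace_mul_comm K M V,
    LinearMap.trace_mul_comm K M' U, smul_eq_mul] at htr
  have h9 : κ * κ * LinearMap.trace K N X = 0 := by rw [htr]; ring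
  exact (mul_eq_zero.1 h9).resolve_left (mul_ne_zero hκ hκ)
end TraceVanishing

section Presentation
open MvPolynomial

lemma exists_algHom_of_commute {n : ℕ} {B : Type*} [Ring B] [Algebra ℂ B] (x : Fin n → B)
    (hx : ∀ i j, x i * x j = x j * x i) :
    ∃ φ : MvPolynomial (Fin n) ℂ →ₐ[ℂ] B, ∀ i, φ (X i) = x i := by
  have hcomm : ∀ a ∈ Set.range x, ∀ b ∈ Set.range x, a * b = b * a := by
    rintro _ ⟨i, rfl⟩ _ ⟨j, rfl⟩
    exact hx i j
  have hc := Algebra.isMulCommutative_adjoin ℂ hcomm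
  let _ : CommRing (Algebra.adjoin ℂ (Set.range x)) :=
    { (Algebra.adjoin ℂ (Set.range x)).toRing with mul_comm := hc.is_comm.comm }
  let y : Fin n → Algebra.adjoin ℂ (Set.range x) :=
    fun i => ⟨x i, Algebra.subset_adjoin ⟨i, rfl⟩⟩
  refine ⟨(Algebra.adjoin ℂ (Set.range x)).val.comp (aeval y), fun i => ?_⟩
  rw [AlgHom.comp_apply, aeval_X]
  rfl

/-- The linear form attached to a vector, in the polynomial ring on a basis. -/
noncomputable def lin {n : ℕ} {V : Type*} [AddCommGroup V] [Module ℂ V]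
    (b : Module.Basis (Fin n) ℂ V) : V →ₗ[ℂ] MvPolynomial (Fin n) ℂ :=
  b.constr ℂ fun i => X i

/-- A homogenised symplectic reflection algebra `F`, with a central parameter `T` of degree one,
together with its reduction `B` modulo `ħ = T²`, as a module over the polynomial ring on `V`. -/
structure HPres (n : ℕ) (V G F B : Type) [AddCommGroup V] [Module ℂ V] [Group G] [Fintype G]
    [Ring F] [Algebra ℂ F] [Ring B] [Algebra ℂ B] [Module (MvPolynomial (Fin n) ℂ) B] where
  b : Module.Basis (Fin n) ℂ V
  ρ : G →* Module.End ℂ V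
  ω : V →ₗ[ℂ] V →ₗ[ℂ] ℂ
  ω_alt : ∀ v, ω v v = 0
  ω_nondeg : ∀ v, (∀ w, ω v w = 0) → v = 0
  ω_inv : ∀ g u v, ω (ρ g u) (ρ g v) = ω u v
  κ : G → V →ₗ[ℂ] V →ₗ[ℂ] ℂ
  κ_left : ∀ s u v, ρ s u = u → κ s u v = 0
  κ_right : ∀ s u v, ρ s v = v → κ s u v = 0
  κ_codim : ∀ g s u v, ρ g u = u → ρ g v = v → κ s u v ≠ 0 →
    Module.finrank ℂ (LinearMap.ker (ρ (s * g) - 1)) < Module.finrank ℂ (LinearMap.ker (ρ g - 1))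
  T : F
  T_central : ∀ a, T * a = a * T
  T_regular : ∀ a, T * a = 0 → a = 0
  ι : V →ₗ[ℂ] F
  j : G →* F
  j_ι : ∀ g u, j g * ι u = ι (ρ g u) * j g
  comm : ∀ u v, ι u * ι v - ι v * ι u =
    T * T * (algebraMap ℂ F (ω u v) + ∑ s, κ s u v • j s)
  gen : Algebra.adjoin ℂ ({T} ∪ Set.range ι ∪ Set.range j) = ⊤
  cls : F →ₐ[ℂ] B
  cls_surj : Function.Surjective cls
  cls_eq_zero : ∀ a, cls a = 0 ↔ ∃ c, a = T * T * c
  φ : MvPolynomial (Fin n) ℂ →ₐ[ℂ] B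
  φ_lin : ∀ v, φ (lin b v) = cls (ι v)
  smul_eq : ∀ f x, f • x = φ f * x

namespace HPres
variable {n : ℕ} {V G F B : Type} [AddCommGroup V] [Module ℂ V] [Group G] [Fintype G]
  [Ring F] [Algebra ℂ F] [Ring B] [Algebra ℂ B] [Module (MvPolynomial (Fin n) ℂ) B]
  (P : HPres n V G F B)

/-- The linear form attached to a vector. -/
noncomputable abbrev l : V →ₗ[ℂ] MvPolynomial (Fin n) ℂ := lin P.b

lemma l_basis (i : Fin n) : P.l (P.b i) = X i := P.b.constr_basis ℂ _ i

/-- The algebra endomorphism of the polynomial ring induced by a linear endomorphism. -/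
noncomputable def sym (A : Module.End ℂ V) :
    MvPolynomial (Fin n) ℂ →ₐ[ℂ] MvPolynomial (Fin n) ℂ :=
  aeval fun i => P.l (A (P.b i))

lemma sym_X (A : Module.End ℂ V) (i : Fin n) : P.sym A (X i) = P.l (A (P.b i)) := aeval_X _ _

@[simp] lemma sym_l (A : Module.End ℂ V) (v : V) : P.sym A (P.l v) = P.l (A v) := by
  have : (P.sym A).toLinearMap ∘ₗ P.l = P.l ∘ₗ A := by
    refine P.b.ext fun i => ?_
    simp only [LinearMap.comp_apply, l_basis, AlgHom.toLinearMap_apply, sym_X]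
  exact LinearMap.congr_fun this v

lemma algHom_ext_l {A : Type*} [CommRing A] [Algebra ℂ A] {f g : MvPolynomial (Fin n) ℂ →ₐ[ℂ] A}
    (h : ∀ v, f (P.l v) = g (P.l v)) : f = g :=
  MvPolynomial.algHom_ext fun i => by rw [← P.l_basis]; exact h _

lemma sym_mul (A A' : Module.End ℂ V) (f) : P.sym (A * A') f = P.sym A (P.sym A' f) := by
  have : P.sym (A * A') = (P.sym A).comp (P.sym A') :=
    P.algHom_ext_l fun v => by simp
  exact DFunLike.congr_fun this f

lemma sym_one (f) : P.sym 1 f = f := by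
  have : P.sym 1 = AlgHom.id _ _ := P.algHom_ext_l fun v => by simp
  exact DFunLike.congr_fun this f

/-- The action of the group on the polynomial ring. -/
noncomputable def act (g : G) : MvPolynomial (Fin n) ℂ →ₐ[ℂ] MvPolynomial (Fin n) ℂ :=
  P.sym (P.ρ g)

@[simp] lemma act_l (g : G) (v : V) : P.act g (P.l v) = P.l (P.ρ g v) := P.sym_l _ v

lemma act_mul (g h : G) (f) : P.act (g * h) f = P.act g (P.act h f) := by
  rw [act, map_mul, sym_mul]; rfl

lemma act_one (f) : P.act 1 f = f := by rw [act, map_one, sym_one]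

/-- The image of a group element in the reduced algebra. -/
def jB (g : G) : B := P.cls (P.j g)

lemma jB_mul (g h : G) : P.jB (g * h) = P.jB g * P.jB h := by simp [jB]

lemma jB_one : P.jB 1 = 1 := by simp [jB]

/-- The image of `T` in the reduced algebra. -/
def τ : B := P.cls P.T

lemma τ_comm (x : B) : P.τ * x = x * P.τ := by
  obtain ⟨a, rfl⟩ := P.cls_surj x
  rw [τ, ← map_mul, P.T_central, map_mul]

lemma τ_sq : P.τ * P.τ = 0 := by
  rw [τ, ← map_mul, P.cls_eq_zero]
  exact ⟨1, (mul_one _).symm⟩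

lemma jB_φ (g : G) (f) : P.jB g * P.φ f = P.φ (P.act g f) * P.jB g := by
  induction f using MvPolynomial.induction_on with
  | C a =>
    rw [← algebraMap_eq, AlgHom.commutes, AlgHom.commutes, AlgHom.commutes, Algebra.commutes]
  | add p q hp hq => simp only [map_add, mul_add, add_mul, hp, hq]
  | mul_X p i hp =>
    have : P.jB g * P.φ (X i) = P.φ (P.act g (X i)) * P.jB g := by
      rw [← P.l_basis, act_l, P.φ_lin, P.φ_lin, jB, ← map_mul, P.j_ι, map_mul]
    rw [map_mul, map_mul, map_mul, ← mul_assoc, hp, mul_assoc, this, mul_assoc]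

lemma φ_comm (f g) : P.φ f * P.φ g = P.φ g * P.φ f := by
  rw [← map_mul, mul_comm, map_mul]

lemma ħ_central (a : F) : P.T * P.T * a = a * (P.T * P.T) := by
  rw [mul_assoc, P.T_central a, ← mul_assoc, P.T_central a, mul_assoc]

lemma ħ_regular (a : F) (h : P.T * P.T * a = 0) : a = 0 :=
  P.T_regular _ (P.T_regular _ (by rwa [← mul_assoc]))

lemma cls_induction {p : B → Prop} (hadd : ∀ x y, p x → p y → p (x + y))
    (hmul : ∀ x y, p x → p y → p (x * y)) (hC : ∀ c, p (algebraMap ℂ B c)) (hτ : p P.τ)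
    (hl : ∀ v, p (P.φ (P.l v))) (hj : ∀ g, p (P.jB g)) (x : B) : p x := by
  obtain ⟨a, rfl⟩ := P.cls_surj x
  have ha : a ∈ Algebra.adjoin ℂ ({P.T} ∪ Set.range P.ι ∪ Set.range P.j) := by
    rw [P.gen]; trivial
  induction ha using Algebra.adjoin_induction with
  | mem y hy =>
    rcases hy with (rfl | ⟨v, rfl⟩) | ⟨g, rfl⟩
    · exact hτ
    · rw [← P.φ_lin]; exact hl v
    · exact hj g
  | algebraMap c => rw [AlgHom.commutes]; exact hC c
  | add y z _ _ hy hz => rw [map_add]; exact hadd _ _ hy hz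
  | mul y z _ _ hy hz => rw [map_mul]; exact hmul _ _ hy hz

lemma span_eq_top : Submodule.span (MvPolynomial (Fin n) ℂ)
    (Set.range P.jB ∪ Set.range fun g => P.τ * P.jB g) = ⊤ := by
  set W := Submodule.span (MvPolynomial (Fin n) ℂ)
    (Set.range P.jB ∪ Set.range fun g => P.τ * P.jB g) with hW
  have hS : ∀ f, ∀ w ∈ W, P.φ f * w ∈ W := fun f w hw => by
    rw [← P.smul_eq]; exact W.smul_mem _ hw
  have key : ∀ x : B, ∀ w ∈ W, x * w ∈ W := by
    refine P.cls_induction (fun x y hx hy w hw => by rw [add_mul]; exact W.add_mem (hx w hw) (hy w hw))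
      (fun x y hx hy w hw => by rw [mul_assoc]; exact hx _ (hy w hw)) (fun c w hw => ?_) ?_
      (fun v => hS _) (fun g => ?_)
    · rw [← P.φ.commutes]; exact hS _ w hw
    · intro w hw
      induction hw using Submodule.span_induction with
      | mem y hy =>
        rcases hy with ⟨g, rfl⟩ | ⟨g, rfl⟩
        · exact Submodule.subset_span (Or.inr ⟨g, rfl⟩)
        · dsimp only
          rw [← mul_assoc, τ_sq, zero_mul]; exact W.zero_mem
      | zero => rw [mul_zero]; exact W.zero_mem
      | add y z _ _ hy hz => rw [mul_add]; exact W.add_mem hy hz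
      | smul f y _ hy =>
        rw [P.smul_eq, ← mul_assoc, τ_comm, mul_assoc]
        exact hS _ _ hy
    · intro w hw
      induction hw using Submodule.span_induction with
      | mem y hy =>
        rcases hy with ⟨h, rfl⟩ | ⟨h, rfl⟩
        · rw [← jB_mul]; exact Submodule.subset_span (Or.inl ⟨_, rfl⟩)
        · dsimp only
          rw [← mul_assoc, ← τ_comm, mul_assoc, ← jB_mul]
          exact Submodule.subset_span (Or.inr ⟨_, rfl⟩)
      | zero => rw [mul_zero]; exact W.zero_mem
      | add y z _ _ hy hz => rw [mul_add]; exact W.add_mem hy hz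
      | smul f y _ hy =>
        rw [P.smul_eq, ← mul_assoc, jB_φ, mul_assoc]
        exact hS _ _ hy
  refine eq_top_iff.2 fun x _ => ?_
  rw [← mul_one x, ← P.jB_one]
  exact key x _ (Submodule.subset_span (Or.inl ⟨1, rfl⟩))

include P in
lemma isNoetherian : IsNoetherian (MvPolynomial (Fin n) ℂ) B := by
  have : Module.Finite (MvPolynomial (Fin n) ℂ) B :=
    ⟨Submodule.fg_def.2 ⟨_, (Set.finite_range _).union (Set.finite_range _), P.span_eq_top⟩⟩
  infer_instance

/-- The image in the reduced algebra of a two-sided ideal. -/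
def N (I : TwoSidedIdeal F) : Submodule (MvPolynomial (Fin n) ℂ) B where
  carrier := {x | ∃ a ∈ I, P.cls a = x}
  add_mem' := by
    rintro _ _ ⟨a, ha, rfl⟩ ⟨c, hc, rfl⟩
    exact ⟨a + c, I.add_mem ha hc, map_add _ _ _⟩
  zero_mem' := ⟨0, I.zero_mem, map_zero _⟩
  smul_mem' := by
    rintro f _ ⟨a, ha, rfl⟩
    obtain ⟨c, hc⟩ := P.cls_surj (P.φ f)
    exact ⟨c * a, I.mul_mem_left _ _ ha, by rw [map_mul, hc, P.smul_eq]⟩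

lemma cls_mem_N {I : TwoSidedIdeal F} {a : F} (ha : a ∈ I) : P.cls a ∈ P.N I := ⟨a, ha, rfl⟩

lemma mul_mem_N_left {I : TwoSidedIdeal F} (x : B) {y : B} (hy : y ∈ P.N I) : x * y ∈ P.N I := by
  obtain ⟨a, ha, rfl⟩ := hy
  obtain ⟨c, rfl⟩ := P.cls_surj x
  exact ⟨c * a, I.mul_mem_left _ _ ha, map_mul _ _ _⟩

lemma mul_mem_N_right {I : TwoSidedIdeal F} (x : B) {y : B} (hy : y ∈ P.N I) : y * x ∈ P.N I := by
  obtain ⟨a, ha, rfl⟩ := hy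
  obtain ⟨c, rfl⟩ := P.cls_surj x
  exact ⟨a * c, I.mul_mem_right _ _ ha, map_mul _ _ _⟩

lemma N_mono {I I' : TwoSidedIdeal F} (h : I ≤ I') : P.N I ≤ P.N I' := by
  rintro _ ⟨a, ha, rfl⟩
  exact ⟨a, h ha, rfl⟩

end HPres
end Presentation

section PoissonPrimes
open MvPolynomial

lemma exists_notMem_mul_pow_mem {R : Type*} [CommRing R] {I p : Ideal R} [hp : p.IsPrime]
    (h : ∀ q : Ideal R, q.IsPrime → I ≤ q → q ≤ p → q = p) {f : R} (hf : f ∈ p) :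
    ∃ t ∉ p, ∃ k : ℕ, t * f ^ k ∈ I := by
  by_contra! hcon
  have hdisj : Disjoint (I : Set R) (p.primeCompl ⊔ Submonoid.powers f : Submonoid R) := by
    rw [Set.disjoint_left]
    intro x hx hx'
    obtain ⟨t, ht, y, ⟨k, rfl⟩, rfl⟩ := Submonoid.mem_sup.1 hx'
    exact hcon t ht k hx
  obtain ⟨q, hq, hIq, hdq⟩ := Ideal.exists_le_prime_disjoint _ _ hdisj
  rw [Set.disjoint_left] at hdq
  have hqp : q ≤ p := fun x hx => by
    by_contra hxp
    exact hdq hx (Submonoid.mem_sup_left (show x ∈ p.primeCompl from hxp))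
  refine hdq (a := f) ?_ (Submonoid.mem_sup_right (Submonoid.mem_powers f))
  rw [h q hq hIq hqp]
  exact hf

namespace HPres
variable {n : ℕ} {V G F B : Type} [AddCommGroup V] [Module ℂ V] [Group G] [Fintype G]
  [Ring F] [Algebra ℂ F] [Ring B] [Algebra ℂ B] [Module (MvPolynomial (Fin n) ℂ) B]
  (P : HPres n V G F B)

/-- The Poisson bracket with a linear form. -/
noncomputable def pb (v : V) :
    Derivation ℂ (MvPolynomial (Fin n) ℂ) (MvPolynomial (Fin n) ℂ) :=
  mkDerivation ℂ fun i => C (P.ω v (P.b i))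

@[simp] lemma pb_l (v u : V) : P.pb v (P.l u) = C (P.ω v u) := by
  have : (P.pb v).toLinearMap ∘ₗ P.l = (Algebra.linearMap ℂ _) ∘ₗ P.ω v := by
    refine P.b.ext fun i => ?_
    simp only [LinearMap.comp_apply, l_basis]
    exact mkDerivation_X _ _ _
  exact LinearMap.congr_fun this u

lemma pb_add (v v' : V) (f) : P.pb (v + v') f = P.pb v f + P.pb v' f := by
  have : P.pb (v + v') = P.pb v + P.pb v' :=
    MvPolynomial.derivation_ext fun i => by
      rw [← P.l_basis]; simp
  rw [this]; rfl

lemma pb_smul (c : ℂ) (v : V) (f) : P.pb (c • v) f = c • P.pb v f := by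
  have : P.pb (c • v) = c • P.pb v :=
    MvPolynomial.derivation_ext fun i => by
      rw [← P.l_basis]; simp [MvPolynomial.smul_eq_C_mul]
  rw [this]; rfl

/-- `P.pb` as a linear map in the vector. -/
noncomputable def pbLin (f : MvPolynomial (Fin n) ℂ) : V →ₗ[ℂ] MvPolynomial (Fin n) ℂ where
  toFun v := P.pb v f
  map_add' v v' := P.pb_add v v' f
  map_smul' c v := P.pb_smul c v f

lemma pow_commutator (v u : V) (m : ℕ) : ∃ (d : F) (c : G → MvPolynomial (Fin n) ℂ),
    P.ι v ^ (m + 1) * P.ι u - P.ι u * P.ι v ^ (m + 1) = P.T * P.T * d ∧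
    P.cls d = P.φ (((m + 1 : ℕ) : MvPolynomial (Fin n) ℂ) * P.l v ^ m * C (P.ω v u)) + ∑ r, P.φ (c r) * P.jB r ∧
    ∀ r, P.ρ r u = u → c r = 0 := by
  have hx : P.cls (algebraMap ℂ F (P.ω v u) + ∑ s, P.κ s v u • P.j s) =
      P.φ (C (P.ω v u)) + ∑ r, P.φ (C (P.κ r v u)) * P.jB r := by
    rw [map_add, AlgHom.commutes, ← algebraMap_eq, AlgHom.commutes, map_sum]
    simp only [map_smul, AlgHom.commutes, ← Algebra.smul_def, jB]
  induction m with
  | zero =>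
    refine ⟨_, fun r => C (P.κ r v u), by simpa using P.comm v u, by simpa using hx,
      fun r hr => by simp only [P.κ_right r v u hr, C_0]⟩
  | succ m ih =>
    obtain ⟨d, c, hd, hc, h0⟩ := ih
    refine ⟨P.ι v * d + (algebraMap ℂ F (P.ω v u) + ∑ s, P.κ s v u • P.j s) * P.ι v ^ (m + 1),
      fun r => P.l v * c r + C (P.κ r v u) * P.act r (P.l v ^ (m + 1)), ?_, ?_, fun r hr => by
        simp only [h0 r hr, P.κ_right r v u hr, C_0]; ring⟩
    · rw [mul_add, ← mul_assoc _ (P.ι v), P.ħ_central, mul_assoc (P.ι v), ← hd,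
        ← mul_assoc _ _ (P.ι v ^ (m + 1)), ← P.comm, pow_succ']
      noncomm_ring
    · have h1 : P.φ (((m + 1 + 1 : ℕ) : MvPolynomial (Fin n) ℂ) * P.l v ^ (m + 1) * C (P.ω v u)) =
          P.φ (P.l v) * P.φ (((m + 1 : ℕ) : MvPolynomial (Fin n) ℂ) * P.l v ^ m * C (P.ω v u)) +
          P.φ (C (P.ω v u)) * P.φ (P.l v ^ (m + 1)) := by
        rw [← map_mul, ← map_mul, ← map_add]
        congr 1
        push_cast
        ring
      rw [h1, map_add, map_mul, map_mul, hc, hx, ← P.φ_lin, map_pow P.cls, ← P.φ_lin,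
        ← map_pow P.φ, mul_add,
        add_mul, Finset.mul_sum, Finset.sum_mul]
      simp only [mul_assoc, P.jB_φ, map_add, add_mul, Finset.sum_add_distrib, map_mul P.φ]
      abel

/-- The symbol of the commutator with an averaged power. -/
noncomputable def dl (m : ℕ) (v : V) (f : MvPolynomial (Fin n) ℂ) : MvPolynomial (Fin n) ℂ :=
  ∑ γ, ((m + 1 : ℕ) : MvPolynomial (Fin n) ℂ) * P.l (P.ρ γ v) ^ m * P.pb (P.ρ γ v) f

/-- The average of the powers of a vector. -/
def zpow (m : ℕ) (v : V) : F := ∑ γ, P.ι (P.ρ γ v) ^ (m + 1)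

/-- `P.HasBracket m v A f` controls the commutator of `P.zpow m v` with a lift of `f`. -/
def HasBracket (m : ℕ) (v : V) (A : Set G) (f : MvPolynomial (Fin n) ℂ) : Prop :=
  ∃ (a d : F) (c : G → MvPolynomial (Fin n) ℂ), P.cls a = P.φ f ∧
    P.zpow m v * a - a * P.zpow m v = P.T * P.T * d ∧
    P.cls d = P.φ (P.dl m v f) + ∑ r, P.φ (c r) * P.jB r ∧ ∀ r ∈ A, c r = 0

variable {P}
lemma HasBracket.l (m : ℕ) (v u : V) {A : Set G} (hA : ∀ r ∈ A, P.ρ r u = u) :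
    P.HasBracket m v A (P.l u) := by
  choose d c hd hc h0 using fun γ => P.pow_commutator (P.ρ γ v) u m
  refine ⟨P.ι u, ∑ γ, d γ, fun r => ∑ γ, c γ r, (P.φ_lin u).symm, ?_, ?_,
    fun r hr => Finset.sum_eq_zero fun γ _ => h0 γ r (hA r hr)⟩
  · rw [zpow, Finset.sum_mul, Finset.mul_sum, Finset.mul_sum, ← Finset.sum_sub_distrib]
    exact Finset.sum_congr rfl fun γ _ => hd γ
  · rw [map_sum]
    simp only [hc, dl, pb_l, Finset.sum_add_distrib, map_sum, Finset.sum_mul]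
    rw [Finset.sum_comm]

lemma HasBracket.C (m : ℕ) (v : V) {A : Set G} (a : ℂ) : P.HasBracket m v A (C a) := by
  refine ⟨algebraMap ℂ F a, 0, 0, ?_, ?_, ?_, fun _ _ => rfl⟩
  · rw [AlgHom.commutes, ← algebraMap_eq, AlgHom.commutes]
  · rw [← Algebra.commutes, sub_self, mul_zero]
  · simp [dl]

lemma HasBracket.add {m : ℕ} {v : V} {A : Set G} {f g} (hf : P.HasBracket m v A f)
    (hg : P.HasBracket m v A g) : P.HasBracket m v A (f + g) := by
  obtain ⟨a, d, c, h1, h2, h3, h4⟩ := hf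
  obtain ⟨a', d', c', h1', h2', h3', h4'⟩ := hg
  refine ⟨a + a', d + d', c + c', by simp [h1, h1'], ?_, ?_, fun r hr => by
    simp [h4 r hr, h4' r hr]⟩
  · rw [mul_add _ d, ← h2, ← h2']; noncomm_ring
  · simp only [dl, map_add, h3, h3', Pi.add_apply, add_mul, mul_add, Finset.sum_add_distrib]
    abel

lemma HasBracket.mul {m : ℕ} {v : V} {A : Set G} {f g} (hf : P.HasBracket m v A f)
    (hg : P.HasBracket m v A g) : P.HasBracket m v A (f * g) := by
  obtain ⟨a, d, c, h1, h2, h3, h4⟩ := hf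
  obtain ⟨a', d', c', h1', h2', h3', h4'⟩ := hg
  refine ⟨a * a', d * a' + a * d', fun r => c r * P.act r g + f * c' r, by simp [h1, h1'], ?_, ?_,
    fun r hr => by simp [h4 r hr, h4' r hr]⟩
  · rw [mul_add, ← mul_assoc _ d, ← h2, ← mul_assoc _ a d', P.ħ_central a, mul_assoc a _ d', ← h2']
    noncomm_ring
  · have h5 : P.dl m v (f * g) = P.dl m v f * g + f * P.dl m v g := by
      simp only [dl, Derivation.leibniz, smul_eq_mul, Finset.sum_mul, Finset.mul_sum,
        ← Finset.sum_add_distrib]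
      exact Finset.sum_congr rfl fun γ _ => by ring
    rw [map_add, map_mul, map_mul, h1, h1', h3, h3', h5, add_mul, mul_add, Finset.mul_sum,
      Finset.sum_mul]
    simp only [mul_assoc, P.jB_φ, map_add, map_mul, add_mul, Finset.sum_add_distrib]
    abel

lemma HasBracket.pow {m : ℕ} {v : V} {A : Set G} {f} (hf : P.HasBracket m v A f) (k : ℕ) :
    P.HasBracket m v A (f ^ k) := by
  induction k with
  | zero => rw [pow_zero, ← C_1]; exact .C _ _ _
  | succ k ih => rw [pow_succ]; exact ih.mul hf

lemma HasBracket.sym {m : ℕ} {v : V} {A : Set G} {M : Module.End ℂ V}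
    (hM : ∀ r ∈ A, ∀ u, P.ρ r (M u) = M u) (f) : P.HasBracket m v A (P.sym M f) := by
  induction f using MvPolynomial.induction_on with
  | C a => rw [← algebraMap_eq, AlgHom.commutes]; exact .C _ _ _
  | add p q hp hq => rw [map_add]; exact hp.add hq
  | mul_X p i hp =>
    rw [map_mul, sym_X]
    exact hp.mul (.l _ _ _ fun r hr => hM r hr _)

lemma HasBracket.any (m : ℕ) (v : V) (f) : P.HasBracket m v ∅ f := by
  rw [← P.sym_one f]
  exact .sym (by simp) f

end HPres
end PoissonPrimes

section PoissonBracketMaps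
open MvPolynomial
namespace HPres
variable {n : ℕ} {V G F B : Type} [AddCommGroup V] [Module ℂ V] [Group G] [Fintype G]
  [Ring F] [Algebra ℂ F] [Ring B] [Algebra ℂ B] [Module (MvPolynomial (Fin n) ℂ) B]
  (P : HPres n V G F B)

/-- A two-sided ideal which is saturated with respect to `ħ = T²`. -/
def Sat (I : TwoSidedIdeal F) : Prop := ∀ a, P.T * P.T * a ∈ I → a ∈ I

lemma φ_central {f : MvPolynomial (Fin n) ℂ} (hf : ∀ g, P.act g f = f) (x : B) :
    P.φ f * x = x * P.φ f := by
  induction x using P.cls_induction with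
  | hadd x y hx hy => rw [mul_add, add_mul, hx, hy]
  | hmul x y hx hy => rw [← mul_assoc, hx, mul_assoc, hy, mul_assoc]
  | hC c => rw [Algebra.commutes]
  | hτ => rw [τ_comm]
  | hl v => rw [φ_comm]
  | hj g => rw [jB_φ, hf]

lemma cls_zpow_comm (m : ℕ) (v : V) (x : B) :
    P.cls (P.zpow m v) * x = x * P.cls (P.zpow m v) := by
  have h : P.cls (P.zpow m v) = P.φ (∑ γ, P.l (P.ρ γ v) ^ (m + 1)) := by
    simp only [zpow, map_sum, map_pow, P.φ_lin]
  rw [h]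
  refine P.φ_central (fun g => ?_) x
  simp only [map_sum, map_pow, act_l]
  exact Fintype.sum_equiv (Equiv.mulLeft g) _ _ fun γ => by simp

lemma exists_bracket (m : ℕ) (v : V) (a : F) :
    ∃ d, P.zpow m v * a - a * P.zpow m v = P.T * P.T * d := by
  rw [← P.cls_eq_zero, map_sub, map_mul, map_mul, cls_zpow_comm, sub_self]

/-- Multiplication by `x` maps the image of `I₀` to the image of `I₁`. -/
def Maps (I₀ I₁ : TwoSidedIdeal F) (x : B) : Prop := ∀ y ∈ P.N I₀, x * y ∈ P.N I₁

/-- The annihilator of the quotient of the images of two ideals. -/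
def ann (I₀ I₁ : TwoSidedIdeal F) : Ideal (MvPolynomial (Fin n) ℂ) where
  carrier := {f | P.Maps I₀ I₁ (P.φ f)}
  add_mem' := fun {f g} hf hg y hy => by
    rw [map_add, add_mul]; exact add_mem (hf y hy) (hg y hy)
  zero_mem' := fun y _ => by rw [map_zero, zero_mul]; exact zero_mem _
  smul_mem' := fun f g hg y hy => by
    rw [smul_eq_mul, map_mul, mul_assoc]; exact P.mul_mem_N_left _ (hg y hy)

variable {P}
lemma mem_ann {I₀ I₁ : TwoSidedIdeal F} {f} : f ∈ P.ann I₀ I₁ ↔ P.Maps I₀ I₁ (P.φ f) := Iff.rfl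

lemma Maps.add {I₀ I₁ : TwoSidedIdeal F} {x y : B} (hx : P.Maps I₀ I₁ x) (hy : P.Maps I₀ I₁ y) :
    P.Maps I₀ I₁ (x + y) := fun w hw => by rw [add_mul]; exact add_mem (hx w hw) (hy w hw)

lemma Maps.sub {I₀ I₁ : TwoSidedIdeal F} {x y : B} (hx : P.Maps I₀ I₁ x) (hy : P.Maps I₀ I₁ y) :
    P.Maps I₀ I₁ (x - y) := fun w hw => by rw [sub_mul]; exact sub_mem (hx w hw) (hy w hw)

lemma Maps.mul_left {I₀ I₁ : TwoSidedIdeal F} {x : B} (hx : P.Maps I₀ I₁ x) (y : B) :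
    P.Maps I₀ I₁ (y * x) := fun w hw => by
  rw [mul_assoc]; exact P.mul_mem_N_left _ (hx w hw)

lemma Maps.mul_right {I₀ I₁ : TwoSidedIdeal F} {x : B} (hx : P.Maps I₀ I₁ x) (y : B) :
    P.Maps I₀ I₁ (x * y) := fun w hw => by
  rw [mul_assoc]; exact hx _ (P.mul_mem_N_left _ hw)

lemma Maps.sum {I₀ I₁ : TwoSidedIdeal F} {α : Type*} {s : Finset α} {x : α → B}
    (hx : ∀ i ∈ s, P.Maps I₀ I₁ (x i)) : P.Maps I₀ I₁ (∑ i ∈ s, x i) := fun w hw => by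
  rw [Finset.sum_mul]; exact sum_mem fun i hi => hx i hi w hw

lemma Maps.bracket {I₀ I₁ : TwoSidedIdeal F} (h₀ : P.Sat I₀) (h₁ : P.Sat I₁) {m : ℕ} {v : V}
    {a d : F} (hd : P.zpow m v * a - a * P.zpow m v = P.T * P.T * d)
    (ha : P.Maps I₀ I₁ (P.cls a)) : P.Maps I₀ I₁ (P.cls d) := by
  rintro _ ⟨b, hb, rfl⟩
  obtain ⟨i, hi, hiab⟩ := ha _ (P.cls_mem_N hb)
  obtain ⟨w, hw⟩ := (P.cls_eq_zero (a * b - i)).1 (by rw [map_sub, hiab, map_mul, sub_self])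
  obtain ⟨Db, hDb⟩ := P.exists_bracket m v b
  obtain ⟨Dw, hDw⟩ := P.exists_bracket m v w
  obtain ⟨Di, hDi⟩ := P.exists_bracket m v i
  have hDb0 : Db ∈ I₀ := h₀ _ (by
    rw [← hDb]; exact I₀.sub_mem (I₀.mul_mem_left _ _ hb) (I₀.mul_mem_right _ _ hb))
  have hDi1 : Di ∈ I₁ := h₁ _ (by
    rw [← hDi]; exact I₁.sub_mem (I₁.mul_mem_left _ _ hi) (I₁.mul_mem_right _ _ hi))
  set z := P.zpow m v
  have key : d * b = Di + P.T * P.T * Dw - a * Db := by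
    refine sub_eq_zero.1 (P.ħ_regular _ ?_)
    have hab : a * b = i + P.T * P.T * w := by rw [← hw]; abel
    have e1 : P.T * P.T * (d * b) = z * (a * b) - a * b * z - a * (P.T * P.T * Db) := by
      rw [← mul_assoc, ← hd, ← hDb]; noncomm_ring
    have e2 : P.T * P.T * (P.T * P.T * Dw) = z * (P.T * P.T * w) - P.T * P.T * w * z := by
      rw [← hDw, ← mul_assoc z, ← P.ħ_central z]; noncomm_ring
    rw [mul_sub, mul_sub, mul_add, e1, e2, ← hDi, hab, ← mul_assoc _ a Db, P.ħ_central a]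
    noncomm_ring
  rw [← map_mul, key, map_sub, map_add, (P.cls_eq_zero (P.T * P.T * Dw)).2 ⟨_, rfl⟩, add_zero,
    map_mul]
  exact sub_mem (P.cls_mem_N hDi1) (ha _ (P.cls_mem_N hDb0))

/-- Twisted commutators isolate the component of the identity. -/
lemma exists_mul_mem_ann {I₀ I₁ : TwoSidedIdeal F} {p : Ideal (MvPolynomial (Fin n) ℂ)}
    [hp : p.IsPrime] [DecidableEq G] (R : Finset G)
    (hR : ∀ r ∈ R, ∃ v, P.l (P.ρ r v) - P.l v ∉ p) (f : MvPolynomial (Fin n) ℂ)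
    (c : G → MvPolynomial (Fin n) ℂ) (h : P.Maps I₀ I₁ (P.φ f + ∑ r ∈ R, P.φ (c r) * P.jB r)) :
    ∃ q ∉ p, q * f ∈ P.ann I₀ I₁ := by
  induction R using Finset.induction_on generalizing f c with
  | empty =>
    refine ⟨1, (Ideal.ne_top_iff_one p).1 hp.ne_top, ?_⟩
    rw [one_mul, mem_ann]
    simpa using h
  | insert s R hs ih =>
    obtain ⟨v, hv⟩ := hR s (Finset.mem_insert_self _ _)
    obtain ⟨q, hq, hqf⟩ := ih (fun r hr => hR r (Finset.mem_insert_of_mem hr))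
      ((P.l (P.ρ s v) - P.l v) * f) (fun r => (P.l (P.ρ s v) - P.l (P.ρ r v)) * c r) (by
        have := (h.mul_left (P.φ (P.l (P.ρ s v)))).sub (h.mul_right (P.φ (P.l v)))
        convert this using 1
        rw [Finset.sum_insert hs]
        simp only [mul_add, add_mul, Finset.mul_sum, Finset.sum_mul, mul_assoc, P.jB_φ, act_l]
        simp only [← mul_assoc, ← map_mul, sub_mul, map_sub, Finset.sum_sub_distrib]
        simp only [mul_comm (c _), mul_comm f]
        abel)
    exact ⟨q * (P.l (P.ρ s v) - P.l v), hp.mul_notMem hq hv, by rwa [mul_assoc]⟩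

variable (P)

/-- The pointwise stabiliser of the zero set of an ideal. -/
def stab (p : Ideal (MvPolynomial (Fin n) ℂ)) : Subgroup G where
  carrier := {g | ∀ v, P.l (P.ρ g v) - P.l v ∈ p}
  one_mem' := fun v => by simp
  mul_mem' := fun {g h} hg hh v => by
    have := p.add_mem (hg (P.ρ h v)) (hh v)
    rwa [sub_add_sub_cancel, ← Module.End.mul_apply, ← map_mul] at this
  inv_mem' := fun {g} hg v => by
    have := p.neg_mem (hg (P.ρ g⁻¹ v))
    rwa [← Module.End.mul_apply, ← map_mul, mul_inv_cancel, map_one, Module.End.one_apply,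
      neg_sub] at this

lemma mem_stab {p : Ideal (MvPolynomial (Fin n) ℂ)} {g : G} :
    g ∈ P.stab p ↔ ∀ v, P.l (P.ρ g v) - P.l v ∈ p := Iff.rfl

open Classical in
/-- The averaging projection onto the vectors fixed by a subgroup. -/
noncomputable def pr (H : Subgroup G) : Module.End ℂ V :=
  (Nat.card H : ℂ)⁻¹ • ∑ h : H, P.ρ h

variable {P}
lemma pr_apply (H : Subgroup G) [Fintype H] (v : V) :
    P.pr H v = (Nat.card H : ℂ)⁻¹ • ∑ h : H, P.ρ h v := by
  rw [pr, LinearMap.smul_apply, LinearMap.sum_apply]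
  congr!

lemma card_ne (H : Subgroup G) : (Nat.card H : ℂ) ≠ 0 :=
  Nat.cast_ne_zero.2 Nat.card_pos.ne'

lemma ρ_pr {H : Subgroup G} {h : G} (hh : h ∈ H) (v : V) : P.ρ h (P.pr H v) = P.pr H v := by
  classical
  rw [pr_apply, map_smul, map_sum]
  congr 1
  refine Fintype.sum_equiv (Equiv.mulLeft (⟨h, hh⟩ : H)) _ _ fun γ => ?_
  simp

lemma pr_eq_self {H : Subgroup G} {v : V} (hv : ∀ h ∈ H, P.ρ h v = v) : P.pr H v = v := by
  classical
  rw [pr_apply, Finset.sum_congr rfl fun (h : H) _ => hv h h.2, Finset.sum_const, Finset.card_univ,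
    ← Nat.card_eq_fintype_card, ← Nat.cast_smul_eq_nsmul ℂ, smul_smul, inv_mul_cancel₀ (card_ne H),
    one_smul]

lemma pr_pr (H : Subgroup G) (v : V) : P.pr H (P.pr H v) = P.pr H v :=
  pr_eq_self fun _ hh => ρ_pr hh v

lemma ω_pr (H : Subgroup G) (u v : V) : P.ω (P.pr H u) v = P.ω u (P.pr H v) := by
  classical
  rw [pr_apply, pr_apply, map_smul, map_smul, LinearMap.smul_apply, map_sum, map_sum,
    LinearMap.sum_apply]
  congr 1
  refine Fintype.sum_equiv (Equiv.inv H) _ _ fun γ => ?_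
  rw [← P.ω_inv ((γ : G)⁻¹), ← Module.End.mul_apply, ← map_mul]
  simp

lemma sym_pr_sym_pr (H : Subgroup G) (f) : P.sym (P.pr H) (P.sym (P.pr H) f) =
    P.sym (P.pr H) f := by
  rw [← sym_mul]
  congr 2
  exact LinearMap.ext (pr_pr H)

lemma l_sub_pr_mem (p : Ideal (MvPolynomial (Fin n) ℂ)) (v : V) :
    P.l v - P.l (P.pr (P.stab p) v) ∈ p := by
  classical
  have h1 : P.l v - P.l (P.pr (P.stab p) v) =
      - (C (Nat.card (P.stab p) : ℂ)⁻¹ * ∑ h : P.stab p, (P.l (P.ρ h v) - P.l v)) := by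
    rw [pr_apply, map_smul, Finset.sum_sub_distrib, Finset.sum_const, Finset.card_univ,
      ← Nat.card_eq_fintype_card, mul_sub, ← Nat.cast_smul_eq_nsmul ℂ, ← smul_eq_C_mul,
      ← smul_eq_C_mul, smul_smul, inv_mul_cancel₀ (card_ne _), one_smul, map_sum, neg_sub]
  rw [h1]
  exact p.neg_mem (p.mul_mem_left _ (sum_mem fun h _ => h.2 v))

lemma sub_sym_pr_mem (p : Ideal (MvPolynomial (Fin n) ℂ)) (f) :
    f - P.sym (P.pr (P.stab p)) f ∈ p := by
  rw [← Ideal.Quotient.eq]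
  have : (Ideal.Quotient.mkₐ ℂ p) = (Ideal.Quotient.mkₐ ℂ p).comp (P.sym (P.pr (P.stab p))) := by
    refine P.algHom_ext_l fun v => ?_
    rw [AlgHom.comp_apply, sym_l]
    exact (Ideal.Quotient.eq).2 (l_sub_pr_mem p v)
  exact DFunLike.congr_fun this f

end HPres
end PoissonBracketMaps

section PoissonMinimalPrimes
open MvPolynomial
namespace HPres
variable {n : ℕ} {V G F B : Type} [AddCommGroup V] [Module ℂ V] [Group G] [Fintype G]
  [Ring F] [Algebra ℂ F] [Ring B] [Algebra ℂ B] [Module (MvPolynomial (Fin n) ℂ) B]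
  {P : HPres n V G F B}

lemma ρ_eq_of_sym_pr {H : Subgroup G} {f : MvPolynomial (Fin n) ℂ} (hf : P.sym (P.pr H) f = f)
    {h : G} (hh : h ∈ H) : P.act h f = f := by
  rw [← hf, act, ← sym_mul]
  congr 2
  exact LinearMap.ext fun v => ρ_pr hh v

lemma dl_mul (m : ℕ) (v : V) (f g : MvPolynomial (Fin n) ℂ) :
    P.dl m v (f * g) = P.dl m v f * g + f * P.dl m v g := by
  simp only [dl, Derivation.leibniz, smul_eq_mul, Finset.sum_mul, Finset.mul_sum,
    ← Finset.sum_add_distrib]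
  exact Finset.sum_congr rfl fun γ _ => by ring

lemma dl_pow (m : ℕ) (v : V) (f : MvPolynomial (Fin n) ℂ) (k : ℕ) :
    P.dl m v (f ^ (k + 1)) = ((k + 1 : ℕ) : MvPolynomial (Fin n) ℂ) * f ^ k * P.dl m v f := by
  induction k with
  | zero => simp
  | succ k ih =>
    rw [pow_succ, dl_mul, ih]
    push_cast
    ring

/-- Minimal primes over annihilators are stable under the averaged derivations, on the functions
on the fixed subspace. -/
lemma dl_mem_of_minimal {I₀ I₁ : TwoSidedIdeal F} (h₀ : P.Sat I₀) (h₁ : P.Sat I₁)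
    {p : Ideal (MvPolynomial (Fin n) ℂ)} [hp : p.IsPrime]
    (hmin : ∀ q : Ideal (MvPolynomial (Fin n) ℂ), q.IsPrime → P.ann I₀ I₁ ≤ q → q ≤ p → q = p)
    {s : MvPolynomial (Fin n) ℂ} (hs : s ∈ p) (hsH : P.sym (P.pr (P.stab p)) s = s)
    (hle : P.ann I₀ I₁ ≤ p) (m : ℕ) (v : V) : P.dl m v s ∈ p := by
  classical
  have hex : ∃ k, ∃ t ∉ p, t * s ^ k ∈ P.ann I₀ I₁ := by
    obtain ⟨t, ht, k, hk⟩ := exists_notMem_mul_pow_mem hmin hs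
    exact ⟨k, t, ht, hk⟩
  obtain ⟨t, ht, hts⟩ := Nat.find_spec hex
  have hlt := fun j (hj : j < Nat.find hex) => Nat.find_min hex hj
  generalize Nat.find hex = k at hts hlt
  cases k with
  | zero => exact absurd (hle hts) (by simpa using ht)
  | succ k =>
  by_contra hds
  have hsb : P.HasBracket m v (P.stab p) (s ^ (k + 1)) := by
    refine HasBracket.pow ?_ _
    rw [← hsH]
    exact HasBracket.sym (fun r hr u => ρ_pr hr u) s
  obtain ⟨a, d, c, ha, hd, hcd, -⟩ := HasBracket.any (P := P) m v t
  obtain ⟨a', d', c', ha', hd', hcd', hc'⟩ := hsb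
  have hprod : P.zpow m v * (a * a') - a * a' * P.zpow m v = P.T * P.T * (d * a' + a * d') := by
    rw [mul_add, ← mul_assoc _ d, ← hd, ← mul_assoc _ a d', P.ħ_central a, mul_assoc a _ d', ← hd']
    noncomm_ring
  have hM := Maps.bracket h₀ h₁ hprod (by rw [map_mul, ha, ha', ← map_mul]; exact hts)
  have hM := hM.mul_left (P.φ t)
  set R := Finset.univ.filter (fun r => r ∉ P.stab p)
  have hts' : P.Maps I₀ I₁ (P.φ (t * s ^ (k + 1))) := hts
  have hact : ∀ r ∈ P.stab p, P.act r (s ^ (k + 1)) = s ^ (k + 1) := fun r hr => by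
    rw [map_pow, ρ_eq_of_sym_pr hsH hr]
  obtain ⟨q, hq, hqf⟩ := exists_mul_mem_ann (P := P) (I₀ := I₀) (I₁ := I₁) (p := p) R
    (fun r hr => by
      have := (Finset.mem_filter.1 hr).2
      rw [mem_stab] at this
      push Not at this
      exact this) (t * t * P.dl m v (s ^ (k + 1)))
    (fun r => t * c r * P.act r (s ^ (k + 1)) + t * t * c' r) (by
      have h1 : P.Maps I₀ I₁ (P.φ (P.dl m v t) * P.φ (t * s ^ (k + 1)) +
          ∑ r ∈ Finset.univ.filter (fun r => r ∈ P.stab p),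
            P.φ (c r) * P.φ (t * s ^ (k + 1)) * P.jB r) :=
        (hts'.mul_left _).add (Maps.sum fun r _ => (hts'.mul_left _).mul_right _)
      have := hM.sub h1
      convert this using 1
      rw [map_add P.cls, map_mul P.cls, map_mul P.cls, ha, ha', hcd, hcd']
      have e1 : ∀ (x y : G → B), ∑ r, (x r + y r) =
          ∑ r ∈ Finset.univ.filter (fun r => r ∈ P.stab p), (x r + y r) + ∑ r ∈ R, (x r + y r) :=
        fun x y => (Finset.sum_filter_add_sum_filter_not _ _ _).symm
      have e2 : P.φ t * ((P.φ (P.dl m v t) + ∑ r, P.φ (c r) * P.jB r) * P.φ (s ^ (k + 1)) +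
          P.φ t * (P.φ (P.dl m v (s ^ (k + 1))) + ∑ r, P.φ (c' r) * P.jB r)) =
          P.φ (P.dl m v t) * P.φ (t * s ^ (k + 1)) + P.φ (t * t * P.dl m v (s ^ (k + 1))) +
          ∑ r, (P.φ (t * c r * P.act r (s ^ (k + 1))) * P.jB r + P.φ (t * t * c' r) * P.jB r) := by
        have : P.φ (P.dl m v t) * P.φ (t * s ^ (k + 1)) =
          P.φ t * P.φ (P.dl m v t) * P.φ (s ^ (k + 1)) := by
          rw [← map_mul, ← map_mul, ← map_mul]; congr 1; ring
        rw [this, Finset.sum_add_distrib]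
        simp only [mul_add, add_mul, Finset.mul_sum, Finset.sum_mul, map_mul P.φ, mul_assoc, P.jB_φ]
        abel
      rw [e2, e1]
      have e3 : ∑ r ∈ Finset.univ.filter (fun r => r ∈ P.stab p),
          (P.φ (t * c r * P.act r (s ^ (k + 1))) * P.jB r + P.φ (t * t * c' r) * P.jB r) =
          ∑ r ∈ Finset.univ.filter (fun r => r ∈ P.stab p),
            P.φ (c r) * P.φ (t * s ^ (k + 1)) * P.jB r := by
        refine Finset.sum_congr rfl fun r hr => ?_
        have hr := (Finset.mem_filter.1 hr).2
        rw [hact r hr, hc' r hr, mul_zero, map_zero, zero_mul, add_zero, ← map_mul]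
        congr 2
        ring
      rw [e3]
      simp only [map_add, add_mul]
      abel)
  refine hlt k k.lt_succ_self ⟨q * (t * t * (((k + 1 : ℕ) : MvPolynomial (Fin n) ℂ) *
    P.dl m v s)), hp.mul_notMem hq (hp.mul_notMem (hp.mul_notMem ht ht) (hp.mul_notMem ?_ hds)), ?_⟩
  · intro h
    refine hp.ne_top (p.eq_top_of_isUnit_mem h ?_)
    rw [← map_natCast (C : ℂ →+* MvPolynomial (Fin n) ℂ)]
    exact (isUnit_iff_ne_zero.2 (Nat.cast_ne_zero.2 k.succ_ne_zero)).map C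
  · rw [dl_pow] at hqf
    convert hqf using 1
    ring

/-- A symmetrisation of the Hamiltonian derivations preserves a minimal prime. -/
lemma pb_mem_of_dl_mem {p : Ideal (MvPolynomial (Fin n) ℂ)} [hp : p.IsPrime]
    {s : MvPolynomial (Fin n) ℂ} (h : ∀ m v, P.dl m v s ∈ p) (v : V)
    (hv : ∀ γ ∉ P.stab p, P.l (P.ρ γ v) - P.l v ∉ p) :
    P.pb (P.pr (P.stab p) v) s ∈ p := by
  classical
  have h1 : ∀ m, ∑ γ, P.l (P.ρ γ v) ^ m * P.pb (P.ρ γ v) s ∈ p := fun m => by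
    have := h m v
    simp only [dl, mul_assoc, ← Finset.mul_sum] at this
    refine (hp.mem_or_mem this).resolve_left fun h => ?_
    refine hp.ne_top (p.eq_top_of_isUnit_mem h ?_)
    rw [← map_natCast (C : ℂ →+* MvPolynomial (Fin n) ℂ)]
    exact (isUnit_iff_ne_zero.2 (Nat.cast_ne_zero.2 m.succ_ne_zero)).map C
  have h2 : ∀ q : Polynomial (MvPolynomial (Fin n) ℂ),
      ∑ γ, q.eval (P.l (P.ρ γ v)) * P.pb (P.ρ γ v) s ∈ p := fun q => by
    induction q using Polynomial.induction_on' with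
    | add q r hq hr =>
      simp only [Polynomial.eval_add, add_mul, Finset.sum_add_distrib]
      exact p.add_mem hq hr
    | monomial m a =>
      simp only [Polynomial.eval_monomial, mul_assoc, ← Finset.mul_sum]
      exact p.mul_mem_left _ (h1 m)
  have h3 := h2 (∏ γ ∈ Finset.univ.filter (fun r => r ∉ P.stab p),
    (Polynomial.X - Polynomial.C (P.l (P.ρ γ v))))
  simp only [Polynomial.eval_prod, Polynomial.eval_sub, Polynomial.eval_X, Polynomial.eval_C] at h3
  rw [← Finset.sum_filter_add_sum_filter_not _ (fun r => r ∈ P.stab p)] at h3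
  rw [Finset.sum_eq_zero (s := Finset.univ.filter (fun r => r ∉ P.stab p)) (fun γ hγ => by
    rw [Finset.prod_eq_zero hγ (sub_self _), zero_mul]), add_zero] at h3
  set w := ∏ γ ∈ Finset.univ.filter (fun r => r ∉ P.stab p), (P.l v - P.l (P.ρ γ v)) with hw
  have hwp : w ∉ p := fun h => by
    obtain ⟨γ, hγ, hγp⟩ := (Ideal.IsPrime.prod_mem_iff).1 h
    refine hv γ (Finset.mem_filter.1 hγ).2 ?_
    rw [← neg_sub]
    exact p.neg_mem hγp
  have h4 : w * ∑ γ ∈ Finset.univ.filter (fun r => r ∈ P.stab p), P.pb (P.ρ γ v) s ∈ p := by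
    rw [← Ideal.Quotient.eq_zero_iff_mem, map_mul, map_sum, Finset.mul_sum] 
    rw [← Ideal.Quotient.eq_zero_iff_mem, map_sum] at h3
    rw [← h3]
    refine Finset.sum_congr rfl fun γ hγ => ?_
    rw [map_mul]
    congr 1
    rw [hw, map_prod, map_prod]
    refine Finset.prod_congr rfl fun δ _ => ?_
    rw [map_sub, map_sub, sub_left_inj, eq_comm, Ideal.Quotient.eq]
    exact (Finset.mem_filter.1 hγ).2 v
  have h5 := (hp.mem_or_mem h4).resolve_left hwp
  have h6 : P.pb (P.pr (P.stab p) v) s = (Nat.card (P.stab p) : ℂ)⁻¹ •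
      ∑ γ ∈ Finset.univ.filter (fun r => r ∈ P.stab p), P.pb (P.ρ γ v) s := by
    rw [pr_apply, ← Finset.sum_subtype_of_mem (p := fun r => r ∈ P.stab p)
      (fun γ => P.pb (P.ρ γ v) s) (by simp)]
    change P.pbLin s _ = _
    rw [map_smul, map_sum]
    congr 1
    refine Finset.sum_bij' (fun γ _ => ⟨γ, by simp⟩) (fun γ _ => ⟨γ, by simp⟩) ?_ ?_ ?_ ?_ ?_ <;> simp [pbLin]
  rw [h6, smul_eq_C_mul]
  exact p.mul_mem_left _ h5

lemma pb_pr {H : Subgroup G} {s : MvPolynomial (Fin n) ℂ} (hs : P.sym (P.pr H) s = s) (v : V) :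
    P.pb (P.pr H v) s = P.pb v s ∧ P.sym (P.pr H) (P.pb v s) = P.pb v s := by
  suffices h : ∀ f, P.pb (P.pr H v) (P.sym (P.pr H) f) = P.pb v (P.sym (P.pr H) f) ∧
      P.sym (P.pr H) (P.pb v (P.sym (P.pr H) f)) = P.pb v (P.sym (P.pr H) f) by
    simpa only [hs] using h s
  intro f
  induction f using MvPolynomial.induction_on with
  | C a => rw [← algebraMap_eq, AlgHom.commutes]; simp
  | add f g hf hg => simp only [map_add, hf.1, hf.2, hg.1, hg.2, and_self]
  | mul_X f i hf =>
    simp only [map_mul, sym_X, Derivation.leibniz, smul_eq_mul, map_add, hf.1, hf.2, pb_l, ω_pr,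
      pr_pr, sym_pr_sym_pr, sym_l, true_and]
    rw [← algebraMap_eq, AlgHom.commutes]

lemma forall_of_generic {p : Ideal (MvPolynomial (Fin n) ℂ)}
    (W : Submodule ℂ V)
    (h : ∀ v, (∀ γ ∉ P.stab p, P.l (P.ρ γ v) - P.l v ∉ p) → v ∈ W) (v : V) : v ∈ W := by
  classical
  let E : G → Submodule ℂ V := fun γ =>
    (p.restrictScalars ℂ).comap (P.l ∘ₗ P.ρ γ - P.l)
  by_contra hvW
  have := Subspace.biUnion_ne_univ_of_top_notMem (k := ℂ) (E := V)
    (s := insert W ((Finset.univ.filter (fun r => r ∉ P.stab p)).image E)) (by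
      intro hmem
      rcases Finset.mem_insert.1 hmem with h | h
      · rw [← h] at hvW; exact hvW trivial
      · obtain ⟨γ, hγ, hE⟩ := Finset.mem_image.1 h
        refine (Finset.mem_filter.1 hγ).2 fun v => ?_
        have : v ∈ E γ := hE ▸ trivial
        exact this)
  refine this (Set.eq_univ_of_forall fun w => ?_)
  by_cases hw : ∀ γ ∉ P.stab p, P.l (P.ρ γ w) - P.l w ∉ p
  · exact Set.mem_biUnion (Finset.mem_coe.2 (Finset.mem_insert_self _ _)) (h w hw)
  · push Not at hw
    obtain ⟨γ, hγ, hγp⟩ := hw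
    exact Set.mem_biUnion (Finset.mem_coe.2 (Finset.mem_insert_of_mem
      (Finset.mem_image_of_mem _ (by simpa using hγ)))) (show w ∈ E γ from hγp)

lemma exists_pb_eq_pderiv (i : Fin n) : ∃ v, ∀ f, P.pb v f = pderiv i f := by
  have hfd : FiniteDimensional ℂ V := P.b.finiteDimensional_of_finite
  have hinj : Function.Injective P.ω := by
    rw [← LinearMap.ker_eq_bot, LinearMap.ker_eq_bot']
    intro v hv
    exact P.ω_nondeg v fun w => by rw [hv]; rfl
  have hsurj : Function.Surjective P.ω :=
    (LinearMap.injective_iff_surjective_of_finrank_eq_finrank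
      (Subspace.dual_finrank_eq (K := ℂ) (V := V)).symm).1 hinj
  obtain ⟨v, hv⟩ := hsurj (P.b.coord i)
  refine ⟨v, fun f => ?_⟩
  have : P.pb v = pderiv i := MvPolynomial.derivation_ext fun j => by
    rw [pb, mkDerivation_X, hv, pderiv_X]
    simp [Pi.single_apply, Finsupp.single_apply]
  rw [this]

lemma eq_zero_of_forall_pderiv_mem {Q : Submodule ℂ (MvPolynomial (Fin n) ℂ)}
    (h1 : (1 : MvPolynomial (Fin n) ℂ) ∉ Q) (h : ∀ f ∈ Q, ∀ i, pderiv i f ∈ Q)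
    {f : MvPolynomial (Fin n) ℂ} (hf : f ∈ Q) : f = 0 := by
  suffices H : ∀ k : ℕ, ∀ f ∈ Q, (∀ d : Fin n →₀ ℕ, k ≤ d.degree → coeff d f = 0) → f = 0 by
    refine H (f.totalDegree + 1) f hf fun d hd => coeff_eq_zero_of_totalDegree_lt ?_
    rw [Finsupp.degree] at hd
    exact hd
  intro k
  induction k with
  | zero => exact fun f _ hf => MvPolynomial.ext _ _ fun d => hf d d.degree.zero_le
  | succ k ih =>
    intro f hf hd
    have hder : ∀ i, pderiv i f = 0 := fun i => ih _ (h f hf i) fun d hdk => by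
      rw [coeff_pderiv, hd _ (by simpa using hdk), zero_mul]
    have hfC : f = C (coeff 0 f) := by
      refine MvPolynomial.ext _ _ fun d => ?_
      rw [coeff_C]
      split_ifs with h0
      · rw [h0]
      · obtain ⟨i, hi⟩ := Finsupp.ne_iff.1 (Ne.symm h0)
        have := coeff_pderiv (i := i) f (d - Finsupp.single i 1)
        rw [hder, coeff_zero, tsub_add_cancel_of_le (by
          simpa [Finsupp.single_le_iff] using Nat.one_le_iff_ne_zero.2 hi)] at this
        refine (mul_eq_zero.1 this.symm).resolve_right ?_
        exact Nat.cast_add_one_ne_zero _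
    by_contra hne
    have hc : coeff 0 f ≠ 0 := fun h0 => hne (by rw [hfC, h0, C_0])
    refine h1 ?_
    have := Q.smul_mem (coeff 0 f)⁻¹ hf
    rwa [hfC, coeff_zero_C, smul_eq_C_mul, ← C_mul, inv_mul_cancel₀ hc, C_1] at this

/-- Minimal primes over annihilators are the ideals of the fixed subspaces of stabilisers. -/
theorem mem_minimal_iff {I₀ I₁ : TwoSidedIdeal F} (h₀ : P.Sat I₀) (h₁ : P.Sat I₁)
    {p : Ideal (MvPolynomial (Fin n) ℂ)} (hp : p ∈ (P.ann I₀ I₁).minimalPrimes)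
    (f : MvPolynomial (Fin n) ℂ) : f ∈ p ↔ P.sym (P.pr (P.stab p)) f = 0 := by
  have hpp : p.IsPrime := hp.1.1
  have hle : P.ann I₀ I₁ ≤ p := hp.1.2
  have hmin : ∀ q : Ideal (MvPolynomial (Fin n) ℂ), q.IsPrime → P.ann I₀ I₁ ≤ q → q ≤ p → q = p :=
    fun q hq hIq hqp => le_antisymm hqp (hp.2 ⟨hq, hIq⟩ hqp)
  constructor
  · intro hf
    have hs : P.sym (P.pr (P.stab p)) f ∈ p := by
      have := p.sub_mem hf (sub_sym_pr_mem (P := P) p f)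
      rwa [sub_sub_cancel] at this
    let Q : Submodule ℂ (MvPolynomial (Fin n) ℂ) :=
      p.restrictScalars ℂ ⊓ LinearMap.ker ((P.sym (P.pr (P.stab p))).toLinearMap - LinearMap.id)
    have hQ : ∀ g, g ∈ Q ↔ g ∈ p ∧ P.sym (P.pr (P.stab p)) g = g := fun g => by
      simp [Q, LinearMap.mem_ker, sub_eq_zero]
    refine eq_zero_of_forall_pderiv_mem (Q := Q) (fun h1 => ?_) (fun g hg i => ?_)
      ((hQ _).2 ⟨hs, sym_pr_sym_pr _ _⟩)
    · exact (Ideal.ne_top_iff_one p).1 hpp.ne_top ((hQ _).1 h1).1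
    · obtain ⟨v, hv⟩ := P.exists_pb_eq_pderiv i
      obtain ⟨hgp, hgs⟩ := (hQ _).1 hg
      rw [← hv, hQ]
      refine ⟨?_, (pb_pr (P := P) hgs v).2⟩
      rw [← (pb_pr (P := P) hgs v).1]
      exact forall_of_generic (P := P) (p := p) ((p.restrictScalars ℂ).comap (P.pbLin g ∘ₗ P.pr (P.stab p)))
        (fun w hw => pb_mem_of_dl_mem (fun m v => dl_mem_of_minimal h₀ h₁ hmin hgp hgs hle m v)
          w hw) v
  · intro hf
    have := sub_sym_pr_mem (P := P) p f
    rwa [hf, sub_zero] at this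

end HPres
end PoissonMinimalPrimes

section Normalization
open MvPolynomial
lemma exists_ne_zero_dvd_of_finite {O R : Type*} [CommRing O] [Nontrivial O] [CommRing R]
    [IsDomain R] {ι : O →+* R} (hι : ι.Finite) {x : R} (hx : x ≠ 0) :
    ∃ o ≠ 0, ∃ b, ι o = x * b := by
  let := ι.toAlgebra
  have : Module.Finite O R := hι
  have := Ideal.comap_ne_bot_of_integral_mem (I := Ideal.span {x})
    hx (Ideal.mem_span_singleton_self _) (Algebra.IsIntegral.isIntegral (R := O) x)
  obtain ⟨o, ho, ho0⟩ := Submodule.exists_mem_ne_zero_of_ne_bot this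
  obtain ⟨b, hb⟩ := Ideal.mem_span_singleton'.1 (Ideal.mem_comap.1 ho)
  exact ⟨o, ho0, b, by rw [mul_comm, hb]; rfl⟩

lemma exists_generators_of_finite {O R : Type*} [CommRing O] [CommRing R]
    {ι : O →+* R} (hι : ι.Finite) :
    ∃ (q : ℕ) (a : Fin q → R), ∀ x, ∃ o : Fin q → O, x = ∑ j, ι (o j) * a j := by
  let := ι.toAlgebra
  have : Module.Finite O R := hι
  obtain ⟨q, a, ha⟩ := Module.Finite.exists_fin (R := O) (M := R)
  refine ⟨q, a, fun x => ?_⟩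
  obtain ⟨o, ho⟩ := (Submodule.mem_span_range_iff_exists_fun O).1 (ha ▸ Submodule.mem_top (x := x))
  exact ⟨o, ho.symm⟩

namespace HPres
variable {n : ℕ} {V G F B : Type} [AddCommGroup V] [Module ℂ V] [Group G] [Fintype G]
  [Ring F] [Algebra ℂ F] [Ring B] [Algebra ℂ B] [Module (MvPolynomial (Fin n) ℂ) B]
  (P : HPres n V G F B)

/-- The invariant polynomials. -/
def inv : Subalgebra ℂ (MvPolynomial (Fin n) ℂ) where
  carrier := {f | ∀ g, P.act g f = f}
  mul_mem' := fun ha hb g => by rw [map_mul, ha g, hb g]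
  add_mem' := fun ha hb g => by rw [map_add, ha g, hb g]
  algebraMap_mem' := fun r g => AlgHom.commutes _ r

lemma finite_inv : Module.Finite P.inv (MvPolynomial (Fin n) ℂ) := by
  let : MulSemiringAction G (MvPolynomial (Fin n) ℂ) :=
    { smul := fun g f => P.act g f
      one_smul := P.act_one
      mul_smul := P.act_mul
      smul_zero := fun g => map_zero _
      smul_add := fun g => map_add _
      smul_one := fun g => map_one _
      smul_mul := fun g => map_mul _ }
  have : Algebra.IsInvariant P.inv (MvPolynomial (Fin n) ℂ) G :=
    ⟨fun b hb => ⟨⟨b, hb⟩, rfl⟩⟩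
  have : Algebra.IsIntegral P.inv (MvPolynomial (Fin n) ℂ) :=
    Algebra.IsInvariant.isIntegral P.inv (MvPolynomial (Fin n) ℂ) G
  have : Algebra.FiniteType P.inv (MvPolynomial (Fin n) ℂ) :=
    Algebra.FiniteType.of_restrictScalars_finiteType ℂ _ _
  exact Algebra.IsIntegral.finite

lemma finiteType_inv : Algebra.FiniteType ℂ P.inv :=
  ⟨fg_of_fg_of_fg ℂ P.inv (MvPolynomial (Fin n) ℂ) Algebra.FiniteType.out
    P.finite_inv.1 Subtype.val_injective⟩

/-- Noether normalisation of a prime quotient by invariant polynomials. -/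
theorem exists_normalization (p : Ideal (MvPolynomial (Fin n) ℂ)) [hp : p.IsPrime] :
    ∃ (s : ℕ) (θ : MvPolynomial (Fin s) ℂ →ₐ[ℂ] MvPolynomial (Fin n) ℂ),
      (∀ g o, P.act g (θ o) = θ o) ∧ (∀ o, θ o ∈ p → o = 0) ∧
      (∀ f ∉ p, ∃ o ≠ 0, ∃ b, θ o - f * b ∈ p) ∧
      ∃ (q : ℕ) (a : Fin q → MvPolynomial (Fin n) ℂ), ∀ f, ∃ o : Fin q → MvPolynomial (Fin s) ℂ,
        f - ∑ j, θ (o j) * a j ∈ p := by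
  have := P.finite_inv
  have := P.finiteType_inv
  set pA : Ideal P.inv := p.comap (algebraMap P.inv (MvPolynomial (Fin n) ℂ)) with hpA
  have : pA.IsPrime := Ideal.comap_isPrime _ _
  have : Nontrivial (P.inv ⧸ pA) := Ideal.Quotient.nontrivial_iff.2 (Ideal.IsPrime.ne_top ‹_›)
  have : Algebra.FiniteType ℂ (P.inv ⧸ pA) :=
    Algebra.FiniteType.of_surjective (Ideal.Quotient.mkₐ ℂ pA) Ideal.Quotient.mk_surjective
  obtain ⟨s, g, hg, hgf⟩ := exists_finite_inj_algHom_of_fg ℂ (P.inv ⧸ pA)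
  choose lft hlft using fun i => Ideal.Quotient.mk_surjective (I := pA) (g (X i))
  let θ₀ : MvPolynomial (Fin s) ℂ →ₐ[ℂ] P.inv := aeval lft
  have hθ₀ : ∀ o, Ideal.Quotient.mk pA (θ₀ o) = g o := by
    have : (Ideal.Quotient.mkₐ ℂ pA).comp θ₀ = g := MvPolynomial.algHom_ext fun i => by
      simp [θ₀, hlft]
    exact fun o => DFunLike.congr_fun this o
  have hθp : ∀ o, ((θ₀ o : P.inv) : MvPolynomial (Fin n) ℂ) ∈ p → o = 0 := fun o ho => by
    apply hg
    rw [← hθ₀, map_zero, Ideal.Quotient.eq_zero_iff_mem]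
    exact ho
  let ι : MvPolynomial (Fin s) ℂ →+* (MvPolynomial (Fin n) ℂ ⧸ p) :=
    (Ideal.Quotient.mk p).comp ((P.inv.val.comp θ₀ : _ →ₐ[ℂ] _) : _ →+* _)
  have hfin : ι.Finite := by
    have h1 : ι = (Ideal.quotientMap p (algebraMap P.inv (MvPolynomial (Fin n) ℂ)) le_rfl).comp
        (g : MvPolynomial (Fin s) ℂ →+* _) := by
      refine RingHom.ext fun o => ?_
      simp only [RingHom.comp_apply, RingHom.coe_coe, ← hθ₀, ι]
      rfl
    rw [h1]
    refine RingHom.Finite.comp ?_ hgf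
    refine RingHom.Finite.of_comp_finite (f := Ideal.Quotient.mk pA) ?_
    have h2 : (Ideal.quotientMap p (algebraMap P.inv (MvPolynomial (Fin n) ℂ)) le_rfl).comp
        (Ideal.Quotient.mk pA) = (Ideal.Quotient.mk p).comp (algebraMap P.inv _) :=
      RingHom.ext fun x => rfl
    rw [h2]
    exact (RingHom.Finite.of_surjective _ Ideal.Quotient.mk_surjective).comp
      (RingHom.finite_algebraMap.2 P.finite_inv)
  refine ⟨s, P.inv.val.comp θ₀, fun g o => (θ₀ o).2 g, hθp, fun f hf => ?_, ?_⟩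
  · obtain ⟨o, ho, b, hb⟩ := exists_ne_zero_dvd_of_finite hfin
      (fun h => hf (Ideal.Quotient.eq_zero_iff_mem.1 h) : Ideal.Quotient.mk p f ≠ 0)
    obtain ⟨b, rfl⟩ := Ideal.Quotient.mk_surjective b
    refine ⟨o, ho, b, ?_⟩
    rw [← Ideal.Quotient.eq, map_mul, ← hb]
    rfl
  · obtain ⟨q, y, hy⟩ := exists_generators_of_finite hfin
    choose a ha using fun j => Ideal.Quotient.mk_surjective (y j)
    refine ⟨q, a, fun f => ?_⟩
    obtain ⟨o, ho⟩ := hy (Ideal.Quotient.mk p f)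
    refine ⟨o, ?_⟩
    rw [← Ideal.Quotient.eq, ho, map_sum]
    refine Finset.sum_congr rfl fun j _ => ?_
    rw [map_mul, ha]
    rfl

end HPres
end Normalization

section LocalizedSubquotient
open TensorProduct

variable {O K B : Type} [CommRing O] [IsDomain O] [Field K] [Algebra O K] [IsFractionRing O K]
  [AddCommGroup B] [Module O B]

lemma exists_localization (D N₁ : Submodule O B) :
    ∃ (N : Type) (_ : AddCommGroup N) (_ : Module K N) (lc : B → N),
      (∀ x ∈ D, ∀ y ∈ D, lc (x + y) = lc x + lc y) ∧
      (∀ o, ∀ x ∈ D, lc (o • x) = algebraMap O K o • lc x) ∧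
      (∀ x ∈ D, lc x = 0 ↔ ∃ o : O, o ≠ 0 ∧ o • x ∈ N₁) ∧
      (∀ ξ, ∃ o : O, o ≠ 0 ∧ ∃ x ∈ D, lc x = algebraMap O K o • ξ) ∧
      ∀ f : B → N, (∀ x ∈ D, ∀ y ∈ D, f (x + y) = f x + f y) →
        (∀ o, ∀ x ∈ D, f (o • x) = algebraMap O K o • f x) → (∀ x ∈ N₁, f x = 0) →
        ∃ R : Module.End K N, ∀ x ∈ D, R (lc x) = f x := by
  classical
  let N' : Submodule O D := N₁.comap D.subtype
  let i : D ⧸ N' →ₗ[O] K ⊗[O] (D ⧸ N') := TensorProduct.mk O K (D ⧸ N') 1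
  have hloc : IsLocalizedModule (nonZeroDivisors O) i :=
    (isLocalizedModule_iff_isBaseChange (nonZeroDivisors O) K i).2 (TensorProduct.isBaseChange O _ K)
  have hsm : ∀ (o : O) (ξ : K ⊗[O] (D ⧸ N')), o • ξ = algebraMap O K o • ξ := fun o ξ =>
    (algebraMap_smul K o ξ).symm
  let lc : B → K ⊗[O] (D ⧸ N') := fun x => if hx : x ∈ D then i (N'.mkQ ⟨x, hx⟩) else 0
  have hlc : ∀ x (hx : x ∈ D), lc x = i (N'.mkQ ⟨x, hx⟩) := fun x hx => dif_pos hx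
  refine ⟨K ⊗[O] (D ⧸ N'), inferInstance, inferInstance, lc, fun x hx y hy => ?_, fun o x hx => ?_,
    fun x hx => ?_, fun ξ => ?_, fun f hfa hfs hf0 => ?_⟩
  · rw [hlc x hx, hlc y hy, hlc _ (D.add_mem hx hy), ← map_add, ← map_add]
    rfl
  · rw [hlc x hx, hlc _ (D.smul_mem o hx), ← hsm, ← map_smul, ← map_smul]
    rfl
  · rw [hlc x hx, IsLocalizedModule.eq_zero_iff (nonZeroDivisors O)]
    constructor
    · rintro ⟨c, hc⟩
      refine ⟨c, nonZeroDivisors.ne_zero c.2, ?_⟩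
      rw [Submonoid.smul_def, ← map_smul, Submodule.mkQ_apply, Submodule.Quotient.mk_eq_zero] at hc
      exact hc
    · rintro ⟨o, ho, h⟩
      refine ⟨⟨o, mem_nonZeroDivisors_of_ne_zero ho⟩, ?_⟩
      rw [Submonoid.smul_def, ← map_smul, Submodule.mkQ_apply, Submodule.Quotient.mk_eq_zero]
      exact h
  · obtain ⟨⟨m, s⟩, hms⟩ := IsLocalizedModule.surj (nonZeroDivisors O) i ξ
    obtain ⟨⟨x, hx⟩, rfl⟩ := N'.mkQ_surjective m
    refine ⟨s, nonZeroDivisors.ne_zero s.2, x, hx, ?_⟩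
    rw [hlc x hx, ← hsm]
    exact hms.symm
  · let f₀ : D →ₗ[O] K ⊗[O] (D ⧸ N') :=
      { toFun := fun x => f x
        map_add' := fun x y => hfa x x.2 y y.2
        map_smul' := fun o x => by rw [RingHom.id_apply, hsm]; exact hfs o x x.2 }
    let f₁ := N'.liftQ f₀ (fun x hx => hf0 x hx)
    refine ⟨f₁.liftBaseChange K, fun x hx => ?_⟩
    rw [hlc x hx]
    simp only [i, TensorProduct.mk_apply, LinearMap.liftBaseChange_tmul, one_smul]
    rfl

/-- Localisation of a subquotient at a central operator `T` which is invertible up to scalars. -/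
theorem exists_localization_of_operator (N₀ N₁ : Submodule O B) (h : N₁ ≤ N₀) (T U : B →ₗ[O] B)
    (hT0 : ∀ x ∈ N₀, T x ∈ N₀) (hT1 : ∀ x ∈ N₁, T x ∈ N₁) (hU0 : ∀ x ∈ N₀, U x ∈ N₀)
    (hU1 : ∀ x ∈ N₁, U x ∈ N₁) (hTU : ∀ x, T (U x) = U (T x)) (o₀ : O) (ho₀ : o₀ ≠ 0)
    (ho : ∀ x ∈ N₀, o₀ • T x - T (U (T x)) ∈ N₁) :
    ∃ (N : Type) (_ : AddCommGroup N) (_ : Module K N) (p : B → N),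
      (∀ x ∈ N₀, ∀ y ∈ N₀, p (x + y) = p x + p y) ∧
      (∀ o, ∀ x ∈ N₀, p (o • x) = algebraMap O K o • p x) ∧
      (∀ x ∈ N₁, p x = 0) ∧
      (∀ x ∈ N₀, p x = 0 → ∃ o : O, o ≠ 0 ∧ o • T x ∈ N₁) ∧
      (∀ x ∈ N₀.map T ⊔ N₁, p x = 0 → ∃ o : O, o ≠ 0 ∧ o • x ∈ N₁) ∧
      (∀ ξ, ∃ o : O, o ≠ 0 ∧ ∃ x ∈ N₀.map T ⊔ N₁, p x = algebraMap O K o • ξ) ∧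
      (∀ f : B → N, (∀ x ∈ N₀.map T ⊔ N₁, ∀ y ∈ N₀.map T ⊔ N₁, f (x + y) = f x + f y) →
        (∀ o, ∀ x ∈ N₀.map T ⊔ N₁, f (o • x) = algebraMap O K o • f x) → (∀ x ∈ N₁, f x = 0) →
        ∃ R : Module.End K N, ∀ x ∈ N₀.map T ⊔ N₁, R (p x) = f x) ∧
      ∀ f : B →ₗ[O] B, (∀ x ∈ N₀, f x ∈ N₀) → (∀ x ∈ N₁, f x ∈ N₁) → (∀ x, f (T x) = T (f x)) →
        ∃ R : Module.End K N, ∀ x ∈ N₀, R (p x) = p (f x) := by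
  set D := N₀.map T ⊔ N₁ with hD
  have hD0 : D ≤ N₀ := sup_le (Submodule.map_le_iff_le_comap.2 hT0) h
  have hTD : ∀ x ∈ N₀, T x ∈ D := fun x hx => Submodule.mem_sup_left (Submodule.mem_map_of_mem hx)
  obtain ⟨N, iN, iM, lc, hadd, hsmul, hker, hsurj, hlift⟩ :=
    exists_localization (K := K) D N₁
  have hUT : ∀ x ∈ N₀, U (T x) ∈ D := fun x hx => by rw [← hTU]; exact hTD _ (hU0 x hx)
  have hK : algebraMap O K o₀ ≠ 0 := fun h0 => ho₀ (IsFractionRing.injective O K (by rw [h0, map_zero]))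
  have hlc1 : ∀ x ∈ N₁, lc x = 0 := fun x hx =>
    (hker x (Submodule.mem_sup_right hx)).2 ⟨1, one_ne_zero, by rwa [one_smul]⟩
  have hsub : ∀ x ∈ D, ∀ y ∈ D, x - y ∈ N₁ → lc x = lc y := fun x hx y hy hxy => by
    rw [← sub_add_cancel x y, hadd _ (Submodule.mem_sup_right hxy) _ hy, hlc1 _ hxy, zero_add]
  let p : B → N := fun x => (algebraMap O K o₀)⁻¹ • lc (U (T x))
  have hpD : ∀ x ∈ D, p x = lc x := fun x hx => by
    simp only [p]
    rw [inv_smul_eq_iff₀ hK, ← hsmul o₀ x hx]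
    refine (hsub _ (D.smul_mem _ hx) _ (hUT x (hD0 hx)) ?_).symm
    obtain ⟨_, ⟨z, hz, rfl⟩, w, hw, rfl⟩ := Submodule.mem_sup.1 hx
    have := N₁.add_mem (ho z hz) (N₁.sub_mem (N₁.smul_mem o₀ hw) (hU1 _ (hT1 _ hw)))
    convert this using 1
    rw [hTU, smul_add, map_add, map_add]
    abel
  have hpadd : ∀ x ∈ N₀, ∀ y ∈ N₀, p (x + y) = p x + p y := fun x hx y hy => by
    simp only [p]
    rw [map_add, map_add, hadd _ (hUT x hx) _ (hUT y hy), smul_add]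
  have hpsmul : ∀ o, ∀ x ∈ N₀, p (o • x) = algebraMap O K o • p x := fun o x hx => by
    simp only [p]
    rw [map_smul, map_smul, hsmul _ _ (hUT x hx), smul_comm]
  have hp1 : ∀ x ∈ N₁, p x = 0 := fun x hx => by
    simp only [p]
    rw [hlc1 _ (hU1 _ (hT1 _ hx)), smul_zero]
  have hliftD : ∀ f : B → N, (∀ x ∈ D, ∀ y ∈ D, f (x + y) = f x + f y) →
        (∀ o, ∀ x ∈ D, f (o • x) = algebraMap O K o • f x) → (∀ x ∈ N₁, f x = 0) →
        ∃ R : Module.End K N, ∀ x ∈ D, R (p x) = f x := fun f h1 h2 h3 => by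
    obtain ⟨R, hR⟩ := hlift f h1 h2 h3
    exact ⟨R, fun x hx => by rw [hpD x hx, hR x hx]⟩
  refine ⟨N, iN, iM, p, hpadd, hpsmul, hp1, fun x hx hpx => ?_, fun x hx hpx => ?_, fun ξ => ?_,
    hliftD, fun f hf0 hf1 hfT => ?_⟩
  · obtain ⟨o, ho', hox⟩ := (hker _ (hUT x hx)).1
      ((smul_eq_zero.1 hpx).resolve_left (inv_ne_zero hK))
    refine ⟨o * o₀, mul_ne_zero ho' ho₀, ?_⟩
    have := N₁.add_mem (hT1 _ hox) (N₁.smul_mem o (ho x hx))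
    convert this using 1
    rw [map_smul, mul_smul, smul_sub]
    abel
  · rw [hpD x hx] at hpx
    exact (hker x hx).1 hpx
  · obtain ⟨o, ho', x, hx, hox⟩ := hsurj ξ
    exact ⟨o, ho', x, hx, by rw [hpD x hx, hox]⟩
  · have hfD : ∀ x ∈ D, f x ∈ D := fun x hx => by
      obtain ⟨_, ⟨z, hz, rfl⟩, w, hw, rfl⟩ := Submodule.mem_sup.1 hx
      rw [map_add, hfT]
      exact D.add_mem (hTD _ (hf0 z hz)) (Submodule.mem_sup_right (hf1 w hw))
    obtain ⟨R, hR⟩ := hliftD (fun x => p (f x))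
      (fun x hx y hy => by rw [map_add, hpadd _ (hD0 (hfD x hx)) _ (hD0 (hfD y hy))])
      (fun o x hx => by rw [map_smul, hpsmul _ _ (hD0 (hfD x hx))])
      (fun x hx => hp1 _ (hf1 x hx))
    refine ⟨R, fun x hx => ?_⟩
    have h1 : p x = (algebraMap O K o₀)⁻¹ • p (U (T x)) := by rw [hpD _ (hUT x hx)]
    rw [h1, map_smul, hR _ (hUT x hx), inv_smul_eq_iff₀ hK, ← hpsmul _ _ (hf0 x hx)]
    have hz : f (o₀ • x - U (T x)) ∈ N₀ :=
      hf0 _ (N₀.sub_mem (N₀.smul_mem _ hx) (hU0 _ (hT0 _ hx)))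
    have hz0 : p (f (o₀ • x - U (T x))) = 0 := by
      simp only [p]
      rw [← hfT, map_sub T, map_smul T, hlc1 _ (hU1 _ (hf1 _ (ho x hx))), smul_zero]
    have h2 : o₀ • f x = f (U (T x)) + f (o₀ • x - U (T x)) := by
      rw [← map_smul, ← map_add]; congr 1; abel
    rw [h2, hpadd _ (hf0 _ (hU0 _ (hT0 _ hx))) _ hz, hz0, add_zero]

end LocalizedSubquotient

section LocalizedBimodule
open MvPolynomial
namespace HPres
variable {n : ℕ} {V G F B : Type} [AddCommGroup V] [Module ℂ V] [Group G] [Fintype G]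
  [Ring F] [Algebra ℂ F] [Ring B] [Algebra ℂ B] [Module (MvPolynomial (Fin n) ℂ) B]
  (P : HPres n V G F B)

/-- The localisation of the quotient of the images of two ideals at a prime, as a vector space
over the function field of a Noether normalisation. -/
structure Loc (p : Ideal (MvPolynomial (Fin n) ℂ)) {s : ℕ}
    (θ : MvPolynomial (Fin s) ℂ →ₐ[ℂ] MvPolynomial (Fin n) ℂ) (K : Type) [Field K]
    [Algebra (MvPolynomial (Fin s) ℂ) K] (I₀ I₁ : TwoSidedIdeal F) where
  N : Type
  [acg : AddCommGroup N]
  [mod : Module K N]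
  π : B → N
  D : Submodule (MvPolynomial (Fin n) ℂ) B
  t : MvPolynomial (Fin n) ℂ
  t_notMem : t ∉ p
  D_le : D ≤ P.N I₀
  t_mem : ∀ y ∈ P.N I₀, P.φ t * y ∈ D
  D_right : ∀ y ∈ D, ∀ b, y * b ∈ D
  D_stab : ∀ g ∈ P.stab p, ∀ y ∈ D, P.jB g * y ∈ D
  k : ℕ
  pow_mem : ∀ f ∈ p ^ k, ∀ y ∈ D, P.φ f * y ∈ P.N I₁
  π_add : ∀ x ∈ P.N I₀, ∀ y ∈ P.N I₀, π (x + y) = π x + π y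
  π_smul : ∀ o, ∀ x ∈ P.N I₀, π (P.φ (θ o) * x) = algebraMap _ K o • π x
  π_zero : ∀ x ∈ P.N I₁, π x = 0
  π_ker : ∀ x ∈ P.N I₀, π x = 0 → ∃ o ≠ 0, P.φ (θ o * t) * x ∈ P.N I₁
  π_ker_D : ∀ x ∈ D, π x = 0 → ∃ o ≠ 0, P.φ (θ o) * x ∈ P.N I₁
  π_surj : ∀ ξ, ∃ o : MvPolynomial (Fin s) ℂ, o ≠ 0 ∧ ∃ x ∈ D, π x = algebraMap _ K o • ξ
  L : MvPolynomial (Fin n) ℂ → Module.End K N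
  L_π : ∀ f, ∀ x ∈ P.N I₀, L f (π x) = π (P.φ f * x)
  R : B → Module.End K N
  R_π : ∀ b, ∀ x ∈ P.N I₀, R b (π x) = π (x * b)
  J : G → Module.End K N
  J_π : ∀ g, ∀ x ∈ D, J g (π x) = π (P.jB g * x)
  J_π_stab : ∀ g ∈ P.stab p, ∀ x ∈ P.N I₀, J g (π x) = π (P.jB g * x)

attribute [instance] Loc.acg Loc.mod

lemma mem_of_sym_pr {p : Ideal (MvPolynomial (Fin n) ℂ)}
    (hp : ∀ f, f ∈ p ↔ P.sym (P.pr (P.stab p)) f = 0) {g : G} (hg : g ∈ P.stab p)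
    (f : MvPolynomial (Fin n) ℂ) : P.act g f ∈ p ↔ f ∈ p := by
  have : P.pr (P.stab p) * P.ρ g = P.pr (P.stab p) := LinearMap.ext fun v => by
    classical
    rw [Module.End.mul_apply, pr_apply, pr_apply]
    congr 1
    refine Fintype.sum_equiv (Equiv.mulRight (⟨g, hg⟩ : P.stab p)) _ _ fun γ => ?_
    simp
  rw [hp, hp, act, ← sym_mul, this]

theorem exists_loc {p : Ideal (MvPolynomial (Fin n) ℂ)} [hpp : p.IsPrime]
    (hp : ∀ f, f ∈ p ↔ P.sym (P.pr (P.stab p)) f = 0) {s : ℕ}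
    (θ : MvPolynomial (Fin s) ℂ →ₐ[ℂ] MvPolynomial (Fin n) ℂ) (K : Type) [Field K]
    [Algebra (MvPolynomial (Fin s) ℂ) K] [IsFractionRing (MvPolynomial (Fin s) ℂ) K]
    (hθG : ∀ g o, P.act g (θ o) = θ o)
    (hθ : ∀ f ∉ p, ∃ o ≠ 0, ∃ b, θ o - f * b ∈ p) {I₀ I₁ : TwoSidedIdeal F} (hI : I₁ ≤ I₀)
    (h : ∃ t ∉ p, ∃ k, ∀ f ∈ p ^ k, t * f ∈ P.ann I₀ I₁) : Nonempty (P.Loc p θ K I₀ I₁) := by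
  classical
  have hψ : ∀ o x, P.φ (θ o) * x = x * P.φ (θ o) := fun o x => P.φ_central (fun g => hθG g o) x
  -- an invariant denominator
  obtain ⟨t, ht, k, htk, htH⟩ : ∃ t ∉ p, ∃ k, (∀ f ∈ p ^ k, t * f ∈ P.ann I₀ I₁) ∧
      ∀ g ∈ P.stab p, P.act g t = t := by
    obtain ⟨t, ht, k, htk⟩ := h
    refine ⟨∏ h : P.stab p, P.act h t, fun hmem => ?_, k, fun f hf => ?_, fun g hg => ?_⟩
    · obtain ⟨g, -, hg⟩ := (Ideal.IsPrime.prod_mem_iff).1 hmem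
      exact ht ((P.mem_of_sym_pr hp g.2 t).1 hg)
    · obtain ⟨c, hc⟩ : t ∣ ∏ h : P.stab p, P.act h t := by
        have := Finset.dvd_prod_of_mem (fun h : P.stab p => P.act h t) (Finset.mem_univ 1)
        rwa [OneMemClass.coe_one, act_one] at this
      rw [hc, mul_assoc, mul_left_comm]
      exact Ideal.mul_mem_left _ _ (htk f hf)
    · rw [map_prod]
      refine Fintype.prod_equiv (Equiv.mulLeft (⟨g, hg⟩ : P.stab p)) _ _ fun γ => ?_
      rw [← act_mul]; rfl
  obtain ⟨o, ho, b, hb⟩ := hθ t ht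
  obtain ⟨b', hb'⟩ : ∃ b', θ (o ^ k) - t * b' ∈ p ^ k := by
    obtain ⟨c, hc⟩ := sub_dvd_pow_sub_pow (θ o) (θ o - t * b) k
    refine ⟨b * c, ?_⟩
    have h2 := Ideal.pow_mem_pow hb k
    rw [sub_sub_cancel] at hc
    rwa [map_pow, ← mul_assoc, ← hc, sub_sub_cancel]
  let _ : Module (MvPolynomial (Fin s) ℂ) B := Module.compHom B (P.φ.comp θ).toRingHom
  have hsm : ∀ (o : MvPolynomial (Fin s) ℂ) (x : B), o • x = P.φ (θ o) * x := fun _ _ => rfl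
  let NN : TwoSidedIdeal F → Submodule (MvPolynomial (Fin s) ℂ) B := fun I =>
    { carrier := {x | x ∈ P.N I}
      add_mem' := fun ha hb => (P.N I).add_mem ha hb
      zero_mem' := (P.N I).zero_mem
      smul_mem' := fun o x hx => P.mul_mem_N_left _ hx }
  let lm : ∀ x : B, (∀ o, x * P.φ (θ o) = P.φ (θ o) * x) → B →ₗ[MvPolynomial (Fin s) ℂ] B :=
    fun x hx =>
    { toFun := fun y => x * y
      map_add' := mul_add x
      map_smul' := fun o y => by
        rw [RingHom.id_apply, hsm, hsm, ← mul_assoc, hx, mul_assoc] }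
  let rm : B → B →ₗ[MvPolynomial (Fin s) ℂ] B := fun x =>
    { toFun := fun y => y * x
      map_add' := fun a b => add_mul a b x
      map_smul' := fun o y => mul_assoc _ _ _ }
  have hcomm : ∀ f o, P.φ f * P.φ (θ o) = P.φ (θ o) * P.φ f := fun f o => P.φ_comm _ _
  obtain ⟨N, iN, iM, π, h1, h2, h3, h4, h5, h6, h7, h8⟩ :=
    exists_localization_of_operator (K := K) (NN I₀) (NN I₁) (P.N_mono hI)
    (lm (P.φ t) (hcomm t)) (lm (P.φ b') (hcomm b'))
    (fun x hx => P.mul_mem_N_left _ hx) (fun x hx => P.mul_mem_N_left _ hx)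
    (fun x hx => P.mul_mem_N_left _ hx) (fun x hx => P.mul_mem_N_left _ hx)
    (fun x => show P.φ t * (P.φ b' * x) = P.φ b' * (P.φ t * x) by
      rw [← mul_assoc, P.φ_comm, mul_assoc]) (o ^ k) (pow_ne_zero _ ho) (fun x hx => by
      have := htk _ hb' x hx
      change P.φ (θ (o ^ k)) * (P.φ t * x) - P.φ t * (P.φ b' * (P.φ t * x)) ∈ P.N I₁
      convert this using 1
      rw [← mul_assoc, ← mul_assoc, ← mul_assoc, ← map_mul, ← map_mul, ← map_mul, ← sub_mul,
        ← map_sub]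
      congr 2
      ring)
  let D : Submodule (MvPolynomial (Fin n) ℂ) B :=
    { carrier := {x | ∃ y ∈ P.N I₀, ∃ z ∈ P.N I₁, P.φ t * y + z = x}
      add_mem' := by
        rintro _ _ ⟨y, hy, z, hz, rfl⟩ ⟨y', hy', z', hz', rfl⟩
        exact ⟨_, add_mem hy hy', _, add_mem hz hz', by rw [mul_add]; abel⟩
      zero_mem' := ⟨0, zero_mem _, 0, zero_mem _, by simp⟩
      smul_mem' := by
        rintro f _ ⟨y, hy, z, hz, rfl⟩
        refine ⟨P.φ f * y, P.mul_mem_N_left _ hy, P.φ f * z, P.mul_mem_N_left _ hz, ?_⟩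
        rw [P.smul_eq, mul_add, ← mul_assoc, ← mul_assoc, P.φ_comm t f] }
  have hD : ∀ x, x ∈ D ↔ x ∈ (NN I₀).map (lm (P.φ t) (hcomm t)) ⊔ NN I₁ := fun x => by
    constructor
    · rintro ⟨y, hy, z, hz, rfl⟩
      exact add_mem (Submodule.mem_sup_left ⟨y, hy, rfl⟩) (Submodule.mem_sup_right hz)
    · intro hx
      obtain ⟨_, ⟨y, hy, rfl⟩, z, hz, rfl⟩ := Submodule.mem_sup.1 hx
      exact ⟨y, hy, z, hz, rfl⟩
  have hD0 : D ≤ P.N I₀ := by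
    rintro _ ⟨y, hy, z, hz, rfl⟩
    exact add_mem (P.mul_mem_N_left _ hy) (P.N_mono hI hz)
  simp only [← hD] at h5 h6 h7
  choose L hL using fun f => h8 (lm (P.φ f) (hcomm f)) (fun x hx => P.mul_mem_N_left _ hx)
    (fun x hx => P.mul_mem_N_left _ hx) (fun x => show P.φ f * (P.φ t * x) = P.φ t * (P.φ f * x) by
      rw [← mul_assoc, P.φ_comm, mul_assoc])
  choose R hR using fun b => h8 (rm b) (fun x hx => P.mul_mem_N_right _ hx)
    (fun x hx => P.mul_mem_N_right _ hx) (fun x => mul_assoc _ _ _)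
  have hJex : ∀ g, ∃ J : Module.End K N, (∀ x ∈ D, J (π x) = π (P.jB g * x)) ∧
      (g ∈ P.stab p → ∀ x ∈ P.N I₀, J (π x) = π (P.jB g * x)) := fun g => by
    by_cases hg : g ∈ P.stab p
    · obtain ⟨J, hJ⟩ := h8 (lm (P.jB g) (fun o => (hψ o _).symm))
        (fun x hx => P.mul_mem_N_left _ hx) (fun x hx => P.mul_mem_N_left _ hx)
        (fun x => show P.jB g * (P.φ t * x) = P.φ t * (P.jB g * x) by
          rw [← mul_assoc, P.jB_φ, htH g hg, mul_assoc])
      exact ⟨J, fun x hx => hJ x (hD0 hx), fun _ => hJ⟩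
    · obtain ⟨J, hJ⟩ := h7 (fun x => π (P.jB g * x))
        (fun x hx y hy => by
          rw [mul_add]; exact h1 _ (P.mul_mem_N_left _ (hD0 hx)) _ (P.mul_mem_N_left _ (hD0 hy)))
        (fun o x hx => by
          rw [← h2 _ _ (show P.jB g * x ∈ NN I₀ from P.mul_mem_N_left _ (hD0 hx)), hsm, hsm,
            ← mul_assoc, ← hψ, mul_assoc])
        (fun x hx => h3 _ (P.mul_mem_N_left _ hx))
      exact ⟨J, hJ, fun h => absurd h hg⟩
  choose J hJ hJ' using hJex
  exact ⟨{
    N := N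
    π := π
    D := D
    t := t
    t_notMem := ht
    D_le := hD0
    t_mem := fun y hy => ⟨y, hy, 0, zero_mem _, add_zero _⟩
    D_right := by
      rintro _ ⟨y, hy, z, hz, rfl⟩ b
      exact ⟨_, P.mul_mem_N_right b hy, _, P.mul_mem_N_right b hz, by rw [add_mul, mul_assoc]⟩
    D_stab := by
      rintro g hg _ ⟨y, hy, z, hz, rfl⟩
      refine ⟨_, P.mul_mem_N_left (P.jB g) hy, _, P.mul_mem_N_left (P.jB g) hz, ?_⟩
      rw [mul_add, ← mul_assoc, ← mul_assoc, P.jB_φ, htH g hg]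
    k := k
    pow_mem := by
      rintro f hf _ ⟨y, hy, z, hz, rfl⟩
      rw [mul_add, ← mul_assoc, ← map_mul, mul_comm f]
      exact add_mem (htk f hf y hy) (P.mul_mem_N_left _ hz)
    π_add := h1
    π_smul := h2
    π_zero := h3
    π_ker := fun x hx hx0 => by
      obtain ⟨o, ho, hox⟩ := h4 x hx hx0
      exact ⟨o, ho, by rw [map_mul, mul_assoc]; exact hox⟩
    π_ker_D := h5
    π_surj := h6
    L := L
    L_π := hL
    R := R
    R_π := hR
    J := J
    J_π := hJ
    J_π_stab := hJ' }⟩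

end HPres
end LocalizedBimodule

section LocalizedBimoduleOperators
open MvPolynomial
lemma algebraMap_ne_zero_of_ne_zero {O K : Type*} [CommRing O] [IsDomain O] [Field K] [Algebra O K]
    [IsFractionRing O K] {o : O} (ho : o ≠ 0) : algebraMap O K o ≠ 0 := fun h =>
  ho (IsFractionRing.injective O K (by rw [h, map_zero]))

namespace HPres
namespace Loc
variable {n : ℕ} {V G F B : Type} [AddCommGroup V] [Module ℂ V] [Group G] [Fintype G]
  [Ring F] [Algebra ℂ F] [Ring B] [Algebra ℂ B] [Module (MvPolynomial (Fin n) ℂ) B]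
  {P : HPres n V G F B} {p : Ideal (MvPolynomial (Fin n) ℂ)} {s : ℕ}
  {θ : MvPolynomial (Fin s) ℂ →ₐ[ℂ] MvPolynomial (Fin n) ℂ} {K : Type} [Field K]
  [Algebra (MvPolynomial (Fin s) ℂ) K] [IsFractionRing (MvPolynomial (Fin s) ℂ) K]
  {I₀ I₁ : TwoSidedIdeal F} (M : P.Loc p θ K I₀ I₁)

variable {M} in
lemma ext_D {A A' : Module.End K M.N} (h : ∀ x ∈ M.D, A (M.π x) = A' (M.π x)) : A = A' := by
  refine LinearMap.ext fun ξ => ?_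
  obtain ⟨o, ho, x, hx, hox⟩ := M.π_surj ξ
  have := h x hx
  rw [hox, map_smul, map_smul] at this
  exact smul_right_injective _ (algebraMap_ne_zero_of_ne_zero (K := K) ho) this

omit [IsFractionRing (MvPolynomial (Fin s) ℂ) K] in
lemma φ_mem {x : B} (hx : x ∈ M.D) (f) : P.φ f * x ∈ M.D := by
  rw [← P.smul_eq]; exact M.D.smul_mem f hx

/-- The action of the polynomial ring on the localised bimodule. -/
noncomputable def Lh : MvPolynomial (Fin n) ℂ →+* Module.End K M.N where
  toFun := M.L
  map_one' := ext_D fun x hx => by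
    rw [M.L_π _ _ (M.D_le hx), map_one, one_mul]; rfl
  map_mul' f g := ext_D fun x hx => by
    rw [M.L_π _ _ (M.D_le hx), Module.End.mul_apply, M.L_π _ _ (M.D_le hx), map_mul, mul_assoc,
      M.L_π _ _ (P.mul_mem_N_left _ (M.D_le hx))]
  map_zero' := ext_D fun x hx => by
    rw [M.L_π _ _ (M.D_le hx), map_zero, zero_mul, M.π_zero 0 (Submodule.zero_mem _)]; rfl
  map_add' f g := ext_D fun x hx => by
    have := M.D_le hx
    rw [M.L_π _ _ this, LinearMap.add_apply, M.L_π _ _ this, M.L_π _ _ this, map_add, add_mul,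
      M.π_add _ (P.mul_mem_N_left _ this) _ (P.mul_mem_N_left _ this)]

lemma Lh_π (f) {x : B} (hx : x ∈ P.N I₀) : M.Lh f (M.π x) = M.π (P.φ f * x) := M.L_π f x hx

lemma Lh_θ (o : MvPolynomial (Fin s) ℂ) : M.Lh (θ o) = algebraMap _ K o • 1 := ext_D fun x hx => by
  rw [M.Lh_π _ (M.D_le hx), M.π_smul _ _ (M.D_le hx)]; rfl

lemma Lh_C [Algebra ℂ K] [IsScalarTower ℂ (MvPolynomial (Fin s) ℂ) K] (c : ℂ) :
    M.Lh (C c) = algebraMap ℂ K c • 1 := by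
  rw [IsScalarTower.algebraMap_apply ℂ (MvPolynomial (Fin s) ℂ) K, ← Lh_θ, AlgHom.commutes]; rfl

lemma Lh_comm (f g) : M.Lh f * M.Lh g = M.Lh g * M.Lh f := by
  rw [← map_mul, mul_comm, map_mul]

lemma Lh_eq_zero {f} (hf : f ∈ p ^ M.k) : M.Lh f = 0 := ext_D fun x hx => by
  rw [M.Lh_π _ (M.D_le hx), M.π_zero _ (M.pow_mem f hf x hx)]; rfl

lemma isUnit_Lh (hθ : ∀ f ∉ p, ∃ o ≠ 0, ∃ b, θ o - f * b ∈ p) {f} (hf : f ∉ p) :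
    IsUnit (M.Lh f) := by
  obtain ⟨o, ho, b, hb⟩ := hθ f hf
  have hK := algebraMap_ne_zero_of_ne_zero (K := K) ho
  have hnil : IsNilpotent (M.Lh (θ o - f * b)) :=
    ⟨M.k, by rw [← map_pow]; exact M.Lh_eq_zero (Ideal.pow_mem_pow hb _)⟩
  have hu : IsUnit (M.Lh (θ o)) := by
    rw [Lh_θ, ← Algebra.algebraMap_eq_smul_one]
    exact (IsUnit.mk0 _ hK).map _
  have h2 : M.Lh (f * b) = M.Lh (θ o) - M.Lh (θ o - f * b) := by rw [map_sub, sub_sub_cancel]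
  have h3 : IsUnit (M.Lh (f * b)) := by
    rw [h2, sub_eq_add_neg]
    exact hnil.neg.isUnit_add_left_of_commute hu (Commute.neg_left (M.Lh_comm _ _))
  rw [map_mul] at h3
  exact (Commute.isUnit_mul_iff (M.Lh_comm _ _)).1 h3 |>.1

lemma J_mul {g h : G} (hh : h ∈ P.stab p) : M.J (g * h) = M.J g * M.J h :=
  ext_D fun x hx => by
    rw [Module.End.mul_apply, M.J_π h x hx, M.J_π g _ (M.D_stab h hh x hx), M.J_π _ x hx, P.jB_mul,
      mul_assoc]

lemma J_one : M.J 1 = 1 := ext_D fun x hx => by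
  rw [M.J_π _ x hx, P.jB_one, one_mul]; rfl

lemma J_pow {g : G} (hg : g ∈ P.stab p) (m : ℕ) : M.J g ^ m = M.J (g ^ m) := by
  induction m with
  | zero => rw [pow_zero, pow_zero, J_one]
  | succ m ih => rw [pow_succ, pow_succ, ih, ← J_mul M hg]

lemma J_Lh (g : G) (f) : M.J g * M.Lh f = M.Lh (P.act g f) * M.J g := ext_D fun x hx => by
  rw [Module.End.mul_apply, Module.End.mul_apply, M.J_π _ x hx, M.Lh_π _ (M.D_le hx),
    M.J_π _ _ (M.φ_mem hx f), M.Lh_π _ (P.mul_mem_N_left _ (M.D_le hx)), ← mul_assoc, P.jB_φ,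
    mul_assoc]

lemma R_Lh (b : B) (f) : M.R b * M.Lh f = M.Lh f * M.R b := ext_D fun x hx => by
  rw [Module.End.mul_apply, Module.End.mul_apply, M.R_π _ _ (M.D_le hx), M.Lh_π _ (M.D_le hx),
    M.R_π _ _ (P.mul_mem_N_left _ (M.D_le hx)), M.Lh_π _ (P.mul_mem_N_right _ (M.D_le hx)),
    mul_assoc]

lemma R_θ (hθG : ∀ g o, P.act g (θ o) = θ o) (o) :
    M.R (P.φ (θ o)) = algebraMap _ K o • 1 := ext_D fun x hx => by
  rw [M.R_π _ _ (M.D_le hx), ← P.φ_central (fun g => hθG g o), M.π_smul _ _ (M.D_le hx)]; rfl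

lemma trace_J_eq_zero (hθ : ∀ f ∉ p, ∃ o ≠ 0, ∃ b, θ o - f * b ∈ p) {γ : G} (hγ : γ ∉ P.stab p) :
    LinearMap.trace K M.N (M.J γ) = 0 := by
  rw [P.mem_stab] at hγ
  push Not at hγ
  obtain ⟨v, hv⟩ := hγ
  obtain ⟨c, hc⟩ := M.isUnit_Lh hθ hv
  have hcA : (↑c⁻¹ : Module.End K M.N) * M.Lh (P.l v) = M.Lh (P.l v) * ↑c⁻¹ := by
    have : Commute (c : Module.End K M.N) (M.Lh (P.l v)) := by rw [hc]; exact M.Lh_comm _ _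
    exact this.units_inv_left
  have h1 : (c : Module.End K M.N) * M.J γ = M.J γ * M.Lh (P.l v) - M.Lh (P.l v) * M.J γ := by
    rw [hc, J_Lh, P.act_l, map_sub, sub_mul]
  have h2 : M.J γ = (↑c⁻¹ * M.J γ) * M.Lh (P.l v) - M.Lh (P.l v) * (↑c⁻¹ * M.J γ) := by
    rw [← mul_assoc (M.Lh _), ← hcA, mul_assoc, mul_assoc, ← mul_sub, ← h1, ← mul_assoc,
      Units.inv_mul, one_mul]
  rw [h2, map_sub, LinearMap.trace_mul_comm, sub_self]

/-- The filtration of the localised bimodule by the powers of the prime. -/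
noncomputable def W (i : ℕ) : Submodule K M.N :=
  ⨆ f : ↥(p ^ i), LinearMap.range (M.Lh (f : MvPolynomial (Fin n) ℂ))

lemma Lh_mem_W {i : ℕ} {f} (hf : f ∈ p ^ i) (ξ) : M.Lh f ξ ∈ M.W i :=
  Submodule.mem_iSup_of_mem (⟨f, hf⟩ : ↥(p ^ i)) ⟨ξ, rfl⟩

lemma W_le {i : ℕ} {W' : Submodule K M.N} (h : ∀ f ∈ p ^ i, ∀ ξ, M.Lh f ξ ∈ W') : M.W i ≤ W' :=
  iSup_le fun f => by rintro _ ⟨ξ, rfl⟩; exact h f f.2 ξ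

lemma W_anti : Antitone M.W := fun _ _ hij =>
  M.W_le fun _ hf ξ => M.Lh_mem_W (Ideal.pow_le_pow_right hij hf) ξ

lemma W_zero : M.W 0 = ⊤ := eq_top_iff.2 fun ξ _ => by
  have := M.Lh_mem_W (i := 0) (f := 1) (by simp) ξ
  rwa [map_one] at this

lemma W_k : M.W M.k = ⊥ := eq_bot_iff.2 <| M.W_le fun f hf ξ => by rw [Lh_eq_zero M hf]; simp

lemma Lh_W {f} (hf : f ∈ p) {i : ℕ} {ξ} (hξ : ξ ∈ M.W i) : M.Lh f ξ ∈ M.W (i + 1) := by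
  have : M.W i ≤ (M.W (i + 1)).comap (M.Lh f) := M.W_le fun g hg ξ => by
    rw [Submodule.mem_comap, ← Module.End.mul_apply, ← map_mul, mul_comm]
    exact M.Lh_mem_W (by rw [pow_succ]; exact Ideal.mul_mem_mul hg hf) ξ
  exact this hξ

lemma R_W (b : B) {i : ℕ} {ξ} (hξ : ξ ∈ M.W i) : M.R b ξ ∈ M.W i := by
  have : M.W i ≤ (M.W i).comap (M.R b) := M.W_le fun g hg ξ => by
    rw [Submodule.mem_comap, ← Module.End.mul_apply, R_Lh]
    exact M.Lh_mem_W hg _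
  exact this hξ

lemma J_W (hp : ∀ f, f ∈ p ↔ P.sym (P.pr (P.stab p)) f = 0) {g : G} (hg : g ∈ P.stab p)
    {i : ℕ} {ξ} (hξ : ξ ∈ M.W i) : M.J g ξ ∈ M.W i := by
  have : M.W i ≤ (M.W i).comap (M.J g) := M.W_le fun f hf ξ => by
    rw [Submodule.mem_comap, ← Module.End.mul_apply, J_Lh]
    refine M.Lh_mem_W ?_ _
    have hle : p ^ i ≤ (p ^ i).comap (P.act g) := by
      refine le_trans ?_ (Ideal.le_comap_pow _ _)
      exact Ideal.pow_right_mono (fun f hf => (P.mem_of_sym_pr hp hg f).2 hf) i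
    exact hle hf
  exact this hξ

end Loc
end HPres
end LocalizedBimoduleOperators

section LocalizedBimoduleFinite
open MvPolynomial
namespace HPres
namespace Loc
variable {n : ℕ} {V G F B : Type} [AddCommGroup V] [Module ℂ V] [Group G] [Fintype G]
  [Ring F] [Algebra ℂ F] [Ring B] [Algebra ℂ B] [Module (MvPolynomial (Fin n) ℂ) B]
  {P : HPres n V G F B} {p : Ideal (MvPolynomial (Fin n) ℂ)} {s : ℕ}
  {θ : MvPolynomial (Fin s) ℂ →ₐ[ℂ] MvPolynomial (Fin n) ℂ} {K : Type} [Field K]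
  [Algebra (MvPolynomial (Fin s) ℂ) K] [IsFractionRing (MvPolynomial (Fin s) ℂ) K]
  {I₀ I₁ : TwoSidedIdeal F} (M : P.Loc p θ K I₀ I₁)

section Finite
variable {q : ℕ} {a : Fin q → MvPolynomial (Fin n) ℂ}
  (ha : ∀ f, ∃ o : Fin q → MvPolynomial (Fin s) ℂ, f - ∑ j, θ (o j) * a j ∈ p)
  {r : ℕ} {y : Fin r → B} (hy : Submodule.span (MvPolynomial (Fin n) ℂ) (Set.range y) = P.N I₀)

include ha hy in
lemma exists_span_sup_W_one : Submodule.span K (Set.range fun ij : Fin q × Fin r =>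
    M.π (P.φ (a ij.1) * y ij.2)) ⊔ M.W 1 = ⊤ := by
  set E := Submodule.span K (Set.range fun ij : Fin q × Fin r => M.π (P.φ (a ij.1) * y ij.2))
  have hyN : ∀ i, y i ∈ P.N I₀ := fun i => by rw [← hy]; exact Submodule.subset_span ⟨i, rfl⟩
  have key : ∀ x ∈ P.N I₀, ∀ f, M.π (P.φ f * x) ∈ E ⊔ M.W 1 := by
    intro x hx
    rw [← hy] at hx
    induction hx using Submodule.span_induction with
    | mem x hx =>
      obtain ⟨i, rfl⟩ := hx
      intro f
      obtain ⟨o, ho⟩ := ha f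
      rw [← M.Lh_π f (hyN i), ← sub_add_cancel f (∑ j, θ (o j) * a j), map_add,
        LinearMap.add_apply, map_sum, LinearMap.sum_apply]
      refine add_mem (Submodule.mem_sup_right (M.Lh_mem_W (by rwa [pow_one]) _))
        (Submodule.mem_sup_left (sum_mem fun j _ => ?_))
      rw [map_mul, Lh_θ, Module.End.mul_apply, LinearMap.smul_apply, Module.End.one_apply,
        M.Lh_π _ (hyN i)]
      exact Submodule.smul_mem _ _ (Submodule.subset_span ⟨(j, i), rfl⟩)
    | zero => intro f; rw [mul_zero, M.π_zero 0 (Submodule.zero_mem _)]; exact Submodule.zero_mem _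
    | add x x' hx hx' h h' =>
      intro f
      rw [hy] at hx hx'
      rw [mul_add, M.π_add _ (P.mul_mem_N_left _ hx) _ (P.mul_mem_N_left _ hx')]
      exact add_mem (h f) (h' f)
    | smul g x _ h =>
      intro f
      rw [P.smul_eq, ← mul_assoc, ← map_mul]
      exact h _
  refine eq_top_iff.2 fun ξ _ => ?_
  obtain ⟨o, ho, x, hx, hox⟩ := M.π_surj ξ
  have h1 := key x (M.D_le hx) 1
  rw [map_one, one_mul, hox] at h1
  exact (Submodule.smul_mem_iff _ (algebraMap_ne_zero_of_ne_zero (K := K) ho)).1 h1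

include ha hy in
lemma codim_W_one_le : codim (M.W 1) ≤ q * r := by
  have h := M.exists_span_sup_W_one ha hy
  set E := Submodule.span K (Set.range fun ij : Fin q × Fin r => M.π (P.φ (a ij.1) * y ij.2))
  have hE : Module.finrank K E ≤ q * r := by
    have := finrank_range_le_card (R := K) fun ij : Fin q × Fin r => M.π (P.φ (a ij.1) * y ij.2)
    rwa [Fintype.card_prod, Fintype.card_fin, Fintype.card_fin] at this
  have : Module.Finite K E := Module.Finite.span_of_finite K (Set.finite_range _)
  refine le_trans ?_ hE
  refine LinearMap.finrank_le_finrank_of_surjective (f := (M.W 1).mkQ ∘ₗ E.subtype) fun z => ?_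
  obtain ⟨ξ, rfl⟩ := (M.W 1).mkQ_surjective z
  obtain ⟨e, he, w, hw, rfl⟩ := Submodule.mem_sup.1 (h.ge (Submodule.mem_top (x := ξ)))
  refine ⟨⟨e, he⟩, ?_⟩
  rw [LinearMap.comp_apply, map_add, Submodule.mkQ_apply, Submodule.mkQ_apply, Submodule.mkQ_apply,
    (Submodule.Quotient.mk_eq_zero _).2 hw, add_zero]
  rfl

include ha hy in
lemma finiteDimensional : FiniteDimensional K M.N := by
  have h := M.exists_span_sup_W_one ha hy
  set E := Submodule.span K (Set.range fun ij : Fin q × Fin r => M.π (P.φ (a ij.1) * y ij.2))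
  have hEfg : E.FG := Submodule.fg_span (Set.finite_range _)
  have key : ∀ m, ∃ E' : Submodule K M.N, E'.FG ∧ E' ⊔ M.W m = ⊤ := by
    intro m
    induction m with
    | zero => exact ⟨⊥, Submodule.fg_bot, by rw [W_zero, sup_top_eq]⟩
    | succ m ih =>
      obtain ⟨E', hE', hsup⟩ := ih
      obtain ⟨T, hT⟩ := (isNoetherian_def.1 (inferInstance :
        IsNoetherian (MvPolynomial (Fin n) ℂ) (MvPolynomial (Fin n) ℂ)) (p ^ m))
      refine ⟨E' ⊔ ⨆ g ∈ T, E.map (M.Lh g),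
        hE'.sup (Submodule.fg_biSup T _ fun g _ => hEfg.map _), ?_⟩
      rw [eq_top_iff, ← hsup, sup_assoc]
      refine sup_le_sup_left (M.W_le fun f hf => ?_) _
      rw [← hT] at hf
      induction hf using Submodule.span_induction with
      | mem g hg =>
        intro ξ
        obtain ⟨e, he, w, hw, rfl⟩ := Submodule.mem_sup.1 (h.ge (Submodule.mem_top (x := ξ)))
        rw [map_add]
        refine add_mem (Submodule.mem_sup_left (Submodule.mem_iSup_of_mem g
          (Submodule.mem_iSup_of_mem hg ⟨e, he, rfl⟩))) (Submodule.mem_sup_right ?_)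
        have : M.W 1 ≤ (M.W (m + 1)).comap (M.Lh g) := M.W_le fun f hf ξ => by
          rw [Submodule.mem_comap, ← Module.End.mul_apply, ← map_mul]
          refine M.Lh_mem_W ?_ _
          rw [pow_succ]
          refine Ideal.mul_mem_mul ?_ (by rwa [pow_one] at hf)
          rw [← hT]
          exact Submodule.subset_span hg
        exact this hw
      | zero => intro ξ; rw [map_zero]; exact Submodule.zero_mem _
      | add f f' _ _ hf hf' => intro ξ; rw [map_add]; exact add_mem (hf ξ) (hf' ξ)
      | smul c f _ hf =>
        intro ξ
        rw [smul_eq_mul, mul_comm, map_mul]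
        exact hf _
  obtain ⟨E', hE', hsup⟩ := key M.k
  rw [W_k, sup_bot_eq] at hsup
  exact ⟨hsup ▸ hE'⟩
end Finite

/-- A chain of submodules whose steps survive localisation gives a lower bound for the
dimension. -/
lemma le_finrank [FiniteDimensional K M.N] (hθp : ∀ o, θ o ∈ p → o = 0) (hpp : p.IsPrime)
    (I : ℕ → TwoSidedIdeal F) (hI : Antitone I) (m : ℕ) (h0 : I 0 = I₀) (h1 : I m = I₁)
    (hann : ∀ i, P.ann (I i) (I (i + 1)) ≤ p) : m ≤ Module.finrank K M.N := by
  have hN : ∀ i, P.N (I i) ≤ P.N I₀ := fun i => P.N_mono (h0 ▸ hI (Nat.zero_le i))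
  let E : ℕ → Submodule K M.N := fun i =>
    { carrier := {ξ | ∃ o : MvPolynomial (Fin s) ℂ, o ≠ 0 ∧ ∃ x ∈ P.N (I i),
        algebraMap _ K o • ξ = M.π x}
      add_mem' := by
        rintro ξ η ⟨o, ho, x, hx, hxo⟩ ⟨o', ho', x', hx', hxo'⟩
        refine ⟨o * o', mul_ne_zero ho ho', P.φ (θ o') * x + P.φ (θ o) * x',
          add_mem (P.mul_mem_N_left _ hx) (P.mul_mem_N_left _ hx'), ?_⟩
        rw [M.π_add _ (hN i (P.mul_mem_N_left _ hx)) _ (hN i (P.mul_mem_N_left _ hx')),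
          M.π_smul _ _ (hN i hx), M.π_smul _ _ (hN i hx'), ← hxo, ← hxo', smul_smul, smul_smul,
          smul_add, map_mul, mul_comm]
      zero_mem' := ⟨1, one_ne_zero, 0, Submodule.zero_mem _, by
        rw [smul_zero, M.π_zero 0 (Submodule.zero_mem _)]⟩
      smul_mem' := by
        rintro c ξ ⟨o, ho, x, hx, hxo⟩
        obtain ⟨u, v, hv, rfl⟩ := IsFractionRing.div_surjective (A := MvPolynomial (Fin s) ℂ) c
        have hv0 := nonZeroDivisors.ne_zero hv
        refine ⟨v * o, mul_ne_zero hv0 ho, P.φ (θ u) * x, P.mul_mem_N_left _ hx, ?_⟩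
        rw [M.π_smul _ _ (hN i hx), ← hxo, smul_smul, smul_smul, map_mul]
        congr 1
        have := algebraMap_ne_zero_of_ne_zero (K := K) hv0
        field_simp }
  have hlt : ∀ i, i + 1 ≤ m → E (i + 1) < E i := fun i hi => by
    refine lt_of_le_not_ge ?_ fun hle => ?_
    · rintro ξ ⟨o, ho, x, hx, hxo⟩
      exact ⟨o, ho, x, P.N_mono (hI (Nat.le_succ i)) hx, hxo⟩
    · have hx : ∀ x ∈ P.N (I i), ∃ o : MvPolynomial (Fin s) ℂ, o ≠ 0 ∧
          P.φ (θ o * M.t) * x ∈ P.N (I (i + 1)) := fun x hx => by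
        obtain ⟨o, ho, x', hx', h⟩ := hle ⟨1, one_ne_zero, x, hx, by rw [map_one, one_smul]⟩
        have hz : P.φ (θ o) * x - x' ∈ P.N I₀ :=
          sub_mem (P.mul_mem_N_left _ (hN i hx)) (hN (i + 1) hx')
        have h0 : M.π (P.φ (θ o) * x - x') = 0 := by
          have := M.π_add _ hz _ (hN (i + 1) hx')
          rw [sub_add_cancel, M.π_smul _ _ (hN i hx), h] at this
          exact right_eq_add.1 this
        obtain ⟨o', ho', h'⟩ := M.π_ker _ hz h0
        refine ⟨o' * o, mul_ne_zero ho' ho, ?_⟩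
        have h2 := add_mem (P.N_mono (h1 ▸ hI hi : I₁ ≤ I (i + 1)) h')
          (P.mul_mem_N_left (P.φ (θ o' * M.t)) hx')
        rw [mul_sub, sub_add_cancel, ← mul_assoc, ← map_mul] at h2
        convert h2 using 3
        rw [map_mul]; ring
      have := P.isNoetherian
      obtain ⟨T, hT⟩ := (isNoetherian_def.1 this (P.N (I i)))
      choose! o ho hox using hx
      have hTN : ∀ x ∈ T, x ∈ P.N (I i) := fun x hx => hT ▸ Submodule.subset_span hx
      have hmem : θ (∏ x ∈ T, o x) * M.t ∈ P.ann (I i) (I (i + 1)) := by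
        rw [mem_ann]
        intro x hx
        rw [← hT] at hx
        induction hx using Submodule.span_induction with
        | mem x hx =>
          obtain ⟨c, hc⟩ := Finset.dvd_prod_of_mem o hx
          have h3 : θ (o x * c) * M.t = θ c * (θ (o x) * M.t) := by rw [map_mul]; ring
          rw [hc, h3, map_mul, mul_assoc]
          exact P.mul_mem_N_left _ (hox x (hTN x hx))
        | zero => rw [mul_zero]; exact Submodule.zero_mem _
        | add x x' _ _ h h' => rw [mul_add]; exact add_mem h h'
        | smul f x _ h =>
          rw [P.smul_eq, ← mul_assoc, P.φ_comm, mul_assoc]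
          exact P.mul_mem_N_left _ h
      rcases hpp.mem_or_mem (hann i hmem) with h | h
      · exact Finset.prod_ne_zero_iff.2 (fun x hx => ho x (hTN x hx)) (hθp _ h)
      · exact M.t_notMem h
  have hdim : ∀ i, i ≤ m → i ≤ Module.finrank K (E (m - i)) := fun i => by
    induction i with
    | zero => simp
    | succ i ih =>
      intro hi
      have h2 := Submodule.finrank_lt_finrank_of_lt (hlt (m - (i + 1)) (by omega))
      rw [show m - (i + 1) + 1 = m - i by omega] at h2
      have := ih (by omega)
      omega
  exact (hdim m le_rfl).trans (Submodule.finrank_le _)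

end Loc
end HPres
end LocalizedBimoduleFinite

section TraceRelation
open MvPolynomial
namespace HPres
namespace Loc
variable {n : ℕ} {V G F B : Type} [AddCommGroup V] [Module ℂ V] [Group G] [Fintype G]
  [Ring F] [Algebra ℂ F] [Ring B] [Algebra ℂ B] [Module (MvPolynomial (Fin n) ℂ) B]
  {P : HPres n V G F B} {p : Ideal (MvPolynomial (Fin n) ℂ)} {s : ℕ}
  {θ : MvPolynomial (Fin s) ℂ →ₐ[ℂ] MvPolynomial (Fin n) ℂ} {K : Type} [Field K]
  [Algebra (MvPolynomial (Fin s) ℂ) K] [IsFractionRing (MvPolynomial (Fin s) ℂ) K]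
  [Algebra ℂ K] [IsScalarTower ℂ (MvPolynomial (Fin s) ℂ) K]
  {I₀ I₁ : TwoSidedIdeal F} (M : P.Loc p θ K I₀ I₁)

omit [IsFractionRing (MvPolynomial (Fin s) ℂ) K] in
lemma π_algebraMap (c : ℂ) {x : B} (hx : x ∈ P.N I₀) :
    M.π (algebraMap ℂ B c * x) = algebraMap ℂ K c • M.π x := by
  rw [IsScalarTower.algebraMap_apply ℂ (MvPolynomial (Fin s) ℂ) K, ← M.π_smul _ _ hx,
    AlgHom.commutes, AlgHom.commutes]

omit [IsFractionRing (MvPolynomial (Fin s) ℂ) K] [Algebra ℂ K]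
  [IsScalarTower ℂ (MvPolynomial (Fin s) ℂ) K] in
lemma π_sum {α : Type*} (T : Finset α) (x : α → B) (hx : ∀ i ∈ T, x i ∈ P.N I₀) :
    M.π (∑ i ∈ T, x i) = ∑ i ∈ T, M.π (x i) := by
  classical
  induction T using Finset.induction_on with
  | empty => rw [Finset.sum_empty, Finset.sum_empty, M.π_zero 0 (Submodule.zero_mem _)]
  | insert i T hi ih =>
    rw [Finset.sum_insert hi, Finset.sum_insert hi, M.π_add _ (hx i (Finset.mem_insert_self i T)) _
      (sum_mem fun j hj => hx j (Finset.mem_insert_of_mem hj)),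
      ih fun j hj => hx j (Finset.mem_insert_of_mem hj)]

theorem trace_relation [FiniteDimensional K M.N] (hI : I₁ ≤ I₀) (h₀ : P.Sat I₀)
    (h₁ : P.Sat I₁)
    (hp : ∀ f, f ∈ p ↔ P.sym (P.pr (P.stab p)) f = 0) (hθG : ∀ g o, P.act g (θ o) = θ o)
    {g : G} (hg : g ∈ P.stab p) {u v : V} (hu : P.pr (P.stab p) u = 0)
    (hv : P.pr (P.stab p) v = 0) (hgu : P.ρ g u = u) :
    algebraMap ℂ K (P.ω u v) * LinearMap.trace K M.N (M.J g) +
      ∑ r, algebraMap ℂ K (P.κ r u v) * LinearMap.trace K M.N (M.J (r * g)) = 0 := by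
  classical
  have hl : ∀ w, P.pr (P.stab p) w = 0 → P.l w ∈ p := fun w hw => by
    rw [hp, P.sym_l, hw, map_zero]
  have hcl : ∀ w : V, P.cls (P.ι w) = P.φ (P.l w) := fun w => (P.φ_lin w).symm
  have hN : ∀ a ∈ I₀, P.cls a ∈ P.N I₀ := fun a ha => P.cls_mem_N ha
  have hlft : ∀ o : MvPolynomial (Fin s) ℂ, ∃ a, P.cls a = P.φ (θ o) ∧ (o = 0 → a = 0) := fun o => by
    by_cases ho : o = 0
    · exact ⟨0, by rw [ho]; simp, fun _ => rfl⟩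
    · obtain ⟨a, ha⟩ := P.cls_surj (P.φ (θ o))
      exact ⟨a, ha, fun h => absurd h ho⟩
  choose lft hlft hlft0 using hlft
  have hħ0 : P.cls (P.T * P.T) = 0 := (P.cls_eq_zero _).2 ⟨1, (mul_one _).symm⟩
  let Df : AddSubgroup F :=
    { carrier := {a | a ∈ I₀ ∧ P.cls a ∈ M.D}
      add_mem' := fun {a b} ha hb => ⟨I₀.add_mem ha.1 hb.1, by
        rw [map_add]; exact M.D.add_mem ha.2 hb.2⟩
      zero_mem' := ⟨I₀.zero_mem, by rw [map_zero]; exact M.D.zero_mem⟩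
      neg_mem' := fun {a} ha => ⟨I₀.neg_mem ha.1, by rw [map_neg]; exact M.D.neg_mem ha.2⟩ }
  have hcomm : P.ι u * (P.ι v * P.j g) - (P.ι v * P.j g) * P.ι u =
      P.T * P.T * ((algebraMap ℂ F (P.ω u v) + ∑ r, P.κ r u v • P.j r) * P.j g) := by
    rw [← mul_assoc (P.T * P.T), ← P.comm, mul_assoc _ (P.j g), P.j_ι, hgu]
    noncomm_ring
  have hx : P.cls ((algebraMap ℂ F (P.ω u v) + ∑ r, P.κ r u v • P.j r) * P.j g) =
      algebraMap ℂ B (P.ω u v) * P.jB g + ∑ r, algebraMap ℂ B (P.κ r u v) * P.jB (r * g) := by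
    rw [map_mul, map_add, AlgHom.commutes, map_sum, add_mul, Finset.sum_mul]
    congr 1
    refine Finset.sum_congr rfl fun r _ => ?_
    rw [map_smul, P.jB_mul, Algebra.smul_def, mul_assoc]; rfl
  have key := trace_eq_zero_of_commutator (K := K) (N := M.N) (P.T * P.T) P.ħ_central I₀ I₁ h₁
    P.cls.toRingHom (fun a ha => (P.cls_eq_zero a).1 ha)
    (P.φ.comp θ).toRingHom (fun o b => P.φ_central (fun g => hθG g o) b) lft hlft (hlft0 0 rfl)
    (fun a => M.π (P.cls a))
    (fun a ha b hb => by rw [map_add]; exact M.π_add _ (hN a ha) _ (hN b hb))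
    (fun a _ => by
      rw [map_mul, hħ0, zero_mul]; exact M.π_zero 0 (Submodule.zero_mem _))
    (fun a ha => M.π_zero _ (P.cls_mem_N ha))
    (fun b => M.R (P.cls b)) (fun a ha b => by rw [map_mul, M.R_π _ _ (hN a ha)])
    (fun o ξ => by rw [hlft, M.R_θ hθG]; rfl)
    Df (fun a ha => ha.1)
    (fun a ha b => ⟨I₀.mul_mem_right _ _ ha.1, by rw [map_mul]; exact M.D_right _ ha.2 _⟩)
    (fun a ha h => by
      obtain ⟨o, ho, i, hi, hio⟩ := M.π_ker_D _ ha.2 h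
      obtain ⟨c, hc⟩ := (P.cls_eq_zero (a * lft o - i)).1 (by
        rw [map_sub, map_mul, hlft, hio, ← P.φ_central (fun g => hθG g o), sub_self])
      refine ⟨o, ho, c, ?_, ?_⟩
      · exact h₀ _ (hc ▸ I₀.sub_mem (I₀.mul_mem_right _ _ ha.1) (hI hi))
      · rw [← hc, sub_sub_cancel]; exact hi)
    (fun ξ => by
      obtain ⟨o, ho, x, hx, hox⟩ := M.π_surj ξ
      obtain ⟨a, ha, rfl⟩ := M.D_le hx
      exact ⟨o, ho, a, ⟨ha, hx⟩, hox⟩)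
    (P.ι u) (P.ι v * P.j g) _ hcomm (M.Lh (P.l u)) (M.Lh (P.l v) * M.J g)
    (algebraMap ℂ K (P.ω u v) • M.J g + ∑ r, algebraMap ℂ K (P.κ r u v) • M.J (r * g))
    (fun a ha => by rw [map_mul, hcl, M.Lh_π _ (hN a ha)])
    (fun a ha => by
      rw [map_mul, map_mul, hcl, Module.End.mul_apply, M.J_π_stab g hg _ (hN a ha),
        M.Lh_π _ (P.mul_mem_N_left _ (hN a ha)), mul_assoc]; rfl)
    (fun a ha => by
      have h1 := hN a ha.1
      rw [map_mul, hx, add_mul, mul_assoc, M.π_add _ (P.mul_mem_N_left _ (P.mul_mem_N_left _ h1)) _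
        (P.mul_mem_N_left _ h1), M.π_algebraMap _ (P.mul_mem_N_left _ h1), Finset.sum_mul,
        M.π_sum _ _ (fun i _ => P.mul_mem_N_left _ h1), LinearMap.add_apply, LinearMap.smul_apply,
        M.J_π _ _ ha.2, LinearMap.sum_apply]
      congr 1
      refine Finset.sum_congr rfl fun r _ => ?_
      rw [mul_assoc, M.π_algebraMap _ (P.mul_mem_N_left _ h1), LinearMap.smul_apply,
        M.J_π _ _ ha.2])
    (fun a ha => ⟨I₀.mul_mem_left _ _ ha.1, by
      rw [map_mul, hcl]; exact M.φ_mem ha.2 _⟩)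
    (fun a ha => ⟨I₀.mul_mem_left _ _ ha.1, by
      rw [map_mul, map_mul, hcl, mul_assoc]; exact M.φ_mem (M.D_stab g hg _ ha.2) _⟩)
    M.W M.W_anti M.k M.W_zero M.W_k (fun i ξ hξ => M.Lh_W (hl u hu) hξ)
    (fun i ξ hξ => M.Lh_W (hl v hv) (M.J_W hp hg hξ)) (fun i b ξ hξ => M.R_W _ hξ)
  rw [map_add, map_smul, map_sum] at key
  simpa only [map_smul, smul_eq_mul] using key

end Loc
end HPres
end TraceRelation

section TraceEstimate
open MvPolynomial
namespace HPres
variable {n : ℕ} {V G F B : Type} [AddCommGroup V] [Module ℂ V] [Group G] [Fintype G]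
  [Ring F] [Algebra ℂ F] [Ring B] [Algebra ℂ B] [Module (MvPolynomial (Fin n) ℂ) B]
  {P : HPres n V G F B} {p : Ideal (MvPolynomial (Fin n) ℂ)}

lemma ρ_pow_orderOf (g : G) : P.ρ g ^ orderOf g = 1 := by
  rw [← map_pow, pow_orderOf_eq_one, map_one]

lemma iSup_eigenspace_ρ (g : G) : ⨆ μ, (P.ρ g).eigenspace μ = ⊤ := by
  have : FiniteDimensional ℂ V := P.b.finiteDimensional_of_finite
  have hss : (P.ρ g).IsSemisimple := by
    refine Module.End.isSemisimple_of_squarefree_aeval_eq_zero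
      (p := (Polynomial.X ^ orderOf g - 1 : Polynomial ℂ))
      (Polynomial.X_pow_sub_one_separable_iff.2 ?_).squarefree ?_
    · exact Nat.cast_ne_zero.2 (orderOf_pos g).ne'
    · rw [map_sub, map_pow, Polynomial.aeval_X, map_one, ρ_pow_orderOf, sub_self]
  simp_rw [← hss.isFinitelySemisimple.maxGenEigenspace_eq_eigenspace]
  exact Module.End.iSup_maxGenEigenspace_eq_top _

lemma exists_eigen_generators (hp : ∀ f, f ∈ p ↔ P.sym (P.pr (P.stab p)) f = 0) {g : G}
    (hg : g ∈ P.stab p) (hfix : ∀ v, P.ρ g v = v → P.pr (P.stab p) v = 0 → v = 0) :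
    ∃ (m : ℕ) (μ : Fin m → ℂ) (w : Fin m → V), (∀ i, μ i ^ orderOf g = 1) ∧ (∀ i, μ i ≠ 1) ∧
      (∀ i, P.ρ g (w i) = μ i • w i) ∧ (∀ i, P.pr (P.stab p) (w i) = 0) ∧
      p ≤ Ideal.span (Set.range fun i => P.l (w i)) := by
  classical
  have : FiniteDimensional ℂ V := P.b.finiteDimensional_of_finite
  set Z : Set V := {w | P.pr (P.stab p) w = 0 ∧ ∃ μ : ℂ, μ ^ orderOf g = 1 ∧ μ ≠ 1 ∧
    P.ρ g w = μ • w} with hZ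
  have hprg : ∀ v, P.pr (P.stab p) (P.ρ g v) = P.pr (P.stab p) v := fun v => by
    rw [pr_apply, pr_apply]
    congr 1
    refine Fintype.sum_equiv (Equiv.mulRight (⟨g, hg⟩ : P.stab p)) _ _ fun γ => ?_
    simp
  have hspan : ∀ v, v - P.pr (P.stab p) v ∈ Submodule.span ℂ Z := fun v => by
    have hv : v ∈ ⨆ μ, (P.ρ g).eigenspace μ := by rw [iSup_eigenspace_ρ]; trivial
    refine Submodule.iSup_induction (fun μ => (P.ρ g).eigenspace μ)
      (motive := fun v => v - P.pr (P.stab p) v ∈ Submodule.span ℂ Z) hv (fun μ v hv => ?_) ?_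
      fun v v' h h' => ?_
    · rw [Module.End.mem_eigenspace_iff] at hv
      by_cases hv0 : v = 0
      · rw [hv0, map_zero, sub_zero]; exact Submodule.zero_mem _
      have hpow : ∀ k : ℕ, (P.ρ g ^ k) v = μ ^ k • v := fun k => by
        induction k with
        | zero => simp
        | succ k ih => rw [pow_succ, Module.End.mul_apply, hv, map_smul, ih, smul_smul, pow_succ, mul_comm]
      have hμ : μ ^ orderOf g = 1 := by
        have := hpow (orderOf g)
        rw [ρ_pow_orderOf, Module.End.one_apply] at this
        by_contra hne
        have h2 : (μ ^ orderOf g - 1) • v = 0 := by rw [sub_smul, one_smul, ← this, sub_self]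
        exact (smul_eq_zero.1 h2).elim (fun h => hne (sub_eq_zero.1 h)) hv0
      have h1 : P.pr (P.stab p) (v - P.pr (P.stab p) v) = 0 := by
        rw [map_sub, pr_pr, sub_self]
      have h2 : P.ρ g (v - P.pr (P.stab p) v) = μ • (v - P.pr (P.stab p) v) := by
        rw [map_sub, hv, ρ_pr hg, smul_sub, ← map_smul, ← hv, hprg]
      by_cases hμ1 : μ = 1
      · rw [hμ1, one_smul] at h2
        rw [hfix _ h2 h1]; exact Submodule.zero_mem _
      · exact Submodule.subset_span ⟨h1, μ, hμ, hμ1, h2⟩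
    · rw [map_zero, sub_zero]; exact Submodule.zero_mem _
    · rw [map_add, add_sub_add_comm]; exact add_mem h h'
  obtain ⟨T, hTZ, hT⟩ := (Submodule.fg_span_iff_fg_span_finset_subset (R := ℂ) Z).1 (IsNoetherian.noetherian _)
  choose! μ hμ using fun w (hw : w ∈ Z) => hw.2
  have hTm : ∀ i, (T.equivFin.symm i : V) ∈ Z := fun i => hTZ (T.equivFin.symm i).2
  refine ⟨T.card, fun i => μ (T.equivFin.symm i), fun i => T.equivFin.symm i,
    fun i => (hμ _ (hTm i)).1, fun i => (hμ _ (hTm i)).2.1, fun i => (hμ _ (hTm i)).2.2,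
    fun i => (hTm i).1, fun f hf => ?_⟩
  set I := Ideal.span (Set.range fun i => P.l (T.equivFin.symm i : V)) with hI
  have hlI : ∀ v ∈ Submodule.span ℂ Z, P.l v ∈ I := fun v hv => by
    rw [hT] at hv
    induction hv using Submodule.span_induction with
    | mem w hw =>
      refine Ideal.subset_span ⟨T.equivFin ⟨w, hw⟩, ?_⟩
      simp
    | zero => rw [map_zero]; exact I.zero_mem
    | add v v' _ _ h h' => rw [map_add]; exact I.add_mem h h'
    | smul c v _ h => rw [map_smul, smul_eq_C_mul]; exact I.mul_mem_left _ h
  have : (Ideal.Quotient.mkₐ ℂ I) = (Ideal.Quotient.mkₐ ℂ I).comp (P.sym (P.pr (P.stab p))) := by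
    refine P.algHom_ext_l fun v => ?_
    rw [AlgHom.comp_apply, sym_l]
    refine (Ideal.Quotient.eq).2 ?_
    rw [← map_sub]
    exact hlI _ (hspan v)
  have h2 := DFunLike.congr_fun this f
  rw [AlgHom.comp_apply, (hp f).1 hf, map_zero] at h2
  exact Ideal.Quotient.eq_zero_iff_mem.1 h2

namespace Loc
variable {s : ℕ}
  {θ : MvPolynomial (Fin s) ℂ →ₐ[ℂ] MvPolynomial (Fin n) ℂ} {K : Type} [Field K]
  [Algebra (MvPolynomial (Fin s) ℂ) K] [IsFractionRing (MvPolynomial (Fin s) ℂ) K]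
  [Algebra ℂ K] [IsScalarTower ℂ (MvPolynomial (Fin s) ℂ) K]
  {I₀ : TwoSidedIdeal F}

lemma exists_trBound_of_fixed (hp : ∀ f, f ∈ p ↔ P.sym (P.pr (P.stab p)) f = 0) {g : G}
    (hg : g ∈ P.stab p) (hfix : ∀ v, P.ρ g v = v → P.pr (P.stab p) v = 0 → v = 0) (c : ℕ)
    {ε : ℝ} (hε : 0 < ε) : ∃ C : ℝ, 0 ≤ C ∧ ∀ (I₁ : TwoSidedIdeal F) (M : P.Loc p θ K I₀ I₁)
      [FiniteDimensional K M.N], codim (M.W 1) ≤ c →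
      TrBound (LinearMap.trace K M.N (M.J g)) (ε * Module.finrank K M.N + C) := by
  obtain ⟨m, μ, w, hμ, hμ1, hw, hprw, hpw⟩ := exists_eigen_generators hp hg hfix
  obtain ⟨C, hC, h⟩ := exists_trBound_trace (K := K) (orderOf g) (orderOf_pos g) m μ hμ hμ1 ε hε
  refine ⟨C * c, by positivity, fun I₁ M _ hc => ?_⟩
  refine (h (M.J g) (by rw [J_pow M hg, pow_orderOf_eq_one, J_one]) (fun i => M.Lh (P.l (w i)))
    (fun i j => M.Lh_comm _ _) fun i => ?_).mono ?_
  · rw [J_Lh, P.act_l, hw, map_smul, smul_eq_C_mul, map_mul, Lh_C, smul_one_mul, smul_mul_assoc]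
  · gcongr
    refine le_trans (Nat.cast_le.2 (codim_anti ?_)) (Nat.cast_le.2 hc)
    refine M.W_le fun f hf => ?_
    rw [pow_one] at hf
    have hf' := hpw hf
    clear hf
    induction hf' using Submodule.span_induction with
    | mem f hf =>
      obtain ⟨i, rfl⟩ := hf
      exact fun ξ => Submodule.mem_iSup_of_mem i ⟨ξ, rfl⟩
    | zero => intro ξ; rw [map_zero]; exact Submodule.zero_mem _
    | add f f' _ _ h h' => intro ξ; rw [map_add]; exact add_mem (h ξ) (h' ξ)
    | smul r f _ h => intro ξ; rw [smul_eq_mul, mul_comm, map_mul]; exact h _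

theorem exists_trBound_J (h₀ : P.Sat I₀) (hp : ∀ f, f ∈ p ↔ P.sym (P.pr (P.stab p)) f = 0)
    (hθG : ∀ g o, P.act g (θ o) = θ o) (hθ : ∀ f ∉ p, ∃ o ≠ 0, ∃ b, θ o - f * b ∈ p) (c : ℕ) {g : G}
    (hg : g ∈ P.stab p) {ε : ℝ} (hε : 0 < ε) : ∃ C : ℝ, 0 ≤ C ∧ ∀ (I₁ : TwoSidedIdeal F)
      (M : P.Loc p θ K I₀ I₁) [FiniteDimensional K M.N], I₁ ≤ I₀ → P.Sat I₁ → codim (M.W 1) ≤ c →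
      TrBound (LinearMap.trace K M.N (M.J g)) (ε * Module.finrank K M.N + C) := by
  classical
  induction hd : Module.finrank ℂ (LinearMap.ker (P.ρ g - 1)) using Nat.strong_induction_on
    generalizing g ε with
  | _ d ih =>
  by_cases hfix : ∀ v, P.ρ g v = v → P.pr (P.stab p) v = 0 → v = 0
  · obtain ⟨C, hC, h⟩ := exists_trBound_of_fixed (θ := θ) (K := K) (I₀ := I₀) hp hg hfix c hε
    exact ⟨C, hC, fun I₁ M _ _ _ hc => h I₁ M hc⟩
  push Not at hfix
  obtain ⟨u, hgu, hpu, hu0⟩ := hfix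
  obtain ⟨v, hgv, hpv, huv⟩ : ∃ v, P.ρ g v = v ∧ P.pr (P.stab p) v = 0 ∧ P.ω u v = 1 := by
    have : ∃ v, P.ω u v ≠ 0 := by
      by_contra! h
      exact hu0 (P.ω_nondeg u h)
    obtain ⟨v₀, hv₀⟩ := this
    have hfu : P.pr (Subgroup.zpowers g) u = u := pr_eq_self fun h hh => by
      have : Subgroup.zpowers g ≤ (MulAction.stabilizer (Module.End ℂ V)ˣ u).comap P.ρ.toHomUnits := by
        rw [Subgroup.zpowers_le]
        exact hgu
      exact this hh
    set v₁ := P.pr (Subgroup.zpowers g) v₀ with hv₁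
    have h1 : P.ω u (v₁ - P.pr (P.stab p) v₁) = P.ω u v₀ := by
      have h2 : P.ω u (P.pr (P.stab p) v₁) = 0 := by rw [← ω_pr, hpu]; simp
      have h3 : P.ω u v₁ = P.ω u v₀ := by rw [hv₁, ← ω_pr, hfu]
      rw [map_sub, h2, h3, sub_zero]
    refine ⟨(P.ω u v₀)⁻¹ • (v₁ - P.pr (P.stab p) v₁), ?_, ?_, ?_⟩
    · rw [map_smul, map_sub, ρ_pr hg, ρ_pr (Subgroup.mem_zpowers g)]
    · rw [map_smul, map_sub, pr_pr, sub_self, smul_zero]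
    · rw [map_smul, h1, smul_eq_mul, inv_mul_cancel₀ hv₀]
  set A : ℝ := ∑ r, ‖P.κ r u v‖ with hA
  have hA0 : 0 ≤ A := Finset.sum_nonneg fun _ _ => norm_nonneg _
  have hη : 0 < ε / (A + 1) := by positivity
  have hterm : ∀ r, ∃ C : ℝ, 0 ≤ C ∧ ∀ (I₁ : TwoSidedIdeal F) (M : P.Loc p θ K I₀ I₁)
      [FiniteDimensional K M.N], I₁ ≤ I₀ → P.Sat I₁ → codim (M.W 1) ≤ c →
      TrBound (algebraMap ℂ K (P.κ r u v) * LinearMap.trace K M.N (M.J (r * g)))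
        (‖P.κ r u v‖ * (ε / (A + 1) * Module.finrank K M.N + C)) := fun r => by
    by_cases hκ : P.κ r u v = 0
    · refine ⟨0, le_rfl, fun I₁ M _ _ _ _ => ⟨0, ?_, ?_⟩⟩ <;> simp [hκ]
    by_cases hr : r * g ∈ P.stab p
    · obtain ⟨C, hC, h⟩ := ih _ (hd ▸ P.κ_codim g r u v hgu hgv hκ) hr hη rfl
      exact ⟨C, hC, fun I₁ M _ hI h₁ hc => (h I₁ M hI h₁ hc).mul _⟩
    · refine ⟨0, le_rfl, fun I₁ M _ _ _ _ => ⟨0, ?_, ?_⟩⟩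
      · rw [M.trace_J_eq_zero hθ hr]; simp
      · rw [norm_zero]; positivity
  choose C hC h using hterm
  refine ⟨∑ r, ‖P.κ r u v‖ * C r, Finset.sum_nonneg fun r _ => mul_nonneg (norm_nonneg _) (hC r),
    fun I₁ M _ hI h₁ hc => ?_⟩
  have hrel := M.trace_relation hI h₀ h₁ hp hθG hg hpu hpv hgu
  rw [huv, map_one, one_mul] at hrel
  rw [eq_neg_of_add_eq_zero_left hrel, ← neg_one_mul, ← map_one (algebraMap ℂ K), ← map_neg]
  refine ((TrBound.sum Finset.univ fun r _ => h r I₁ M hI h₁ hc).mul (-1)).mono ?_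
  rw [norm_neg, norm_one, one_mul]
  simp only [mul_add, Finset.sum_add_distrib, ← Finset.sum_mul, ← hA]
  have hAε : A * (ε / (A + 1)) ≤ ε := by
    rw [mul_div_assoc', div_le_iff₀ (by positivity)]
    nlinarith
  rw [← mul_assoc]
  gcongr

end Loc
end HPres
end TraceEstimate

section DescendingChain
open MvPolynomial

lemma exists_notMem_mul_mem_of_mem_pow {R : Type*} [CommRing R] {I p : Ideal R} [p.IsPrime]
    (hfg : p.FG) (h : ∀ q : Ideal R, q.IsPrime → I ≤ q → q ≤ p → q = p) :
    ∃ t ∉ p, ∃ k : ℕ, ∀ f ∈ p ^ k, t * f ∈ I := by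
  obtain ⟨S, hS⟩ := hfg
  have hSp : ∀ f ∈ S, f ∈ p := fun f hf => hS ▸ Ideal.subset_span hf
  choose! t ht k hk using fun f (hf : f ∈ p) => exists_notMem_mul_pow_mem h hf
  have hprod : ∏ f ∈ S, t f ∉ p := fun hmem => by
    obtain ⟨f, hf, hfp⟩ := (Ideal.IsPrime.prod_mem_iff (p := p)).1 hmem
    exact ht f (hSp f hf) hfp
  obtain ⟨m, hm⟩ := Ideal.exists_pow_le_of_le_radical_of_fg
    (I := p) (J := Submodule.comap (LinearMap.mulLeft R (∏ f ∈ S, t f)) I) (by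
      rw [← hS, Ideal.span_le]
      intro f hf
      refine ⟨k f, ?_⟩
      obtain ⟨r, hr⟩ := Finset.dvd_prod_of_mem t hf
      change (∏ f ∈ S, t f) * f ^ k f ∈ I
      rw [hr, mul_right_comm]
      exact I.mul_mem_right _ (hk f (hSp f hf))) ⟨S, hS⟩
  exact ⟨_, hprod, m, fun f hf => hm hf⟩

namespace HPres
variable {n : ℕ} {V G F B : Type} [AddCommGroup V] [Module ℂ V] [Group G] [Fintype G]
  [Ring F] [Algebra ℂ F] [Ring B] [Algebra ℂ B] [Module (MvPolynomial (Fin n) ℂ) B]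
  (P : HPres n V G F B)

lemma mul_mem_ann {I₀ I₁ I₂ : TwoSidedIdeal F} {f g : MvPolynomial (Fin n) ℂ}
    (hf : f ∈ P.ann I₀ I₁) (hg : g ∈ P.ann I₁ I₂) : f * g ∈ P.ann I₀ I₂ := fun y hy => by
  rw [mul_comm, map_mul, mul_assoc]
  exact hg _ (hf y hy)

lemma exists_mul_mem_ann_of_chain {p : Ideal (MvPolynomial (Fin n) ℂ)} [hp : p.IsPrime]
    (I : ℕ → TwoSidedIdeal F) (h : ∀ i (q : Ideal (MvPolynomial (Fin n) ℂ)), q.IsPrime →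
      P.ann (I i) (I (i + 1)) ≤ q → q ≤ p → q = p) (a m : ℕ) :
    ∃ t ∉ p, ∃ k : ℕ, ∀ f ∈ p ^ k, t * f ∈ P.ann (I a) (I (a + m)) := by
  induction m with
  | zero =>
    refine ⟨1, fun h1 => hp.ne_top ((Ideal.eq_top_iff_one _).2 h1), 0, fun f _ y hy => ?_⟩
    exact P.mul_mem_N_left _ hy
  | succ m ih =>
    obtain ⟨t, ht, k, hk⟩ := ih
    obtain ⟨t', ht', k', hk'⟩ :=
      exists_notMem_mul_mem_of_mem_pow (IsNoetherian.noetherian p) (h (a + m))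
    refine ⟨t * t', hp.mul_notMem ht ht', k + k', fun f hf => ?_⟩
    rw [pow_add] at hf
    induction hf using Submodule.mul_induction_on' with
    | mem_mul_mem x hx y hy =>
      rw [mul_mul_mul_comm]
      exact P.mul_mem_ann (hk x hx) (hk' y hy)
    | add x _ y _ hx hy => rw [mul_add]; exact add_mem hx hy

lemma not_forall_ann_le {p : Ideal (MvPolynomial (Fin n) ℂ)} [hpp : p.IsPrime]
    (hp : ∀ f, f ∈ p ↔ P.sym (P.pr (P.stab p)) f = 0) (I : ℕ → TwoSidedIdeal F)
    (hI : Antitone I) (hS : ∀ i, P.Sat (I i))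
    (h : ∀ m, ∃ t ∉ p, ∃ k : ℕ, ∀ f ∈ p ^ k, t * f ∈ P.ann (I 0) (I m)) :
    ¬ ∀ i, P.ann (I i) (I (i + 1)) ≤ p := fun hann => by
  obtain ⟨s, θ, hθG, hθp, hθ, q, a, ha⟩ := P.exists_normalization p
  let K := FractionRing (MvPolynomial (Fin s) ℂ)
  have := P.isNoetherian
  obtain ⟨r, y, hy⟩ := Submodule.fg_iff_exists_fin_generating_family.1
    (IsNoetherian.noetherian (P.N (I 0)))
  have h1 : (1 : G) ∈ P.stab p := one_mem _
  obtain ⟨C, hC, hbound⟩ := Loc.exists_trBound_J (K := K) (hS 0) hp hθG hθ (q * r) h1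
    (ε := 1 / 2) (by norm_num)
  obtain ⟨m, hm⟩ := exists_nat_gt (2 * C)
  obtain ⟨M⟩ := P.exists_loc hp θ K hθG hθ (hI (Nat.zero_le m)) (h m)
  have := M.finiteDimensional ha hy
  obtain ⟨τ, hτ, hle⟩ := hbound _ M (hI (Nat.zero_le m)) (hS m) (M.codim_W_one_le ha hy)
  rw [M.J_one, LinearMap.trace_one, ← map_natCast (algebraMap ℂ K)] at hτ
  have hτ' := (algebraMap ℂ K).injective hτ
  have hge := M.le_finrank hθp hpp I hI m rfl rfl hann
  rw [hτ', Complex.norm_natCast] at hle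
  have : (m : ℝ) ≤ Module.finrank K M.N := Nat.cast_le.2 hge
  linarith

/-- A descending chain of saturated ideals has eventually constant image in the reduced algebra. -/
theorem exists_N_eq (I : ℕ → TwoSidedIdeal F) (hI : Antitone I) (hS : ∀ i, P.Sat (I i)) :
    ∃ i, P.N (I (i + 1)) = P.N (I i) := by
  by_contra! hne
  have hNI : ∀ {i j}, i ≤ j → P.N (I j) ≤ P.N (I i) := fun h => P.N_mono (hI h)
  have htop : ∀ i, P.ann (I i) (I (i + 1)) ≠ ⊤ := fun i h => hne i <|
    le_antisymm (hNI (Nat.le_succ i)) fun y hy => by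
      have : (1 : MvPolynomial (Fin n) ℂ) ∈ P.ann (I i) (I (i + 1)) := h ▸ Submodule.mem_top
      simpa using this y hy
  set X₀ : Set (Ideal (MvPolynomial (Fin n) ℂ)) :=
    Set.range fun H : Subgroup G => RingHom.ker (P.sym (P.pr H)) with hX₀
  have hX₀f : X₀.Finite := Set.finite_range _
  have hmem : ∀ i, ∀ p ∈ (P.ann (I i) (I (i + 1))).minimalPrimes, p ∈ X₀ := fun i p hp =>
    ⟨P.stab p, Ideal.ext fun f => (P.mem_minimal_iff (hS _) (hS _) hp f).symm⟩
  set X := {p ∈ X₀ | ∃ᶠ i in Filter.atTop, p ∈ (P.ann (I i) (I (i + 1))).minimalPrimes} with hX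
  have hev : ∀ᶠ i in Filter.atTop, ∀ p ∈ (P.ann (I i) (I (i + 1))).minimalPrimes, p ∈ X := by
    have : ∀ᶠ i in Filter.atTop, ∀ p ∈ X₀ \ X, p ∉ (P.ann (I i) (I (i + 1))).minimalPrimes := by
      rw [Filter.eventually_all_finite (hX₀f.subset Set.sdiff_subset)]
      intro p hp
      by_contra hcon
      exact hp.2 ⟨hp.1, hcon⟩
    filter_upwards [this] with i hi p hp
    by_contra hpX
    exact hi p ⟨hmem i p hp, hpX⟩ hp
  obtain ⟨i₀, hi₀⟩ := Filter.eventually_atTop.1 hev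
  have hXne : X.Nonempty := by
    obtain ⟨p, hp⟩ := Ideal.nonempty_minimalPrimes (htop i₀)
    exact ⟨p, hi₀ i₀ le_rfl p hp⟩
  obtain ⟨p, hpX⟩ := (hX₀f.subset (Set.sep_subset _ _) : X.Finite).exists_minimal hXne
  have hfreq := Filter.extraction_of_frequently_atTop
    (hpX.prop.2.and_eventually (Filter.eventually_ge_atTop i₀))
  obtain ⟨f, hf, hfp⟩ := hfreq
  have hpp : p.IsPrime := (hfp 0).1.1.1
  have hmin : ∀ i (q : Ideal (MvPolynomial (Fin n) ℂ)), q.IsPrime →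
      P.ann (I (i₀ + i)) (I (i₀ + (i + 1))) ≤ q → q ≤ p → q = p := fun i q hq hiq hqp => by
    obtain ⟨q', hq', hq'q⟩ := Ideal.exists_minimalPrimes_le hiq
    have := hpX.le_of_le (hi₀ _ (Nat.le_add_right _ _) q' hq') (hq'q.trans hqp)
    exact le_antisymm hqp (this.trans hq'q)
  refine P.not_forall_ann_le (p := p) (P.mem_minimal_iff (hS _) (hS _) (hfp 0).1) (fun i => I (f i))
    (fun i j hij => hI (hf.monotone hij)) (fun i => hS _) (fun m => ?_) fun i => ?_
  · obtain ⟨t, ht, k, hk⟩ := P.exists_mul_mem_ann_of_chain (fun i => I (i₀ + i)) hmin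
      (f 0 - i₀) (f m - f 0)
    have h0 := (hfp 0).2
    have h1 := hf.monotone (Nat.zero_le m)
    rw [show i₀ + (f 0 - i₀) = f 0 by lia, show i₀ + (f 0 - i₀ + (f m - f 0)) = f m by lia] at hk
    exact ⟨t, ht, k, hk⟩
  · refine le_trans (b := P.ann (I (f i)) (I (f i + 1))) (fun g hg y hy => ?_) (hfp i).1.1.2
    exact hNI (hf (Nat.lt_succ_self i)) (hg y hy)

end HPres
end DescendingChain

section Rees
open Polynomial

/-- An algebra generated by a symplectic vector space and a finite group acting on it, in which
the commutators of vectors are given by the symplectic form and the forms `κ`. -/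
structure Pres (n : ℕ) (V G A : Type) [AddCommGroup V] [Module ℂ V] [Group G] [Fintype G]
    [Ring A] [Algebra ℂ A] where
  b : Module.Basis (Fin n) ℂ V
  ρ : G →* Module.End ℂ V
  ω : V →ₗ[ℂ] V →ₗ[ℂ] ℂ
  ω_alt : ∀ v, ω v v = 0
  ω_nondeg : ∀ v, (∀ w, ω v w = 0) → v = 0
  ω_inv : ∀ g u v, ω (ρ g u) (ρ g v) = ω u v
  κ : G → V →ₗ[ℂ] V →ₗ[ℂ] ℂ
  κ_left : ∀ s u v, ρ s u = u → κ s u v = 0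
  κ_right : ∀ s u v, ρ s v = v → κ s u v = 0
  κ_codim : ∀ g s u v, ρ g u = u → ρ g v = v → κ s u v ≠ 0 →
    Module.finrank ℂ (LinearMap.ker (ρ (s * g) - 1)) < Module.finrank ℂ (LinearMap.ker (ρ g - 1))
  ι : V →ₗ[ℂ] A
  j : G →* A
  j_ι : ∀ g u, j g * ι u = ι (ρ g u) * j g
  comm : ∀ u v, ι u * ι v - ι v * ι u = algebraMap ℂ A (ω u v) + ∑ s, κ s u v • j s
  gen : Algebra.adjoin ℂ (Set.range ι ∪ Set.range j) = ⊤

namespace Pres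
variable {n : ℕ} {V G A : Type} [AddCommGroup V] [Module ℂ V] [Group G] [Fintype G]
  [Ring A] [Algebra ℂ A] (Q : Pres n V G A)

/-- The generators of the Rees algebra. -/
noncomputable def reesGens : Set A[X] :=
  {X} ∪ Set.range (fun v => monomial 1 (Q.ι v)) ∪ Set.range fun g => monomial 0 (Q.j g)

/-- The Rees algebra of the filtration in which vectors have degree one. -/
noncomputable abbrev Rees : Subalgebra ℂ A[X] := Algebra.adjoin ℂ Q.reesGens

lemma X_mem : X ∈ Q.Rees := Algebra.subset_adjoin (Or.inl (Or.inl rfl))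

lemma monomial_ι_mem (v : V) : monomial 1 (Q.ι v) ∈ Q.Rees :=
  Algebra.subset_adjoin (Or.inl (Or.inr ⟨v, rfl⟩))

lemma monomial_j_mem (g : G) : monomial 0 (Q.j g) ∈ Q.Rees :=
  Algebra.subset_adjoin (Or.inr ⟨g, rfl⟩)

/-- The parameter of the Rees algebra. -/
noncomputable def T : Q.Rees := ⟨X, Q.X_mem⟩

/-- The vectors, in degree one. -/
noncomputable def ιR : V →ₗ[ℂ] Q.Rees where
  toFun v := ⟨monomial 1 (Q.ι v), Q.monomial_ι_mem v⟩
  map_add' u v := Subtype.ext <| by simp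
  map_smul' c v := Subtype.ext <| by
    change monomial 1 (Q.ι (c • v)) = c • monomial 1 (Q.ι v)
    rw [map_smul, smul_monomial]

/-- The group elements, in degree zero. -/
noncomputable def jR : G →* Q.Rees where
  toFun g := ⟨monomial 0 (Q.j g), Q.monomial_j_mem g⟩
  map_one' := Subtype.ext <| by simp
  map_mul' g h := Subtype.ext <| by simp

lemma T_central (a : Q.Rees) : Q.T * a = a * Q.T := Subtype.ext (X_mul (p := (a : A[X])))

lemma coeff_TT (a : Q.Rees) (k : ℕ) : (↑(Q.T * Q.T * a) : A[X]).coeff (k + 2) =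
    (a : A[X]).coeff k := by
  change (X * X * (a : A[X])).coeff (k + 1 + 1) = _
  rw [mul_assoc, coeff_X_mul, coeff_X_mul]

lemma coeff_TT_of_lt (a : Q.Rees) {k : ℕ} (hk : k < 2) :
    (↑(Q.T * Q.T * a) : A[X]).coeff k = 0 := by
  change (X * X * (a : A[X])).coeff k = _
  rw [← pow_two, coeff_X_pow_mul', if_neg (by lia)]

lemma comm_R (u v : V) : Q.ιR u * Q.ιR v - Q.ιR v * Q.ιR u =
    Q.T * Q.T * (algebraMap ℂ Q.Rees (Q.ω u v) + ∑ s, Q.κ s u v • Q.jR s) := by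
  refine Subtype.ext ?_
  have h1 : ((Q.ιR u * Q.ιR v - Q.ιR v * Q.ιR u : Q.Rees) : A[X]) =
      monomial 2 (Q.ι u * Q.ι v - Q.ι v * Q.ι u) := by
    rw [map_sub]
    change monomial 1 (Q.ι u) * monomial 1 (Q.ι v) - monomial 1 (Q.ι v) * monomial 1 (Q.ι u) = _
    rw [monomial_mul_monomial, monomial_mul_monomial]
  have h2 : ((algebraMap ℂ Q.Rees (Q.ω u v) + ∑ s, Q.κ s u v • Q.jR s : Q.Rees) : A[X]) =
      monomial 0 (algebraMap ℂ A (Q.ω u v) + ∑ s, Q.κ s u v • Q.j s) := by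
    rw [map_add, map_sum, AddMemClass.coe_add, AddSubmonoidClass.coe_finsetSum]
    congr 1
    exact Finset.sum_congr rfl fun s _ => smul_monomial _ _ _
  rw [h1, MulMemClass.coe_mul, h2, Q.comm]
  change _ = X * X * _
  rw [← pow_two, X_pow_mul, monomial_zero_left, C_mul_X_pow_eq_monomial]

lemma gen_R : Algebra.adjoin ℂ ({Q.T} ∪ Set.range Q.ιR ∪ Set.range Q.jR) = ⊤ := by
  rw [← Algebra.adjoin_adjoin_coe_preimage (R := ℂ) (s := Q.reesGens)]
  congr 1
  ext a
  simp only [Set.mem_union, Set.mem_singleton_iff, Set.mem_range, reesGens, Subtype.ext_iff]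
  rfl

lemma monomial_coeff_mem {a : A[X]} (ha : a ∈ Q.Rees) (k : ℕ) :
    monomial k (a.coeff k) ∈ Q.Rees := by
  have hmon : ∀ (k m : ℕ) (x : A), monomial m x ∈ Q.Rees →
      monomial k ((monomial m x).coeff k) ∈ Q.Rees := fun k m x hx => by
    rw [coeff_monomial]
    split_ifs with h
    · exact h ▸ hx
    · rw [monomial_zero_right]; exact zero_mem _
  induction ha using Algebra.adjoin_induction generalizing k with
  | mem a ha =>
    obtain (rfl | ⟨v, rfl⟩) | ⟨g, rfl⟩ := ha
    · exact hmon k 1 1 Q.X_mem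
    · exact hmon k 1 _ (Q.monomial_ι_mem v)
    · exact hmon k 0 _ (Q.monomial_j_mem g)
  | algebraMap z => exact hmon k 0 _ (algebraMap_mem Q.Rees z)
  | add a a' _ _ h h' =>
    rw [coeff_add, map_add]
    exact add_mem (h k) (h' k)
  | mul a a' _ _ h h' =>
    rw [coeff_mul, map_sum]
    refine sum_mem fun x hx => ?_
    rw [← Finset.HasAntidiagonal.mem_antidiagonal.1 hx, ← monomial_mul_monomial]
    exact mul_mem (h _) (h' _)

lemma monomial_mem_of_le {m m' : ℕ} (h : m ≤ m') {x : A} (hx : monomial m x ∈ Q.Rees) :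
    monomial m' x ∈ Q.Rees := by
  obtain ⟨k, rfl⟩ := Nat.exists_eq_add_of_le' h
  have := mul_mem (pow_mem Q.X_mem k) hx
  rwa [X_pow_eq_monomial, monomial_mul_monomial, one_mul] at this

lemma exists_monomial_mem (x : A) : ∃ m, monomial m x ∈ Q.Rees := by
  have hx : x ∈ Algebra.adjoin ℂ (Set.range Q.ι ∪ Set.range Q.j) := by rw [Q.gen]; trivial
  induction hx using Algebra.adjoin_induction with
  | mem x hx =>
    obtain ⟨v, rfl⟩ | ⟨g, rfl⟩ := hx
    · exact ⟨1, Q.monomial_ι_mem v⟩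
    · exact ⟨0, Q.monomial_j_mem g⟩
  | algebraMap z => exact ⟨0, algebraMap_mem Q.Rees z⟩
  | add x y _ _ h h' =>
    obtain ⟨m, hm⟩ := h
    obtain ⟨m', hm'⟩ := h'
    refine ⟨max m m', ?_⟩
    rw [map_add]
    exact add_mem (Q.monomial_mem_of_le (le_max_left _ _) hm)
      (Q.monomial_mem_of_le (le_max_right _ _) hm')
  | mul x y _ _ h h' =>
    obtain ⟨m, hm⟩ := h
    obtain ⟨m', hm'⟩ := h'
    refine ⟨m + m', ?_⟩
    rw [← monomial_mul_monomial]
    exact mul_mem hm hm'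

/-- The homogenisation of a two-sided ideal. -/
noncomputable def hom (J : TwoSidedIdeal A) : TwoSidedIdeal Q.Rees :=
  TwoSidedIdeal.ker ((mapRingHom J.ringCon.mk').comp (Q.Rees.val : Q.Rees →+* A[X]))

lemma mem_hom {J : TwoSidedIdeal A} {a : Q.Rees} :
    a ∈ Q.hom J ↔ ∀ k, (a : A[X]).coeff k ∈ J := by
  rw [hom, TwoSidedIdeal.mem_ker, Polynomial.ext_iff]
  refine forall_congr' fun k => ?_
  rw [RingHom.comp_apply, coe_mapRingHom, coeff_map, coeff_zero, ← map_zero J.ringCon.mk',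
    TwoSidedIdeal.mem_iff]
  exact RingCon.eq _

lemma hom_mono {J J' : TwoSidedIdeal A} (h : J ≤ J') : Q.hom J ≤ Q.hom J' := fun a ha => by
  rw [mem_hom] at ha ⊢
  exact fun k => h (ha k)

lemma mem_hom_of_TT_mul_mem {J : TwoSidedIdeal A} {a : Q.Rees} (h : Q.T * Q.T * a ∈ Q.hom J) :
    a ∈ Q.hom J := by
  rw [mem_hom] at h ⊢
  exact fun k => Q.coeff_TT a k ▸ h (k + 2)

/-- The ideal generated by the square of the parameter. -/
noncomputable def TTIdeal : TwoSidedIdeal Q.Rees :=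
  TwoSidedIdeal.mk' {a | ∃ c, a = Q.T * Q.T * c} ⟨0, by rw [mul_zero]⟩
    (by rintro _ _ ⟨a, rfl⟩ ⟨c, rfl⟩; exact ⟨a + c, by rw [mul_add]⟩)
    (by rintro _ ⟨a, rfl⟩; exact ⟨-a, Subtype.ext (mul_neg (X * X) (a : A[X])).symm⟩)
    (by
      rintro x _ ⟨a, rfl⟩
      refine ⟨x * a, ?_⟩
      rw [← mul_assoc, ← mul_assoc, ← Q.T_central x, mul_assoc Q.T x, ← Q.T_central x, ← mul_assoc,
        mul_assoc _ x])
    (by rintro _ y ⟨a, rfl⟩; exact ⟨a * y, by rw [mul_assoc]⟩)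

/-- The associated graded algebra up to the square of the parameter. -/
abbrev Gr : Type := Q.TTIdeal.ringCon.Quotient

/-- The reduction modulo the square of the parameter. -/
noncomputable def cls : Q.Rees →ₐ[ℂ] Q.Gr := Q.TTIdeal.ringCon.mkₐ ℂ

lemma cls_eq_zero (a : Q.Rees) : Q.cls a = 0 ↔ ∃ c, a = Q.T * Q.T * c := by
  have : a ∈ Q.TTIdeal ↔ ∃ c, a = Q.T * Q.T * c := TwoSidedIdeal.mem_mk' _ _ _ _ _ _ _
  rw [← this, TwoSidedIdeal.mem_iff, ← map_zero Q.cls]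
  exact RingCon.eq _

lemma exists_φ : ∃ φ : MvPolynomial (Fin n) ℂ →ₐ[ℂ] Q.Gr, ∀ v, φ (lin Q.b v) = Q.cls (Q.ιR v) := by
  obtain ⟨φ, hφ⟩ := exists_algHom_of_commute (fun i => Q.cls (Q.ιR (Q.b i))) fun i j => by
    rw [← map_mul Q.cls, ← map_mul Q.cls, ← sub_eq_zero, ← map_sub, cls_eq_zero]
    exact ⟨_, Q.comm_R _ _⟩
  refine ⟨φ, fun v => ?_⟩
  have : φ.toLinearMap ∘ₗ lin Q.b = Q.cls.toLinearMap ∘ₗ Q.ιR := by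
    refine Q.b.ext fun i => ?_
    rw [LinearMap.comp_apply, lin, Module.Basis.constr_basis]
    exact hφ i
  exact LinearMap.congr_fun this v

/-- The action of polynomials on the reduction of the Rees algebra. -/
noncomputable instance : Module (MvPolynomial (Fin n) ℂ) Q.Gr :=
  Module.compHom _ Q.exists_φ.choose.toRingHom

/-- The homogenised presentation attached to a presentation. -/
noncomputable def toHPres : HPres n V G Q.Rees Q.Gr where
  b := Q.b
  ρ := Q.ρ
  ω := Q.ω
  ω_alt := Q.ω_alt
  ω_nondeg := Q.ω_nondeg
  ω_inv := Q.ω_inv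
  κ := Q.κ
  κ_left := Q.κ_left
  κ_right := Q.κ_right
  κ_codim := Q.κ_codim
  T := Q.T
  T_central := Q.T_central
  T_regular a h := by
    refine Subtype.ext (Polynomial.ext fun k => ?_)
    have h' := congrArg (fun a : Q.Rees => (Q.T * a)) h
    simp only [mul_zero, ← mul_assoc] at h'
    rw [← Q.coeff_TT, h']
    rfl
  ι := Q.ιR
  j := Q.jR
  j_ι g u := Subtype.ext <| by
    change monomial 0 (Q.j g) * monomial 1 (Q.ι u) = monomial 1 (Q.ι (Q.ρ g u)) * monomial 0 (Q.j g)
    rw [monomial_mul_monomial, monomial_mul_monomial, Q.j_ι]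
  comm := Q.comm_R
  gen := Q.gen_R
  cls := Q.cls
  cls_surj := RingCon.mkₐ_surjective _
  cls_eq_zero := Q.cls_eq_zero
  φ := Q.exists_φ.choose
  φ_lin := Q.exists_φ.choose_spec
  smul_eq _ _ := rfl

lemma le_of_N_hom_le {J J' : TwoSidedIdeal A} (hJ : J ≤ J')
    (h : Q.toHPres.N (Q.hom J') ≤ Q.toHPres.N (Q.hom J)) : J' ≤ J := by
  have key : ∀ m x, x ∈ J' → monomial m x ∈ Q.Rees → x ∈ J := fun m => by
    induction m using Nat.strong_induction_on with
    | _ m ih =>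
    intro x hx hm
    set a : Q.Rees := ⟨monomial m x, hm⟩ with ha
    have ha' : a ∈ Q.hom J' := by
      rw [mem_hom]
      intro k
      rw [ha, coeff_monomial]
      split_ifs
      · exact hx
      · exact J'.zero_mem
    obtain ⟨b, hb, hab⟩ := h (Q.toHPres.cls_mem_N ha')
    have hab' : Q.cls (a - b) = 0 := by rw [map_sub, sub_eq_zero]; exact hab.symm
    obtain ⟨c, hc⟩ := (Q.cls_eq_zero _).1 hab'
    have hcJ : c ∈ Q.hom J' :=
      Q.mem_hom_of_TT_mul_mem (hc ▸ TwoSidedIdeal.sub_mem _ ha' (Q.hom_mono hJ hb))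
    have hcoeff : x - (b : A[X]).coeff m = (↑(Q.T * Q.T * c) : A[X]).coeff m := by
      rw [← hc, AddSubgroupClass.coe_sub, coeff_sub, ha, coeff_monomial, if_pos rfl]
    rw [mem_hom] at hb hcJ
    have hdiff : x - (b : A[X]).coeff m ∈ J := by
      rw [hcoeff]
      by_cases h2 : m < 2
      · rw [Q.coeff_TT_of_lt _ h2]; exact J.zero_mem
      · obtain ⟨k, rfl⟩ := Nat.exists_eq_add_of_le' (not_lt.1 h2)
        rw [Q.coeff_TT]
        exact ih k (by lia) _ (hcJ k) (Q.monomial_coeff_mem c.2 k)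
    have := J.add_mem hdiff (hb m)
    rwa [sub_add_cancel] at this
  intro x hx
  obtain ⟨m, hm⟩ := Q.exists_monomial_mem x
  exact key m x hx hm

include Q in
theorem wellFounded : WellFoundedGT (TwoSidedIdeal A) ∧ WellFoundedLT (TwoSidedIdeal A) := by
  constructor
  · have := Q.toHPres.isNoetherian
    have hmono : StrictMono fun J : TwoSidedIdeal A => Q.toHPres.N (Q.hom J) :=
      fun J J' hJ => lt_of_le_not_ge (Q.toHPres.N_mono (Q.hom_mono hJ.le))
        fun h => hJ.not_ge (Q.le_of_N_hom_le hJ.le h)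
    exact hmono.wellFoundedGT
  · refine ⟨RelEmbedding.wellFounded_iff_isEmpty.2 ⟨fun f => ?_⟩⟩
    have hf : StrictAnti f := fun i j hij => f.map_rel_iff.2 hij
    obtain ⟨i, hi⟩ := Q.toHPres.exists_N_eq (fun i => Q.hom (f i))
      (fun i j hij => Q.hom_mono (hf.antitone hij)) fun i a ha => Q.mem_hom_of_TT_mul_mem ha
    exact (hf (Nat.lt_succ_self i)).not_ge (Q.le_of_N_hom_le (hf (Nat.lt_succ_self i)).le hi.ge)

end Pres
end Rees

section Averages
variable {V : Type*} [AddCommGroup V] [Module ℂ V]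

/-- The average of the powers of an endomorphism. -/
noncomputable def avg (N : ℕ) (g : Module.End ℂ V) : Module.End ℂ V :=
  (N : ℂ)⁻¹ • ∑ k ∈ Finset.range N, g ^ k

variable {N : ℕ} {g g' h : Module.End ℂ V}

lemma pow_avg (hg : g ^ N = 1) (v : V) : g (avg N g v) = avg N g v := by
  have h0 : (g - 1) * avg N g = 0 := by
    rw [avg, mul_smul_comm, mul_geom_sum, hg, sub_self, smul_zero]
  exact sub_eq_zero.1 (LinearMap.congr_fun h0 v)

lemma avg_apply (hg : g ^ N = 1) (v : V) : avg N g (g v) = avg N g v := by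
  have h0 : avg N g * (g - 1) = 0 := by
    rw [avg, smul_mul_assoc, geom_sum_mul, hg, sub_self, smul_zero]
  have := LinearMap.congr_fun h0 v
  rw [Module.End.mul_apply, LinearMap.sub_apply, map_sub] at this
  exact sub_eq_zero.1 this

lemma avg_of_fixed (hN : 0 < N) {v : V} (hv : g v = v) : avg N g v = v := by
  have : ∀ k, (g ^ k) v = v := fun k => by
    induction k with
    | zero => simp
    | succ k ih => rw [pow_succ, Module.End.mul_apply, hv, ih]
  have hN' : (N : ℂ) ≠ 0 := Nat.cast_ne_zero.2 hN.ne'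
  rw [avg, LinearMap.smul_apply, LinearMap.sum_apply, Finset.sum_congr rfl fun k _ => this k,
    Finset.sum_const, Finset.card_range, ← Nat.cast_smul_eq_nsmul ℂ, smul_smul,
    inv_mul_cancel₀ hN', one_smul]

lemma sub_avg_mem (hN : 0 < N) (v : V) : v - avg N g v ∈ LinearMap.range (g - 1) := by
  have hk : ∀ k, v - (g ^ k) v ∈ LinearMap.range (g - 1) := fun k => by
    refine ⟨-(∑ i ∈ Finset.range k, g ^ i) v, ?_⟩
    rw [map_neg, ← Module.End.mul_apply, mul_geom_sum, LinearMap.sub_apply, Module.End.one_apply,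
      neg_sub]
  have hN' : (N : ℂ) ≠ 0 := Nat.cast_ne_zero.2 hN.ne'
  have : v - avg N g v = (N : ℂ)⁻¹ • ∑ k ∈ Finset.range N, (v - (g ^ k) v) := by
    rw [Finset.sum_sub_distrib, Finset.sum_const, Finset.card_range, smul_sub,
      ← Nat.cast_smul_eq_nsmul ℂ, smul_smul, inv_mul_cancel₀ hN', one_smul, avg,
      LinearMap.smul_apply, LinearMap.sum_apply]
  rw [this]
  exact Submodule.smul_mem _ _ (Submodule.sum_mem _ fun k _ => hk k)

lemma apply_avg (hgh : h * g = g' * h) (v : V) : h (avg N g v) = avg N g' (h v) := by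
  have hk : ∀ k, h * g ^ k = g' ^ k * h := fun k => by
    induction k with
    | zero => simp
    | succ k ih => rw [pow_succ, ← mul_assoc, ih, mul_assoc, hgh, ← mul_assoc, pow_succ]
  have : h * avg N g = avg N g' * h := by
    rw [avg, avg, mul_smul_comm, smul_mul_assoc, Finset.mul_sum, Finset.sum_mul]
    exact congrArg _ (Finset.sum_congr rfl fun k _ => hk k)
  exact LinearMap.congr_fun this v

lemma eq_zero_of_finrank_eq_two {ω : V →ₗ[ℂ] V →ₗ[ℂ] ℂ} (hω : ∀ v, ω v v = 0)
    {W : Submodule ℂ V} (hW : Module.finrank ℂ W = 2) {a b y : V} (ha : a ∈ W) (hb : b ∈ W)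
    (hy : y ∈ W) (hab : ω a b ≠ 0) (hya : ω y a = 0) (hyb : ω y b = 0) : y = 0 := by
  by_contra hy0
  have hba : ω b a ≠ 0 := fun h => by
    have := hω (a + b)
    rw [map_add, map_add, LinearMap.add_apply, LinearMap.add_apply, hω, hω, h] at this
    exact hab (by simpa using this)
  have hli : LinearIndependent ℂ ![(⟨a, ha⟩ : W), ⟨b, hb⟩, ⟨y, hy⟩] := by
    rw [Fintype.linearIndependent_iff]
    intro c hc
    have hc' := congrArg Subtype.val hc
    simp only [Fin.sum_univ_three, Matrix.cons_val_zero, Matrix.cons_val_one, Matrix.cons_val,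
      Submodule.coe_add, Submodule.coe_smul, ZeroMemClass.coe_zero] at hc'
    have h1 := congrArg (fun v => ω v a) hc'
    have h2 := congrArg (fun v => ω v b) hc'
    simp [hω, hya, hyb, hab, hba] at h1 h2
    rw [h1, h2] at hc'
    simp [hy0] at hc'
    intro i
    fin_cases i
    · exact h2
    · exact h1
    · exact hc'
  have : Module.Finite ℂ W := Module.finite_of_finrank_pos (by lia)
  have := hli.fintype_card_le_finrank
  simp [hW] at this

end Averages

section SymplecticReflectionAlgebra
open SympGamma

variable (S : SympGamma)

/-- The representation of the finite group on the symplectic vector space. -/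
def rep : S.Γ →* Module.End ℂ S.V where
  toFun g := (g : S.V ≃ₗ[ℂ] S.V).toLinearMap
  map_one' := rfl
  map_mul' _ _ := rfl

variable {S}

/-- The projection onto the image of `s - 1` along the fixed space of `s`. -/
noncomputable def moved (s : S.Γ) : Module.End ℂ S.V := 1 - avg (orderOf s) (rep S s)

lemma rep_pow_orderOf (s : S.Γ) : rep S s ^ orderOf s = 1 := by
  rw [← map_pow, pow_orderOf_eq_one, map_one]

lemma moved_add_avg (s : S.Γ) (v : S.V) : moved s v + avg (orderOf s) (rep S s) v = v := by
  rw [moved, LinearMap.sub_apply, Module.End.one_apply, sub_add_cancel]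

lemma moved_of_fixed {s : S.Γ} {v : S.V} (h : rep S s v = v) : moved s v = 0 := by
  rw [moved, LinearMap.sub_apply, avg_of_fixed (orderOf_pos s) h, Module.End.one_apply, sub_self]

lemma moved_mem (s : S.Γ) (v : S.V) : moved s v ∈ LinearMap.range (rep S s - 1) :=
  sub_avg_mem (orderOf_pos s) v

lemma rep_conj (g s : S.Γ) : rep S g * rep S s = rep S (g * s * g⁻¹) * rep S g := by
  rw [← map_mul, ← map_mul, inv_mul_cancel_right]

lemma orderOf_conj (g s : S.Γ) : orderOf (g * s * g⁻¹) = orderOf s :=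
  (MulAut.conj g).orderOf_eq s

lemma rep_avg (g s : S.Γ) (v : S.V) : rep S g (avg (orderOf s) (rep S s) v) =
    avg (orderOf (g * s * g⁻¹)) (rep S (g * s * g⁻¹)) (rep S g v) := by
  rw [orderOf_conj]
  exact apply_avg (rep_conj g s) v

lemma rep_moved (g s : S.Γ) (v : S.V) :
    rep S g (moved s v) = moved (g * s * g⁻¹) (rep S g v) := by
  rw [moved, moved, LinearMap.sub_apply, LinearMap.sub_apply, map_sub, rep_avg]
  rfl

lemma ω_rep (g : S.Γ) (u v : S.V) : S.ω (rep S g u) (rep S g v) = S.ω u v := S.symp g g.2 u v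

lemma ω_of_mem_range {s : S.Γ} {y u : S.V} (hy : y ∈ LinearMap.range (rep S s - 1))
    (hu : rep S s u = u) : S.ω y u = 0 := by
  obtain ⟨z, rfl⟩ := hy
  rw [LinearMap.sub_apply, map_sub, LinearMap.sub_apply, Module.End.one_apply]
  nth_rw 1 [← hu]
  rw [ω_rep, sub_self]

lemma ω_moved {s : S.Γ} {y : S.V} (hy : y ∈ LinearMap.range (rep S s - 1)) (u : S.V) :
    S.ω y (moved s u) = S.ω y u := by
  conv_rhs => rw [← moved_add_avg s u]
  rw [map_add, ω_of_mem_range hy (pow_avg (rep_pow_orderOf s) u), add_zero]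

/-- The alternating form attached to a group element. -/
noncomputable def kap (c : Param S) (s : S.Γ) : S.V →ₗ[ℂ] S.V →ₗ[ℂ] ℂ :=
  c.1 s • S.ω.compl₁₂ (moved s) (moved s)

lemma kap_apply (c : Param S) (s : S.Γ) (u v : S.V) :
    kap c s u v = c.1 s * S.ω (moved s u) (moved s v) := rfl

lemma kap_codim (c : Param S) {g s : S.Γ} {u v : S.V} (hu : rep S g u = u) (hv : rep S g v = v)
    (h : kap c s u v ≠ 0) : Module.finrank ℂ (LinearMap.ker (rep S (s * g) - 1)) <
      Module.finrank ℂ (LinearMap.ker (rep S g - 1)) := by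
  rw [kap_apply] at h
  have hs : S.IsSympRefl s := by
    by_contra hs
    exact h (by rw [c.2.1 s hs, zero_mul])
  have hω : S.ω (moved s u) (moved s v) ≠ 0 := right_ne_zero_of_mul h
  have hfix : ∀ x, rep S (s * g) x = x → rep S g x = x := fun x hx => by
    rw [map_mul, Module.End.mul_apply] at hx
    have hy : rep S g x - x ∈ LinearMap.range (rep S s - 1) := by
      refine ⟨-rep S g x, ?_⟩
      rw [map_neg, LinearMap.sub_apply, Module.End.one_apply, hx, neg_sub]
    have hort : ∀ w, rep S g w = w → S.ω (rep S g x - x) (moved s w) = 0 := fun w hw => by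
      rw [ω_moved hy, map_sub, LinearMap.sub_apply]
      nth_rw 1 [← hw]
      rw [ω_rep, sub_self]
    exact sub_eq_zero.1 (eq_zero_of_finrank_eq_two S.alt hs (moved_mem s u) (moved_mem s v) hy hω
      (hort u hu) (hort v hv))
  refine Submodule.finrank_lt_finrank_of_lt (SetLike.lt_iff_le_and_exists.2 ⟨fun x hx => ?_, u, ?_, ?_⟩)
  · exact sub_eq_zero.2 (hfix x (sub_eq_zero.1 hx))
  · exact sub_eq_zero.2 hu
  · intro hu'
    have h1 : rep S (s * g) u = u := sub_eq_zero.1 hu'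
    rw [map_mul, Module.End.mul_apply, hu] at h1
    rw [moved_of_fixed h1, map_zero, LinearMap.zero_apply] at hω
    exact hω rfl

variable (ωs : S.Γ → S.V →ₗ[ℂ] S.V →ₗ[ℂ] ℂ) (c : Param S)

/-- The inclusion of the vector space in the symplectic reflection algebra. -/
noncomputable def vec : S.V →ₗ[ℂ] SRA S ωs c where
  toFun v := RingQuot.mkAlgHom ℂ _ (FreeAlgebra.ι ℂ (Sum.inl v))
  map_add' u v := by
    rw [RingQuot.mkAlgHom_rel ℂ (SRARel.vadd u v), map_add]
  map_smul' a v := by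
    rw [RingQuot.mkAlgHom_rel ℂ (SRARel.vsmul a v), map_smul, RingHom.id_apply]

/-- The inclusion of the group in the symplectic reflection algebra. -/
noncomputable def grp : S.Γ →* SRA S ωs c where
  toFun g := RingQuot.mkAlgHom ℂ _ (FreeAlgebra.ι ℂ (Sum.inr g))
  map_one' := by rw [RingQuot.mkAlgHom_rel ℂ SRARel.gone, map_one]
  map_mul' g h := by rw [RingQuot.mkAlgHom_rel ℂ (SRARel.gmul g h), map_mul]

lemma grp_vec (g : S.Γ) (u : S.V) :
    grp ωs c g * vec ωs c u = vec ωs c (rep S g u) * grp ωs c g := by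
  have := RingQuot.mkAlgHom_rel ℂ (SRARel.conj (ωs := ωs) (c := c) g u)
  rwa [map_mul, map_mul] at this

lemma adjoin_vec_grp :
    Algebra.adjoin ℂ (Set.range (vec ωs c) ∪ Set.range (grp ωs c)) = ⊤ := by
  rw [← (AlgHom.range_eq_top (RingQuot.mkAlgHom ℂ (SRARel S ωs c))).2
    (RingQuot.mkAlgHom_surjective ℂ _), ← Algebra.map_top, ← FreeAlgebra.adjoin_range_ι,
    AlgHom.map_adjoin, ← Set.range_comp]
  congr 1
  rw [Sum.range_eq]
  rfl

lemma comm_vec [Fintype S.Γ] (u v : S.V) : vec ωs c u * vec ωs c v - vec ωs c v * vec ωs c u =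
    algebraMap ℂ _ (S.ω u v) + ∑ s, (c.1 s * ωs s u v) • grp ωs c s := by
  have := RingQuot.mkAlgHom_rel ℂ (SRARel.main (ωs := ωs) (c := c) u v)
  rw [map_sub, map_mul, map_mul, map_add, AlgHom.commutes, finsum_eq_sum_of_fintype, map_sum] at this
  simp_rw [map_smul] at this
  exact this

variable {ωs}

lemma apply_eq_moved (hωs : S.IsReflForms ωs) (s : S.Γ) (u v : S.V) :
    c.1 s * ωs s u v = kap c s u v +
      c.1 s * ωs s (moved s u) (avg (orderOf s) (rep S s) v) := by
  by_cases hs : S.IsSympRefl s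
  · obtain ⟨h1, h2⟩ := hωs s hs
    have h3 := (h1 (avg (orderOf s) (rep S s) u)).2 (pow_avg (rep_pow_orderOf s) u)
    rw [kap_apply, ← h2 _ _ (moved_mem s u) (moved_mem s v), ← mul_add, ← map_add, moved_add_avg]
    conv_lhs => rw [← moved_add_avg s u]
    rw [map_add, LinearMap.add_apply, h3, add_zero]
  · rw [kap_apply, c.2.1 s hs, zero_mul, zero_mul, zero_mul, zero_add]

variable [Fintype S.Γ]

lemma comm_vec_kap (hωs : S.IsReflForms ωs) (u v : S.V) :
    vec ωs c u * vec ωs c v - vec ωs c v * vec ωs c u =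
      algebraMap ℂ _ (S.ω u v) + ∑ s, kap c s u v • grp ωs c s := by
  classical
  set β : S.Γ → S.V → S.V → ℂ := fun s u v =>
    c.1 s * ωs s (moved s u) (avg (orderOf s) (rep S s) v) with hβ
  have hcomm : ∀ u v, vec ωs c u * vec ωs c v - vec ωs c v * vec ωs c u =
      algebraMap ℂ _ (S.ω u v) + ∑ s, kap c s u v • grp ωs c s + ∑ s, β s u v • grp ωs c s := by
    intro u v
    rw [comm_vec, add_assoc, ← Finset.sum_add_distrib]
    congr 1
    exact Finset.sum_congr rfl fun s _ => by rw [← add_smul, apply_eq_moved c hωs]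
  have hconj : ∀ (f : S.Γ → ℂ) (g : S.Γ), grp ωs c g⁻¹ * (∑ s, f s • grp ωs c s) * grp ωs c g =
      ∑ s, f (g * s * g⁻¹) • grp ωs c s := fun f g => by
    rw [Finset.mul_sum, Finset.sum_mul]
    refine Fintype.sum_equiv (MulAut.conj g⁻¹).toEquiv _ _ fun s => ?_
    rw [mul_smul_comm, smul_mul_assoc, ← map_mul, ← map_mul]
    simp [mul_assoc]
  have hgg : ∀ g, grp ωs c g⁻¹ * grp ωs c g = 1 := fun g => by
    rw [← map_mul, inv_mul_cancel, map_one]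
  have hvec : ∀ g u, grp ωs c g⁻¹ * vec ωs c (rep S g u) = vec ωs c u * grp ωs c g⁻¹ := fun g u => by
    rw [grp_vec, ← Module.End.mul_apply, ← map_mul, inv_mul_cancel, map_one, Module.End.one_apply]
  have hkap : ∀ g s, kap c (g * s * g⁻¹) (rep S g u) (rep S g v) = kap c s u v := fun g s => by
    rw [kap_apply, kap_apply, ← rep_moved, ← rep_moved, ω_rep, c.2.2]
  have hequi : ∀ g, ∑ s, β (g * s * g⁻¹) (rep S g u) (rep S g v) • grp ωs c s =
      ∑ s, β s u v • grp ωs c s := fun g => by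
    have h1 := congrArg (fun x => grp ωs c g⁻¹ * x * grp ωs c g) (hcomm (rep S g u) (rep S g v))
    have hprod : ∀ u v, grp ωs c g⁻¹ * (vec ωs c (rep S g u) * vec ωs c (rep S g v)) * grp ωs c g =
        vec ωs c u * vec ωs c v := fun u v => by
      rw [← mul_assoc, hvec, mul_assoc (vec ωs c u), hvec, ← mul_assoc, mul_assoc, hgg, mul_one]
    simp only [mul_add, mul_sub, add_mul, sub_mul, hprod, hconj, hkap, ω_rep] at h1
    rw [hcomm u v, ← Algebra.commutes, mul_assoc, hgg, mul_one] at h1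
    exact (add_left_cancel h1).symm
  have hβk : ∀ (k : ℕ) r u v, β r ((rep S r ^ k) u) ((rep S r ^ k) v) =
      c.1 r * ωs r ((rep S r ^ k) (moved r u)) (avg (orderOf r) (rep S r) v) := fun k r u v => by
    induction k generalizing u v with
    | zero => rfl
    | succ k ih =>
      rw [pow_succ, Module.End.mul_apply, Module.End.mul_apply, Module.End.mul_apply, ih,
        avg_apply (rep_pow_orderOf r), rep_moved, mul_inv_cancel_right]
  have hsum : ∀ r u v, ∑ k ∈ Finset.range (orderOf r), β r ((rep S r ^ k) u) ((rep S r ^ k) v) = 0 :=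
    fun r u v => by
    have hz : ∑ k ∈ Finset.range (orderOf r), (rep S r ^ k) (moved r u) = 0 := by
      have h1 : avg (orderOf r) (rep S r) (moved r u) = 0 := by
        rw [moved, LinearMap.sub_apply, map_sub,
          avg_of_fixed (orderOf_pos r) (pow_avg (rep_pow_orderOf r) u), Module.End.one_apply, sub_self]
      rw [avg, LinearMap.smul_apply, LinearMap.sum_apply] at h1
      exact (smul_eq_zero.1 h1).resolve_left
        (inv_ne_zero (Nat.cast_ne_zero.2 (orderOf_pos r).ne'))
    simp_rw [hβk]
    rw [← Finset.mul_sum, ← LinearMap.sum_apply, ← map_sum, hz, map_zero, LinearMap.zero_apply,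
      mul_zero]
  have hshift : ∀ s (k : ℕ), ∑ g, β (g * s * g⁻¹) (rep S g u) (rep S g v) =
      ∑ g, β (g * s * g⁻¹) ((rep S (g * s * g⁻¹) ^ k) (rep S g u))
        ((rep S (g * s * g⁻¹) ^ k) (rep S g v)) := fun s k => by
    refine (Fintype.sum_equiv (Equiv.mulRight (s ^ k)) _ _ fun g => ?_).symm
    have h1 : g * s ^ k * s * (g * s ^ k)⁻¹ = g * s * g⁻¹ := by
      rw [mul_assoc g, ← pow_succ, pow_succ', mul_inv_rev]
      group
    have h2 : rep S (g * s * g⁻¹) ^ k * rep S g = rep S (g * s ^ k) := by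
      rw [← map_pow, conj_pow, ← map_mul, inv_mul_cancel_right]
    rw [Equiv.coe_mulRight, h1, ← h2]
    rfl
  have hzero : ∀ s, ∑ g, β (g * s * g⁻¹) (rep S g u) (rep S g v) = 0 := fun s => by
    have h1 : ∑ k ∈ Finset.range (orderOf s), ∑ g, β (g * s * g⁻¹) (rep S g u) (rep S g v) = 0 := by
      rw [Finset.sum_congr rfl fun k _ => hshift s k, Finset.sum_comm]
      refine Finset.sum_eq_zero fun g _ => ?_
      rw [← orderOf_conj g s]
      exact hsum _ _ _
    rw [Finset.sum_const, Finset.card_range, ← Nat.cast_smul_eq_nsmul ℂ] at h1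
    exact (smul_eq_zero.1 h1).resolve_left (Nat.cast_ne_zero.2 (orderOf_pos s).ne')
  have hmain : ∑ s, β s u v • grp ωs c s = 0 := by
    have h1 : ∑ _g : S.Γ, ∑ s, β s u v • grp ωs c s = 0 := by
      rw [← Finset.sum_congr rfl fun g _ => hequi g, Finset.sum_comm]
      refine Finset.sum_eq_zero fun s _ => ?_
      rw [← Finset.sum_smul, hzero, zero_smul]
    rw [Finset.sum_const, ← Nat.cast_smul_eq_nsmul ℂ] at h1
    exact (smul_eq_zero.1 h1).resolve_left (Nat.cast_ne_zero.2 (Finset.card_ne_zero_of_mem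
      (Finset.mem_univ (1 : S.Γ))))
  rw [hcomm, hmain, add_zero]

/-- The symplectic reflection algebra as an algebra with a presentation. -/
noncomputable def presSRA (hωs : S.IsReflForms ωs) :
    Pres (Module.finrank ℂ S.V) S.V S.Γ (SRA S ωs c) where
  b := Module.finBasis ℂ S.V
  ρ := rep S
  ω := S.ω
  ω_alt := S.alt
  ω_nondeg := S.nondeg
  ω_inv := ω_rep
  κ := kap c
  κ_left s u v h := by rw [kap_apply, moved_of_fixed h, map_zero, LinearMap.zero_apply, mul_zero]
  κ_right s u v h := by rw [kap_apply, moved_of_fixed h, map_zero, mul_zero]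
  κ_codim _ _ _ _ := kap_codim c
  ι := vec ωs c
  j := grp ωs c
  j_ι := grp_vec ωs c
  comm := comm_vec_kap c hωs
  gen := adjoin_vec_grp ωs c

end SymplecticReflectionAlgebra
end SRAFin

open SympGamma in
/-- **Theorem (finite length of the regular bimodule).**
For every finite subgroup `Γ ⊂ Sp(V)` of a finite-dimensional complex symplectic vector
space and every parameter `c ∈ 𝔭`, the regular bimodule `H_c` has finite length in the
category of `H_c`-bimodules: since sub-bimodules of the regular bimodule are exactly the
two-sided ideals, this says the lattice of two-sided ideals of `H_c` satisfies both the
ascending and the descending chain condition. -/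
theorem regular_bimodule_finite_length
    (S : SympGamma) (ωs : S.Γ → S.V →ₗ[ℂ] S.V →ₗ[ℂ] ℂ) (hωs : S.IsReflForms ωs)
    (c : Param S) :
    WellFoundedGT (TwoSidedIdeal (SRA S ωs c)) ∧
      WellFoundedLT (TwoSidedIdeal (SRA S ωs c)) := by
  have := Fintype.ofFinite S.Γ
  exact (SRAFin.presSRA c hωs).wellFounded
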